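/- Let m ≥ 1 and let A = (A_{αβ}) be bounded measurable t-independent coefficients of order m on ℝ^{n+1} with ‖A‖_∞ ≤ Λ satisfying the Gårding inequality with constant λ > 0. Let Q ⊂ ℝⁿ be a cube, s₀ ∈ ℝ, and Q̃ = Q × (s₀ − ℓ(Q)/2, s₀ + ℓ(Q)/2) ⊂ ℝ^{n+1}. Suppose u has weak derivatives of order up to m in L²(2Q̃) and Lu = 0 weakly in 2Q̃. Let 0 ≤ j ≤ m, and assume additionally that the weak derivative ∂_t^{j+1} u exists and lies in L²(2Q̃) (this is automatic when j ≤ m−1). Then there is a constant C depending only on n, m, λ, Λ such that for almost every τ ∈ (s₀ − ℓ(Q)/2, s₀ + ℓ(Q)/2): ⨍_{Q̃} |∇^j u(x,t)|² dt dx ≤ C ℓ(Q)² ( ⨍_{2Q̃} |∂_t^{j+1} u(x,t)| dt dx )² + C ( ⨍_{2Q} |∇^j u(x,τ)| dx )². -/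

import Mathlib

/- STATEMENT 6: Lemma `lem:iterate` of the paper: an interior bound for `∇^j u` on a box
in terms of `∂_t^{j+1} u` and a boundary slice. -/

open MeasureTheory ENNReal Set Finset
noncomputable section

/-- The open axis-parallel cube in `ℝⁿ` with center `c` and side length `ℓ`. -/
def cube {n : ℕ} (c : Fin n → ℝ) (ℓ : ℝ) : Set (Fin n → ℝ) :=
  {x | ∀ i, |x i - c i| < ℓ / 2}

/-- Directional derivative operator on `ℝ^{n+1} = ℝⁿ × ℝ`. -/
def pdir {n : ℕ} (v : (Fin n → ℝ) × ℝ) (f : (Fin n → ℝ) × ℝ → ℂ) :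
    (Fin n → ℝ) × ℝ → ℂ :=
  fun p => fderiv ℝ f p v

/-- The `i`-th coordinate direction in `ℝ^{n+1} = ℝⁿ × ℝ`. -/
def edir (n : ℕ) (i : Fin (n + 1)) : (Fin n → ℝ) × ℝ :=
  if h : (i : ℕ) < n then (Pi.single (⟨i, h⟩ : Fin n) 1, 0) else (0, 1)

/-- Higher partial derivative `∂^γ` on `ℝ^{n+1}` for a multiindex `γ ∈ ℕ^{n+1}`. -/
def mpd {n : ℕ} (γ : Fin (n + 1) → ℕ) (f : (Fin n → ℝ) × ℝ → ℂ) :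
    (Fin n → ℝ) × ℝ → ℂ :=
  (List.finRange (n + 1)).foldr (fun i g => (pdir (edir n i))^[γ i] g) f

/-- Test functions for an open set `Ω`: smooth, compactly supported inside `Ω`. -/
def IsTest {n : ℕ} (Ω : Set ((Fin n → ℝ) × ℝ)) (φ : (Fin n → ℝ) × ℝ → ℂ) : Prop :=
  ContDiff ℝ (⊤ : ℕ∞) φ ∧ HasCompactSupport φ ∧ tsupport φ ⊆ Ω

/-- `v` is the weak derivative `∂^γ u` on `Ω`. -/
def IsWeakDeriv {n : ℕ} (Ω : Set ((Fin n → ℝ) × ℝ)) (γ : Fin (n + 1) → ℕ)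
    (u v : (Fin n → ℝ) × ℝ → ℂ) : Prop :=
  ∀ φ, IsTest Ω φ →
    ∫ p in Ω, u p * mpd γ φ p = (-1 : ℂ) ^ (∑ i, γ i) * ∫ p in Ω, v p * φ p

/-- The finset of multiindices in `ℕ^{n+1}` of length `m`. -/
def MI (n m : ℕ) : Finset (Fin (n + 1) → ℕ) := Finset.Nat.antidiagonalTuple (n + 1) m

/-- Coefficients of a divergence form operator of order `2m` on `ℝ^{n+1}`. -/
abbrev Coef (n : ℕ) := (Fin (n + 1) → ℕ) → (Fin (n + 1) → ℕ) → (Fin n → ℝ) × ℝ → ℂ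

/-- All coefficients are measurable. -/
def CoefMeasurable {n : ℕ} (A : Coef n) : Prop := ∀ α β, Measurable (A α β)

/-- The coefficients are (essentially) bounded by `Λ`. -/
def CoefBounded {n : ℕ} (m : ℕ) (A : Coef n) (Λ : ℝ) : Prop :=
  ∀ α ∈ MI n m, ∀ β ∈ MI n m, ∀ᵐ p : (Fin n → ℝ) × ℝ, ‖A α β p‖ ≤ Λ

/-- The coefficients are `t`-independent. -/
def TIndep {n : ℕ} (A : Coef n) : Prop :=
  ∀ α β (x : Fin n → ℝ) (s t : ℝ), A α β (x, s) = A α β (x, t)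

/-- The Gårding inequality with constant `lam`. -/
def Garding {n : ℕ} (m : ℕ) (A : Coef n) (lam : ℝ) : Prop :=
  ∀ φ : (Fin n → ℝ) × ℝ → ℂ, ContDiff ℝ (⊤ : ℕ∞) φ → HasCompactSupport φ →
    lam * ∑ α ∈ MI n m, ∫ p, ‖mpd α φ p‖ ^ 2 ≤
      (∑ α ∈ MI n m, ∑ β ∈ MI n m,
        ∫ p, (starRingEnd ℂ) (mpd α φ p) * A α β p * mpd β φ p).re

/-- `du` is a family of measurable weak derivatives of `u` up to order `m` on `Ω`. -/
def HasWDerivs {n : ℕ} (Ω : Set ((Fin n → ℝ) × ℝ)) (m : ℕ)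
    (u : (Fin n → ℝ) × ℝ → ℂ) (du : (Fin (n + 1) → ℕ) → (Fin n → ℝ) × ℝ → ℂ) : Prop :=
  du (fun _ => 0) = u ∧
    ∀ γ : Fin (n + 1) → ℕ, (∑ i, γ i) ≤ m →
      Measurable (du γ) ∧ IsWeakDeriv Ω γ u (du γ)

/-- `Lu = 0` weakly on `Ω`, where `du` encodes the weak derivatives of `u`. -/
def WeakSolution {n : ℕ} (m : ℕ) (A : Coef n) (Ω : Set ((Fin n → ℝ) × ℝ))
    (du : (Fin (n + 1) → ℕ) → (Fin n → ℝ) × ℝ → ℂ) : Prop :=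
  ∀ φ, IsTest Ω φ →
    ∑ α ∈ MI n m, ∑ β ∈ MI n m,
      ∫ p in Ω, (starRingEnd ℂ) (mpd α φ p) * A α β p * du β p = 0

/-- Squared magnitude `|∇^k u|²` of the `k`-th order gradient array encoded by `du`. -/
def gradSq {n : ℕ} (k : ℕ) (du : (Fin (n + 1) → ℕ) → (Fin n → ℝ) × ℝ → ℂ) :
    (Fin n → ℝ) × ℝ → ℝ≥0∞ :=
  fun p => ∑ γ ∈ MI n k, (‖du γ p‖₊ : ℝ≥0∞) ^ 2

/-- The purely vertical multiindex `(0,…,0,k)`, i.e. `∂^γ = ∂_t^k`. -/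
def vmi (n k : ℕ) : Fin (n + 1) → ℕ := fun i => if (i : ℕ) = n then k else 0

section

/-! ### Calculus of the partial derivatives `mpd γ` -/

/-- The space `ℝ^{n+1} = ℝⁿ × ℝ`. -/
abbrev Pt (n : ℕ) := (Fin n → ℝ) × ℝ

/-- Smooth functions on `ℝ^{n+1}`. -/
abbrev Smooth {n : ℕ} (f : Pt n → ℂ) : Prop := ContDiff ℝ (⊤ : ℕ∞) f

/-- The multiindex of the first order derivative in the `i`-th direction. -/
abbrev emi {n : ℕ} (i : Fin (n + 1)) : Fin (n + 1) → ℕ := Pi.single i 1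

variable {n : ℕ}

lemma smooth_zero : Smooth (0 : Pt n → ℂ) := contDiff_const

lemma Smooth.fadd {f g : Pt n → ℂ} (hf : Smooth f) (hg : Smooth g) : Smooth (f + g) :=
  hf.add hg

lemma Smooth.fsub {f g : Pt n → ℂ} (hf : Smooth f) (hg : Smooth g) : Smooth (f - g) :=
  hf.sub hg

lemma Smooth.fmul {f g : Pt n → ℂ} (hf : Smooth f) (hg : Smooth g) : Smooth (f * g) :=
  hf.mul hg

lemma Smooth.fsmul {f : Pt n → ℂ} (c : ℂ) (hf : Smooth f) : Smooth (c • f) :=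
  hf.const_smul c

lemma Smooth.differentiable' {f : Pt n → ℂ} (hf : Smooth f) : Differentiable ℝ f :=
  hf.differentiable (by simp)

lemma Smooth.pdir {f : Pt n → ℂ} (hf : Smooth f) (v : Pt n) : Smooth (pdir v f) :=
  (hf.fderiv_right (m := (⊤ : ℕ∞)) (by simp)).clm_apply contDiff_const

lemma pdir_comm {f : Pt n → ℂ} (hf : Smooth f) (v w : Pt n) :
    pdir v (pdir w f) = pdir w (pdir v f) := by
  have hd : Differentiable ℝ (fderiv ℝ f) :=
    (hf.fderiv_right (m := (⊤ : ℕ∞)) (by simp)).differentiable (by simp)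
  have key : ∀ a b : Pt n, ∀ p, _root_.pdir a (_root_.pdir b f) p
      = fderiv ℝ (fderiv ℝ f) p a b := by
    intro a b p
    unfold _root_.pdir
    rw [fderiv_clm_apply (hd p) (differentiableAt_const b)]
    simp
  funext p
  rw [key, key]
  exact (hf.contDiffAt.isSymmSndFDerivAt (by
    simpa using WithTop.coe_le_coe.2 (le_top : (2 : ℕ∞) ≤ ⊤))).eq v w

lemma Smooth.pdir_iterate {f : Pt n → ℂ} (hf : Smooth f) (v : Pt n) (k : ℕ) :
    Smooth ((_root_.pdir v)^[k] f) := by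
  induction k with
  | zero => exact hf
  | succ k ih => rw [Function.iterate_succ_apply']; exact ih.pdir v

lemma pdir_iterate_comm {f : Pt n → ℂ} (hf : Smooth f) (v w : Pt n) (k : ℕ) :
    pdir v ((pdir w)^[k] f) = (pdir w)^[k] (pdir v f) := by
  induction k with
  | zero => rfl
  | succ k ih =>
    rw [Function.iterate_succ_apply', Function.iterate_succ_apply', ← ih,
      pdir_comm (hf.pdir_iterate w k)]

lemma smooth_foldr {f : Pt n → ℂ} (hf : Smooth f) (γ : Fin (n + 1) → ℕ)
    (l : List (Fin (n + 1))) :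
    Smooth (l.foldr (fun i g => (pdir (edir n i))^[γ i] g) f) := by
  induction l with
  | nil => exact hf
  | cons a l ih => exact ih.pdir_iterate _ _

lemma Smooth.mpd {f : Pt n → ℂ} (hf : Smooth f) (γ : Fin (n + 1) → ℕ) : Smooth (mpd γ f) :=
  smooth_foldr hf γ _

lemma foldr_pdir_congr (f : Pt n → ℂ) {γ γ' : Fin (n + 1) → ℕ} (l : List (Fin (n + 1)))
    (h : ∀ i ∈ l, γ i = γ' i) :
    l.foldr (fun i g => (pdir (edir n i))^[γ i] g) f
      = l.foldr (fun i g => (pdir (edir n i))^[γ' i] g) f := by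
  induction l with
  | nil => rfl
  | cons a l ih =>
    simp only [List.foldr_cons]
    rw [ih fun i hi => h i (List.mem_cons_of_mem _ hi), h a List.mem_cons_self]

lemma foldr_pdir_add_single {f : Pt n → ℂ} (hf : Smooth f) (γ : Fin (n + 1) → ℕ)
    (k : Fin (n + 1)) (l : List (Fin (n + 1))) (hl : l.Nodup) (hk : k ∈ l) :
    l.foldr (fun i g => (pdir (edir n i))^[(γ + emi k) i] g) f
      = pdir (edir n k) (l.foldr (fun i g => (pdir (edir n i))^[γ i] g) f) := by
  induction l with
  | nil => simp at hk
  | cons a l ih =>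
    simp only [List.foldr_cons]
    rw [List.nodup_cons] at hl
    by_cases hak : a = k
    · subst hak
      rw [foldr_pdir_congr f (γ := γ + emi a) (γ' := γ) l]
      · simp [Function.iterate_succ_apply']
      · intro i hi
        have : i ≠ a := fun h => hl.1 (h ▸ hi)
        simp [this]
    · have hkl : k ∈ l := by
        rcases List.mem_cons.1 hk with h | h
        · exact absurd h.symm hak
        · exact h
      rw [ih hl.2 hkl, pdir_iterate_comm (smooth_foldr hf γ l)]
      simp [hak]

lemma mpd_add_single {f : Pt n → ℂ} (hf : Smooth f) (γ : Fin (n + 1) → ℕ) (k : Fin (n + 1)) :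
    mpd (γ + emi k) f = pdir (edir n k) (mpd γ f) :=
  foldr_pdir_add_single hf γ k _ (List.nodup_finRange _) (List.mem_finRange _)

lemma mpd_zero (f : Pt n → ℂ) : mpd 0 f = f := by
  unfold mpd
  induction List.finRange (n + 1) with
  | nil => rfl
  | cons a l ih => simp only [List.foldr_cons, ih]; rfl

lemma mi_induction {p : (Fin (n + 1) → ℕ) → Prop} (h0 : p 0)
    (hs : ∀ γ i, p γ → p (γ + emi i)) (γ : Fin (n + 1) → ℕ) : p γ := by
  induction hk : ∑ i, γ i generalizing γ with
  | zero =>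
    have : γ = 0 := by
      funext i
      exact (Finset.sum_eq_zero_iff.1 hk) i (Finset.mem_univ i)
    rwa [this]
  | succ k ih =>
    obtain ⟨i, hi⟩ : ∃ i, γ i ≠ 0 := by
      by_contra! h
      simp [h] at hk
    have hγ : γ = (γ - emi i) + emi i := by
      funext l
      by_cases hl : l = i
      · subst hl; simp; omega
      · simp [hl]
    rw [hγ]
    apply hs
    apply ih
    have := hk
    rw [hγ] at this
    simp only [Pi.add_apply, Finset.sum_add_distrib, Finset.sum_pi_single', Finset.mem_univ,
      if_true] at this
    omega

lemma mi_sum_add_single (γ : Fin (n + 1) → ℕ) (i : Fin (n + 1)) :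
    ∑ k, (γ + emi i) k = (∑ k, γ k) + 1 := by
  simp [Finset.sum_add_distrib]

lemma mem_MI {k : ℕ} {γ : Fin (n + 1) → ℕ} : γ ∈ MI n k ↔ ∑ i, γ i = k :=
  Finset.Nat.mem_antidiagonalTuple

lemma mi_exists_pred {k : ℕ} {γ : Fin (n + 1) → ℕ} (h : ∑ i, γ i = k + 1) :
    ∃ γ' i, γ = γ' + emi i ∧ ∑ i, γ' i = k := by
  revert h
  induction γ using mi_induction with
  | h0 => intro h; simp at h
  | hs γ i _ =>
    intro h
    exact ⟨γ, i, rfl, by rw [mi_sum_add_single] at h; omega⟩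

lemma pdir_add {f g : Pt n → ℂ} (hf : Smooth f) (hg : Smooth g) (v : Pt n) :
    pdir v (f + g) = pdir v f + pdir v g := by
  funext p
  simp [pdir, fderiv_add (hf.differentiable' p) (hg.differentiable' p)]

lemma pdir_const_smul {f : Pt n → ℂ} (c : ℂ) (hf : Smooth f) (v : Pt n) :
    pdir v (c • f) = c • pdir v f := by
  funext p
  simp [pdir, fderiv_const_smul (hf.differentiable' p)]

lemma pdir_mul {f g : Pt n → ℂ} (hf : Smooth f) (hg : Smooth g) (v : Pt n) :
    pdir v (f * g) = f * pdir v g + pdir v f * g := by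
  funext p
  simp [pdir, fderiv_mul (hf.differentiable' p) (hg.differentiable' p), mul_comm]

lemma pdir_zero (v : Pt n) : pdir v (0 : Pt n → ℂ) = 0 := by
  funext p; simp [pdir]

lemma mpd_zero_fun (γ : Fin (n + 1) → ℕ) : mpd γ (0 : Pt n → ℂ) = 0 := by
  induction γ using mi_induction with
  | h0 => exact mpd_zero _
  | hs γ i ih => rw [mpd_add_single smooth_zero, ih, pdir_zero]

lemma mpd_add {f g : Pt n → ℂ} (hf : Smooth f) (hg : Smooth g) (γ : Fin (n + 1) → ℕ) :
    mpd γ (f + g) = mpd γ f + mpd γ g := by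
  induction γ using mi_induction with
  | h0 => simp only [mpd_zero]
  | hs γ i ih =>
    rw [mpd_add_single (hf.fadd hg), ih, pdir_add (hf.mpd γ) (hg.mpd γ), mpd_add_single hf,
      mpd_add_single hg]

lemma mpd_const_smul {f : Pt n → ℂ} (c : ℂ) (hf : Smooth f) (γ : Fin (n + 1) → ℕ) :
    mpd γ (c • f) = c • mpd γ f := by
  induction γ using mi_induction with
  | h0 => simp only [mpd_zero]
  | hs γ i ih =>
    rw [mpd_add_single (hf.fsmul c), ih, pdir_const_smul c (hf.mpd γ), mpd_add_single hf]

lemma mpd_sub {f g : Pt n → ℂ} (hf : Smooth f) (hg : Smooth g) (γ : Fin (n + 1) → ℕ) :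
    mpd γ (f - g) = mpd γ f - mpd γ g := by
  have h : f - g = f + (-1 : ℂ) • g := by simp [sub_eq_add_neg]
  rw [h, mpd_add hf (hg.fsmul (-1 : ℂ)), mpd_const_smul _ hg]
  simp [sub_eq_add_neg]

lemma tsupport_pdir_subset (f : Pt n → ℂ) (v : Pt n) : tsupport (pdir v f) ⊆ tsupport f := by
  refine (closure_mono ?_).trans (tsupport_fderiv_subset ℝ (f := f))
  intro p hp
  simp only [Function.mem_support] at hp ⊢
  intro h
  exact hp (by simp [pdir, h])

lemma tsupport_mpd_subset {f : Pt n → ℂ} (hf : Smooth f) (γ : Fin (n + 1) → ℕ) :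
    tsupport (mpd γ f) ⊆ tsupport f := by
  induction γ using mi_induction with
  | h0 => rw [mpd_zero]
  | hs γ i ih => rw [mpd_add_single hf]; exact (tsupport_pdir_subset _ _).trans ih

lemma hasCompactSupport_mpd {f : Pt n → ℂ} (hf : Smooth f) (hc : HasCompactSupport f)
    (γ : Fin (n + 1) → ℕ) : HasCompactSupport (mpd γ f) :=
  hc.of_isClosed_subset isClosed_closure (tsupport_mpd_subset hf γ)

lemma mpd_eqOn {f g : Pt n → ℂ} (hf : Smooth f) (hg : Smooth g) {U : Set (Pt n)}
    (hU : IsOpen U) (h : EqOn f g U) (γ : Fin (n + 1) → ℕ) : EqOn (mpd γ f) (mpd γ g) U := by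
  induction γ using mi_induction with
  | h0 => simpa only [mpd_zero] using h
  | hs γ i ih =>
    intro p hp
    rw [mpd_add_single hf, mpd_add_single hg]
    have : mpd γ f =ᶠ[nhds p] mpd γ g := ih.eventuallyEq_of_mem (hU.mem_nhds hp)
    simp [pdir, this.fderiv_eq]

lemma pdir_comp_affine {f : Pt n → ℂ} (hf : Smooth f) (a : Pt n) (c : ℝ) (v : Pt n) :
    pdir v (fun q => f (a + c • q)) = (c : ℂ) • fun q => pdir v f (a + c • q) := by
  funext q
  have h1 : HasFDerivAt (fun q : Pt n => a + c • q) (c • ContinuousLinearMap.id ℝ (Pt n)) q :=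
    ((hasFDerivAt_id q).const_smul c).const_add a
  have h2 := ((hf.differentiable' (a + c • q)).hasFDerivAt.comp q h1).fderiv
  simp only [pdir, Pi.smul_apply]
  rw [show (fun q => f (a + c • q)) = f ∘ fun q => a + c • q from rfl, h2]
  simp

lemma smooth_comp_affine {f : Pt n → ℂ} (hf : Smooth f) (a : Pt n) (c : ℝ) :
    Smooth fun q => f (a + c • q) :=
  hf.comp (contDiff_const.add (contDiff_id.const_smul c))

lemma mpd_comp_affine {f : Pt n → ℂ} (hf : Smooth f) (a : Pt n) (c : ℝ)
    (γ : Fin (n + 1) → ℕ) :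
    mpd γ (fun q => f (a + c • q)) = (c : ℂ) ^ (∑ i, γ i) • fun q => mpd γ f (a + c • q) := by
  induction γ using mi_induction with
  | h0 => simp [mpd_zero]
  | hs γ i ih =>
    rw [mpd_add_single (smooth_comp_affine hf a c), ih,
      pdir_const_smul _ (smooth_comp_affine (hf.mpd γ) a c), pdir_comp_affine (hf.mpd γ),
      mpd_add_single hf, mi_sum_add_single, pow_succ, smul_smul]

/-- The Leibniz rule: `∂^α (f g) = f ∂^α g + ∑ ∂^β f ∂^γ g`, a finite sum over pairs of
multiindices with `|β| + |γ| = |α|` and `|γ| < |α|`. -/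
lemma leibniz_mpd (α : Fin (n + 1) → ℕ) :
    ∃ S : List ((Fin (n + 1) → ℕ) × (Fin (n + 1) → ℕ)),
      (∀ s ∈ S, (∑ i, s.1 i) + (∑ i, s.2 i) = ∑ i, α i ∧ 1 ≤ ∑ i, s.1 i) ∧
      ∀ f g : Pt n → ℂ, Smooth f → Smooth g →
        mpd α (f * g) = f * mpd α g + (S.map fun s => mpd s.1 f * mpd s.2 g).sum := by
  induction α using mi_induction with
  | h0 => exact ⟨[], by simp, fun f g _ _ => by simp [mpd_zero]⟩
  | hs α k ih =>
    obtain ⟨S, hS, hl⟩ := ih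
    refine ⟨(emi k, α) :: (S.map (fun s => (s.1, s.2 + emi k)) ++
      S.map (fun s => (s.1 + emi k, s.2))), ?_, ?_⟩
    · intro s hs
      simp only [List.mem_cons, List.mem_append, List.mem_map] at hs
      rcases hs with rfl | ⟨s', hs', rfl⟩ | ⟨s', hs', rfl⟩
      · rw [mi_sum_add_single]; simp [add_comm]
      · have := hS s' hs'
        simp only [mi_sum_add_single]; omega
      · have := hS s' hs'
        simp only [mi_sum_add_single]; omega
    · intro f g hf hg
      have hsum : ∀ T : List ((Fin (n + 1) → ℕ) × (Fin (n + 1) → ℕ)),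
          Smooth (T.map fun s => mpd s.1 f * mpd s.2 g).sum ∧
          pdir (edir n k) (T.map fun s => mpd s.1 f * mpd s.2 g).sum
            = ((T.map (fun s => (s.1, s.2 + emi k))).map
                fun s => mpd s.1 f * mpd s.2 g).sum
              + ((T.map (fun s => (s.1 + emi k, s.2))).map
                fun s => mpd s.1 f * mpd s.2 g).sum := by
        intro T
        induction T with
        | nil => exact ⟨contDiff_const, by simp [pdir_zero]⟩
        | cons a T ih =>
          have hm : Smooth (mpd a.1 f * mpd a.2 g) := (hf.mpd _).mul (hg.mpd _)
          simp only [List.map_cons, List.sum_cons]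
          refine ⟨hm.add ih.1, ?_⟩
          rw [pdir_add hm ih.1, ih.2, pdir_mul (hf.mpd _) (hg.mpd _), mpd_add_single hf,
            mpd_add_single hg]
          ring
      rw [mpd_add_single (hf.fmul hg), hl f g hf hg, pdir_add (hf.fmul (hg.mpd α)) (hsum S).1,
        (hsum S).2, pdir_mul hf (hg.mpd α), mpd_add_single hg]
      simp only [List.map_cons, List.sum_cons, List.map_append, List.sum_append]
      rw [show mpd (emi k) f = pdir (edir n k) f by
        simpa [mpd_zero] using mpd_add_single hf 0 k]
      ring

/-! ### Interpolation inequalities for smooth compactly supported functions -/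

instance : (volume : Measure (Pt n)).IsAddHaarMeasure :=
  inferInstanceAs ((volume : Measure (Fin n → ℝ)).prod (volume : Measure ℝ)).IsAddHaarMeasure

/-- The `i`-th coordinate of a point of `ℝ^{n+1}`. -/
def coord (i : Fin (n + 1)) (y : Pt n) : ℝ := if h : (i : ℕ) < n then y.1 ⟨i, h⟩ else y.2

lemma abs_coord_le (i : Fin (n + 1)) (y : Pt n) : |coord i y| ≤ ‖y‖ := by
  unfold coord
  split_ifs with h
  · exact (norm_le_pi_norm y.1 ⟨i, h⟩).trans (norm_fst_le y)
  · exact norm_snd_le y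

lemma sum_coord_smul_edir (y : Pt n) : ∑ i, coord i y • edir n i = y := by
  rw [Fin.sum_univ_castSucc]
  ext i
  · simp only [coord, edir, Fin.val_castSucc, Fin.is_lt, dite_true, Fin.val_last, lt_irrefl,
      dite_false, Prod.fst_add, Prod.fst_sum, Prod.smul_fst, smul_zero, add_zero,
      Finset.sum_apply, Pi.smul_apply, smul_eq_mul]
    rw [Finset.sum_eq_single i]
    · simp
    · intro b _ hb
      simp [hb.symm]
    · simp
  · simp [coord, edir, Prod.snd_sum]

lemma pdir_eq_sum (y : Pt n) (f : Pt n → ℂ) (p : Pt n) :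
    pdir y f p = ∑ i, (coord i y : ℂ) * pdir (edir n i) f p := by
  conv_lhs => rw [← sum_coord_smul_edir y]
  simp [pdir]

lemma integrable_sq_of_compact {f : Pt n → ℂ} (hf : Continuous f) (hc : HasCompactSupport f) :
    Integrable fun p => ‖f p‖ ^ 2 := by
  refine (hf.norm.pow 2).integrable_of_hasCompactSupport ?_
  refine hc.mono fun p hp => ?_
  simpa using hp

lemma integral_mul_pdir {f g : Pt n → ℂ} (hf : Smooth f) (hg : Smooth g)
    (hc : HasCompactSupport f) (v : Pt n) :
    ∫ p, f p * pdir v g p = -∫ p, pdir v f p * g p := by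
  have hc' : HasCompactSupport (pdir v f) :=
    hc.of_isClosed_subset isClosed_closure (tsupport_pdir_subset f v)
  refine integral_mul_fderiv_eq_neg_fderiv_mul_of_integrable ?_ ?_ ?_
    (fun x _ => hf.differentiable' x) (fun x _ => hg.differentiable' x)
  · exact ((hf.pdir v).continuous.mul hg.continuous).integrable_of_hasCompactSupport hc'.mul_right
  · exact (hf.continuous.mul (hg.pdir v).continuous).integrable_of_hasCompactSupport hc.mul_right
  · exact (hf.continuous.mul hg.continuous).integrable_of_hasCompactSupport hc.mul_right

lemma smooth_conj {f : Pt n → ℂ} (hf : Smooth f) : Smooth fun p => (starRingEnd ℂ) (f p) :=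
  Complex.conjCLE.contDiff.comp hf

lemma pdir_conj (f : Pt n → ℂ) (v : Pt n) :
    pdir v (fun p => (starRingEnd ℂ) (f p)) = fun p => (starRingEnd ℂ) (pdir v f p) := by
  funext p
  have := Complex.conjCLE.comp_fderiv (f := f) (x := p)
  simp only [pdir]
  rw [show (fun p => (starRingEnd ℂ) (f p)) = Complex.conjCLE ∘ f from rfl, this]
  simp

/-- The homogeneous energy of order `k` of a function. -/
def energy (k : ℕ) (f : Pt n → ℂ) : ℝ := ∑ γ ∈ MI n k, ∫ p, ‖mpd γ f p‖ ^ 2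

lemma energy_nonneg (k : ℕ) (f : Pt n → ℂ) : 0 ≤ energy k f :=
  Finset.sum_nonneg fun _ _ => integral_nonneg fun _ => by positivity

lemma integral_le_energy {k : ℕ} (f : Pt n → ℂ) {γ : Fin (n + 1) → ℕ} (hγ : ∑ i, γ i = k) :
    ∫ p, ‖mpd γ f p‖ ^ 2 ≤ energy k f :=
  Finset.single_le_sum (f := fun γ => ∫ p, ‖mpd γ f p‖ ^ 2)
    (fun _ _ => integral_nonneg fun _ => by positivity) (mem_MI.2 hγ)

lemma integral_pdir_sq_le {g : Pt n → ℂ} (hg : Smooth g) (hc : HasCompactSupport g) (v : Pt n)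
    {ε : ℝ} (hε : 0 < ε) :
    ∫ p, ‖pdir v g p‖ ^ 2 ≤
      ε * (∫ p, ‖pdir v (pdir v g) p‖ ^ 2) + ε⁻¹ * ∫ p, ‖g p‖ ^ 2 := by
  have hs {h : Pt n → ℂ} (h' : HasCompactSupport h) : HasCompactSupport (pdir v h) :=
    h'.of_isClosed_subset isClosed_closure (tsupport_pdir_subset h v)
  have hcc : HasCompactSupport fun p => (starRingEnd ℂ) (g p) :=
    hc.comp_left (g := starRingEnd ℂ) (map_zero _)
  have h1 := integral_mul_pdir (smooth_conj hg) (hg.pdir v) hcc v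
  have h2 : ∫ p, pdir v (fun p => (starRingEnd ℂ) (g p)) p * pdir v g p
      = ((∫ p, ‖pdir v g p‖ ^ 2 : ℝ) : ℂ) := by
    rw [pdir_conj, ← integral_complex_ofReal]
    congr 1
    funext p
    simp [← Complex.conj_mul']
  rw [h2] at h1
  have h3 : ∫ p, ‖pdir v g p‖ ^ 2 ≤
      ‖∫ p, (starRingEnd ℂ) (g p) * pdir v (pdir v g) p‖ := by
    rw [h1, norm_neg, Complex.norm_real]
    exact le_abs_self _
  refine h3.trans ((norm_integral_le_integral_norm _).trans ?_)
  have i1 := integrable_sq_of_compact ((hg.pdir v).pdir v).continuous (hs (hs hc))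
  have i2 := integrable_sq_of_compact hg.continuous hc
  rw [← integral_const_mul, ← integral_const_mul, ← integral_add (i1.const_mul _) (i2.const_mul _)]
  refine integral_mono_of_nonneg (Filter.Eventually.of_forall fun p => norm_nonneg _)
    ((i1.const_mul _).add (i2.const_mul _)) (Filter.Eventually.of_forall fun p => ?_)
  simp only [norm_mul, RCLike.norm_conj]
  set a := ‖g p‖
  set b := ‖pdir v (pdir v g) p‖
  have : ε * b ^ 2 + ε⁻¹ * a ^ 2 - a * b = ε * (b - ε⁻¹ * a / 2) ^ 2 + 3 / 4 * ε⁻¹ * a ^ 2 := by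
    field_simp; ring
  have h5 : 0 ≤ ε * (b - ε⁻¹ * a / 2) ^ 2 + 3 / 4 * ε⁻¹ * a ^ 2 := by positivity
  linarith

lemma energy_succ_le (k : ℕ) {f : Pt n → ℂ} (hf : Smooth f) (hc : HasCompactSupport f)
    {ε : ℝ} (hε : 0 < ε) :
    energy (k + 1) f ≤ (MI n (k + 1)).card * (ε * energy (k + 2) f + ε⁻¹ * energy k f) := by
  rw [← nsmul_eq_mul]
  refine Finset.sum_le_card_nsmul _ _ _ fun γ hγ => ?_
  obtain ⟨γ', i, rfl, hγ'⟩ := mi_exists_pred (mem_MI.1 hγ)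
  rw [mpd_add_single hf]
  refine (integral_pdir_sq_le (hf.mpd γ') (hasCompactSupport_mpd hf hc γ') _ hε).trans ?_
  rw [← mpd_add_single hf, ← mpd_add_single hf]
  gcongr
  · exact integral_le_energy f (by rw [mi_sum_add_single, mi_sum_add_single, hγ'])
  · exact integral_le_energy f hγ'

lemma lintegral_sq_le_of_isProbabilityMeasure {α : Type*} [MeasurableSpace α] {μ : Measure α}
    [IsProbabilityMeasure μ] {g : α → ℝ≥0∞} (hg : AEMeasurable g μ) :
    (∫⁻ a, g a ∂μ) ^ 2 ≤ ∫⁻ a, g a ^ 2 ∂μ := by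
  have h := ENNReal.lintegral_mul_le_Lp_mul_Lq μ (p := 2) (q := 2)
    (by constructor <;> norm_num) hg (g := 1) aemeasurable_const
  simp only [Pi.mul_apply, Pi.one_apply, mul_one, ENNReal.one_rpow, lintegral_one, measure_univ]
    at h
  calc (∫⁻ a, g a ∂μ) ^ 2 ≤ ((∫⁻ a, g a ^ (2 : ℝ) ∂μ) ^ (1 / 2 : ℝ)) ^ 2 := by gcongr
    _ = ∫⁻ a, g a ^ 2 ∂μ := by
      rw [← ENNReal.rpow_natCast, ← ENNReal.rpow_mul]
      norm_num

lemma sub_eq_integral_pdir {f : Pt n → ℂ} (hf : Smooth f) (x y : Pt n) :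
    f (x + y) - f x = ∫ s in (0 : ℝ)..1, pdir y f (x + s • y) := by
  have hd : ∀ s : ℝ, HasDerivAt (fun s : ℝ => f (x + s • y)) (pdir y f (x + s • y)) s := by
    intro s
    have h1 : HasDerivAt (fun s : ℝ => x + s • y) y s := by
      simpa using ((hasDerivAt_id s).smul_const y).const_add x
    exact (hf.differentiable' (x + s • y)).hasFDerivAt.comp_hasDerivAt s h1
  rw [intervalIntegral.integral_eq_sub_of_hasDerivAt (fun s _ => hd s)]
  · simp
  · refine Continuous.intervalIntegrable ?_ _ _
    exact (hf.pdir y).continuous.comp (by fun_prop)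

lemma enorm_sub_sq_le {f : Pt n → ℂ} (hf : Smooth f) (x y : Pt n) :
    ‖f (x + y) - f x‖ₑ ^ 2 ≤ ∫⁻ s in Ioc (0 : ℝ) 1, ‖pdir y f (x + s • y)‖ₑ ^ 2 := by
  have : IsProbabilityMeasure (volume.restrict (Ioc (0 : ℝ) 1)) := ⟨by simp⟩
  rw [sub_eq_integral_pdir hf, intervalIntegral.integral_of_le zero_le_one]
  refine le_trans ?_ (lintegral_sq_le_of_isProbabilityMeasure ?_)
  · gcongr
    exact enorm_integral_le_lintegral_enorm _
  · have : Continuous fun s : ℝ => pdir y f (x + s • y) :=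
      (hf.pdir y).continuous.comp (by fun_prop)
    exact this.enorm.aemeasurable

lemma lintegral_translate_sub_le {f : Pt n → ℂ} (hf : Smooth f) (y : Pt n) :
    ∫⁻ x, ‖f (x + y) - f x‖ₑ ^ 2 ≤ ∫⁻ x, ‖pdir y f x‖ₑ ^ 2 := by
  have hcont := (hf.pdir y).continuous
  calc ∫⁻ x, ‖f (x + y) - f x‖ₑ ^ 2
      ≤ ∫⁻ x, ∫⁻ s in Ioc (0 : ℝ) 1, ‖pdir y f (x + s • y)‖ₑ ^ 2 :=
        lintegral_mono fun x => enorm_sub_sq_le hf x y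
    _ = ∫⁻ s in Ioc (0 : ℝ) 1, ∫⁻ x, ‖pdir y f (x + s • y)‖ₑ ^ 2 := by
        refine lintegral_lintegral_swap ?_
        have : Continuous fun z : Pt n × ℝ => pdir y f (z.1 + z.2 • y) :=
          hcont.comp (by fun_prop)
        exact (this.enorm.measurable.pow_const 2).aemeasurable
    _ = ∫⁻ s in Ioc (0 : ℝ) 1, ∫⁻ x, ‖pdir y f x‖ₑ ^ 2 := by
        congr 1
        funext s
        exact lintegral_add_right_eq_self (fun x => ‖pdir y f x‖ₑ ^ 2) (s • y)
    _ = ∫⁻ x, ‖pdir y f x‖ₑ ^ 2 := by simp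

lemma norm_pdir_sq_le {f : Pt n → ℂ} (hf : Smooth f) (y p : Pt n) :
    ‖pdir y f p‖ ^ 2 ≤ (n + 1) * ‖y‖ ^ 2 * ∑ i, ‖mpd (emi i) f p‖ ^ 2 := by
  have h1 : ‖pdir y f p‖ ≤ ∑ i, ‖y‖ * ‖mpd (emi i) f p‖ := by
    rw [pdir_eq_sum]
    refine (norm_sum_le _ _).trans (Finset.sum_le_sum fun i _ => ?_)
    rw [norm_mul, Complex.norm_real]
    have : mpd (emi i) f = pdir (edir n i) f := by
      simpa [mpd_zero] using mpd_add_single hf 0 i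
    rw [this]
    gcongr
    exact abs_coord_le i y
  calc ‖pdir y f p‖ ^ 2 ≤ (∑ i, ‖y‖ * ‖mpd (emi i) f p‖) ^ 2 := by gcongr
    _ ≤ (Finset.univ : Finset (Fin (n + 1))).card * ∑ i, (‖y‖ * ‖mpd (emi i) f p‖) ^ 2 :=
        sq_sum_le_card_mul_sum_sq
    _ = _ := by simp [mul_pow, Finset.mul_sum, mul_assoc]

lemma integral_pdir_le_energy {f : Pt n → ℂ} (hf : Smooth f) (hc : HasCompactSupport f)
    (y : Pt n) :
    ∫ p, ‖pdir y f p‖ ^ 2 ≤ (n + 1) ^ 2 * ‖y‖ ^ 2 * energy 1 f := by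
  have hi : ∀ i, Integrable fun p => ‖mpd (emi i) f p‖ ^ 2 := fun i =>
    integrable_sq_of_compact (hf.mpd _).continuous (hasCompactSupport_mpd hf hc _)
  calc ∫ p, ‖pdir y f p‖ ^ 2 ≤ ∫ p, (n + 1) * ‖y‖ ^ 2 * ∑ i, ‖mpd (emi i) f p‖ ^ 2 :=
        integral_mono_of_nonneg (Filter.Eventually.of_forall fun p => by positivity)
          ((integrable_finsetSum _ fun i _ => hi i).const_mul _)
          (Filter.Eventually.of_forall fun p => norm_pdir_sq_le hf y p)
    _ = (n + 1) * ‖y‖ ^ 2 * ∑ i, ∫ p, ‖mpd (emi i) f p‖ ^ 2 := by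
        rw [integral_const_mul, integral_finsetSum _ fun i _ => hi i]
    _ ≤ (n + 1) * ‖y‖ ^ 2 * ∑ _i : Fin (n + 1), energy 1 f := by
        gcongr with i
        exact integral_le_energy f (by simp)
    _ = _ := by simp; ring

lemma ofReal_integral_sq {f : Pt n → ℂ} (hf : Continuous f) (hc : HasCompactSupport f) :
    ENNReal.ofReal (∫ p, ‖f p‖ ^ 2) = ∫⁻ p, ‖f p‖ₑ ^ 2 := by
  rw [ofReal_integral_eq_lintegral_ofReal (integrable_sq_of_compact hf hc)
    (Filter.Eventually.of_forall fun p => by positivity)]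
  congr 1
  funext p
  rw [← ofReal_norm, ENNReal.ofReal_pow (norm_nonneg _)]

/-- A Nash type inequality. -/
lemma energy_zero_le_aux {f : Pt n → ℂ} (hf : Smooth f) (hc : HasCompactSupport f)
    {h : ℝ} (hh : 0 < h) :
    (volume : Measure (Pt n)).real (Metric.ball 0 h) * energy 0 f ≤
      (volume : Measure (Pt n)).real (Metric.ball 0 h) * ((n + 1) ^ 2 * h ^ 2 * energy 1 f)
        + 2 * (∫ p, ‖f p‖) ^ 2 := by
  have hcont := hf.continuous
  have hN0 : energy 0 f = ∫ p, ‖f p‖ ^ 2 := by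
    have hM : MI n 0 = {0} := by
      ext γ; rw [mem_MI, Finset.sum_eq_zero_iff]; simp [funext_iff]
    simp [energy, hM, mpd_zero]
  have hW : ENNReal.ofReal (∫ p, ‖f p‖) = ∫⁻ p, ‖f p‖ₑ := by
    rw [ofReal_integral_eq_lintegral_ofReal (hcont.integrable_of_hasCompactSupport hc).norm
      (Filter.Eventually.of_forall fun p => norm_nonneg _)]
    simp
  have hpt : ∀ x y : Pt n, ‖f x‖ₑ ^ 2 ≤ ‖f (x + y) - f x‖ₑ ^ 2 + 2 * (‖f x‖ₑ * ‖f (x + y)‖ₑ) := by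
    intro x y
    have hr : ‖f x‖ ^ 2 ≤ ‖f (x + y) - f x‖ ^ 2 + 2 * (‖f x‖ * ‖f (x + y)‖) := by
      have h0 := abs_norm_sub_norm_le (f (x + y)) (f x)
      have h1 : (‖f (x + y)‖ - ‖f x‖) ^ 2 ≤ ‖f (x + y) - f x‖ ^ 2 := by
        rw [← sq_abs]; gcongr
      nlinarith [sq_nonneg ‖f (x + y)‖]
    have := ENNReal.ofReal_le_ofReal hr
    rw [ENNReal.ofReal_add (by positivity) (by positivity), ENNReal.ofReal_mul (by positivity),
      ENNReal.ofReal_mul (by positivity), ENNReal.ofReal_pow (by positivity),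
      ENNReal.ofReal_pow (by positivity)] at this
    simpa using this
  have hy : ∀ y ∈ Metric.ball (0 : Pt n) h, ∫⁻ x, ‖f x‖ₑ ^ 2 ≤
      ENNReal.ofReal ((n + 1) ^ 2 * h ^ 2 * energy 1 f)
        + 2 * ∫⁻ x, ‖f x‖ₑ * ‖f (x + y)‖ₑ := by
    intro y hy
    have hm : Measurable fun x => ‖f x‖ₑ * ‖f (x + y)‖ₑ :=
      hcont.enorm.measurable.mul (hcont.comp (by fun_prop)).enorm.measurable
    calc ∫⁻ x, ‖f x‖ₑ ^ 2
        ≤ ∫⁻ x, (‖f (x + y) - f x‖ₑ ^ 2 + 2 * (‖f x‖ₑ * ‖f (x + y)‖ₑ)) :=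
          lintegral_mono fun x => hpt x y
      _ = (∫⁻ x, ‖f (x + y) - f x‖ₑ ^ 2) + 2 * ∫⁻ x, ‖f x‖ₑ * ‖f (x + y)‖ₑ := by
          rw [lintegral_add_right _ (hm.const_mul 2), lintegral_const_mul _ hm]
      _ ≤ _ := by
          gcongr
          refine (lintegral_translate_sub_le hf y).trans ?_
          rw [← ofReal_integral_sq (hf.pdir y).continuous
            (hc.of_isClosed_subset isClosed_closure (tsupport_pdir_subset f y))]
          refine ENNReal.ofReal_le_ofReal ((integral_pdir_le_energy hf hc y).trans ?_)
          have := energy_nonneg 1 f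
          gcongr
          exact (mem_ball_zero_iff.1 hy).le
  have hfin : volume (Metric.ball (0 : Pt n) h) ≠ ⊤ := measure_ball_lt_top.ne
  have hest := setLIntegral_mono' (μ := volume) Metric.isOpen_ball.measurableSet hy
  have hswap : ∫⁻ y in Metric.ball (0 : Pt n) h, ∫⁻ x, ‖f x‖ₑ * ‖f (x + y)‖ₑ ≤
      (∫⁻ x, ‖f x‖ₑ) ^ 2 := by
    refine (setLIntegral_le_lintegral _ _).trans ?_
    have hm2 : Measurable fun z : Pt n × Pt n => ‖f z.2‖ₑ * ‖f (z.2 + z.1)‖ₑ :=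
      (hcont.comp (by fun_prop)).enorm.measurable.mul (hcont.comp (by fun_prop)).enorm.measurable
    rw [lintegral_lintegral_swap hm2.aemeasurable]
    have h1 : ∀ x, ∫⁻ y, ‖f x‖ₑ * ‖f (x + y)‖ₑ = ‖f x‖ₑ * ∫⁻ y, ‖f y‖ₑ := by
      intro x
      have hcx : Continuous fun y => f (x + y) := hcont.comp (by fun_prop)
      rw [lintegral_const_mul _ hcx.enorm.measurable,
        lintegral_add_left_eq_self (fun y => ‖f y‖ₑ) x]
    simp only [h1]
    rw [lintegral_mul_const _ hcont.enorm.measurable, sq]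
  have hm3 : Measurable fun y : Pt n => ∫⁻ x, ‖f x‖ₑ * ‖f (x + y)‖ₑ := by
    refine Measurable.lintegral_prod_right'
      (f := fun z : Pt n × Pt n => ‖f z.2‖ₑ * ‖f (z.2 + z.1)‖ₑ) ?_
    exact (hcont.comp (by fun_prop)).enorm.measurable.mul
      (hcont.comp (by fun_prop)).enorm.measurable
  rw [setLIntegral_const, lintegral_add_right _ (hm3.const_mul 2), setLIntegral_const,
    lintegral_const_mul _ hm3] at hest
  have hfinal := hest.trans (add_le_add_right (mul_le_mul_right hswap 2) _)
  rw [← ofReal_integral_sq hcont hc, ← hW, ← ENNReal.ofReal_toReal hfin,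
    ← ENNReal.ofReal_mul (integral_nonneg fun _ => by positivity),
    ← ENNReal.ofReal_mul (by have := energy_nonneg 1 f; positivity),
    ← ENNReal.ofReal_pow (integral_nonneg fun _ => by positivity),
    show (2 : ℝ≥0∞) = ENNReal.ofReal 2 by simp,
    ← ENNReal.ofReal_mul (by norm_num), ← ENNReal.ofReal_add
      (by have := energy_nonneg 1 f; positivity) (by positivity)] at hfinal
  rw [ENNReal.ofReal_le_ofReal_iff (by have := energy_nonneg 1 f; positivity)] at hfinal
  rw [hN0, measureReal_def]
  linarith

lemma energy_zero_le (n : ℕ) : ∃ C : ℝ, 0 ≤ C ∧ ∀ f : Pt n → ℂ, Smooth f → HasCompactSupport f →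
    ∀ ε : ℝ, 0 < ε → ε ≤ 1 →
      energy 0 f ≤ ε * energy 1 f + C * (ε⁻¹) ^ (n + 1) * (∫ p, ‖f p‖) ^ 2 := by
  set μ := (volume : Measure (Pt n)).real (Metric.ball 0 1) with hμ
  have hμ0 : 0 < μ :=
    ENNReal.toReal_pos (Metric.measure_ball_pos _ _ one_pos).ne' measure_ball_lt_top.ne
  refine ⟨2 * μ⁻¹ * (n + 1) ^ (n + 1), by positivity, fun f hf hc ε hε hε1 => ?_⟩
  set h : ℝ := ε / (n + 1) with hh
  have hh0 : 0 < h := by positivity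
  have key := energy_zero_le_aux hf hc hh0
  have hvol : (volume : Measure (Pt n)).real (Metric.ball 0 h) = h ^ (n + 1) * μ := by
    rw [measureReal_def, Measure.addHaar_ball _ _ hh0.le, ENNReal.toReal_mul,
      ENNReal.toReal_ofReal (by positivity)]
    simp [hμ, measureReal_def]
  rw [hvol] at key
  have hE := energy_nonneg 1 f
  have hpos : 0 < h ^ (n + 1) * μ := by positivity
  have h1 : energy 0 f ≤ (n + 1) ^ 2 * h ^ 2 * energy 1 f
      + 2 * (∫ p, ‖f p‖) ^ 2 / (h ^ (n + 1) * μ) := by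
    rw [← sub_le_iff_le_add', le_div_iff₀ hpos]
    linarith
  have h2 : (n + 1 : ℝ) ^ 2 * h ^ 2 = ε * ε := by rw [hh]; field_simp
  have h3 : 2 * (∫ p, ‖f p‖) ^ 2 / (h ^ (n + 1) * μ)
      = 2 * μ⁻¹ * (n + 1) ^ (n + 1) * (ε⁻¹) ^ (n + 1) * (∫ p, ‖f p‖) ^ 2 := by
    rw [hh, div_pow, inv_pow]; field_simp
  rw [h2, h3] at h1
  have h4 : ε * ε * energy 1 f ≤ ε * 1 * energy 1 f := by gcongr
  linarith

/-- Interpolation: the lower order energies are controlled by a small multiple of the top order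
energy and the `L¹` norm. -/
lemma energy_le_succ (n k : ℕ) : ∃ C : ℝ, 0 ≤ C ∧ ∃ q : ℕ, ∀ f : Pt n → ℂ, Smooth f →
    HasCompactSupport f → ∀ ε : ℝ, 0 < ε → ε ≤ 1 →
      energy k f ≤ ε * energy (k + 1) f + C * (ε⁻¹) ^ q * (∫ p, ‖f p‖) ^ 2 := by
  induction k with
  | zero =>
    obtain ⟨C, hC, h⟩ := energy_zero_le n
    exact ⟨C, hC, n + 1, h⟩
  | succ k ih =>
    obtain ⟨C, hC, q, h⟩ := ih
    set N : ℝ := (MI n (k + 1)).card + 1 with hN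
    have hN1 : 1 ≤ N := by simp [hN]
    -- Apply the second order interpolation with `ε / (2 * N)`, then the induction hypothesis with
    -- `ε / (4 N²)`.
    refine ⟨4 * N ^ 2 * C * (4 * N ^ 2) ^ q, by positivity, q + 1, fun f hf hc ε hε hε1 => ?_⟩
    have hE1 := energy_nonneg (k + 1) f
    have hE2 := energy_nonneg (k + 2) f
    have hE0 := energy_nonneg k f
    have h1 := energy_succ_le k hf hc (ε := ε / (2 * N)) (by positivity)
    have h2 := h f hf hc (ε / (4 * N ^ 2)) (by positivity) (by
      rw [div_le_one (by positivity)]; nlinarith)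
    set W := (∫ p, ‖f p‖) ^ 2
    have hW : 0 ≤ W := by positivity
    have h3 : energy (k + 1) f ≤ N * (ε / (2 * N) * energy (k + 2) f
        + (ε / (2 * N))⁻¹ * energy k f) := by
      refine h1.trans ?_
      gcongr
      simp [hN]
    have h4 : N * (ε / (2 * N) * energy (k + 2) f + (ε / (2 * N))⁻¹ * energy k f)
        = ε / 2 * energy (k + 2) f + 2 * N ^ 2 * ε⁻¹ * energy k f := by
      field_simp
    have h5 : 2 * N ^ 2 * ε⁻¹ * energy k f ≤ 2 * N ^ 2 * ε⁻¹ *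
        (ε / (4 * N ^ 2) * energy (k + 1) f + C * ((ε / (4 * N ^ 2))⁻¹) ^ q * W) := by
      gcongr
    have h6 : 2 * N ^ 2 * ε⁻¹ *
        (ε / (4 * N ^ 2) * energy (k + 1) f + C * ((ε / (4 * N ^ 2))⁻¹) ^ q * W)
        = energy (k + 1) f / 2 + 2 * N ^ 2 * C * (4 * N ^ 2) ^ q * (ε⁻¹) ^ (q + 1) * W := by
      rw [inv_div, div_pow, inv_pow, pow_succ]
      field_simp
      ring
    linarith

lemma energy_le_top (n m : ℕ) : ∃ C : ℝ, 0 ≤ C ∧ ∃ q : ℕ, ∀ k < m, ∀ f : Pt n → ℂ, Smooth f →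
    HasCompactSupport f → ∀ ε : ℝ, 0 < ε → ε ≤ 1 →
      energy k f ≤ ε * energy m f + C * (ε⁻¹) ^ q * (∫ p, ‖f p‖) ^ 2 := by
  induction m with
  | zero => exact ⟨0, le_rfl, 0, by simp⟩
  | succ m ih =>
    obtain ⟨C, hC, q, h⟩ := ih
    obtain ⟨C', hC', q', h'⟩ := energy_le_succ n m
    refine ⟨C + C', by positivity, q + q', fun k hk f hf hc ε hε hε1 => ?_⟩
    have hW : 0 ≤ (∫ p, ‖f p‖) ^ 2 := by positivity
    have hi : 1 ≤ ε⁻¹ := (one_le_inv₀ hε).2 hε1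
    have hq : (ε⁻¹) ^ q ≤ (ε⁻¹) ^ (q + q') := pow_le_pow_right₀ hi (by omega)
    have hq' : (ε⁻¹) ^ q' ≤ (ε⁻¹) ^ (q + q') := pow_le_pow_right₀ hi (by omega)
    have b' : C' * (ε⁻¹) ^ q' * (∫ p, ‖f p‖) ^ 2 ≤
      C' * (ε⁻¹) ^ (q + q') * (∫ p, ‖f p‖) ^ 2 := by gcongr
    have b : C * (ε⁻¹) ^ q * (∫ p, ‖f p‖) ^ 2 ≤
      C * (ε⁻¹) ^ (q + q') * (∫ p, ‖f p‖) ^ 2 := by gcongr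
    rcases Nat.lt_succ_iff_lt_or_eq.1 hk with hk | rfl
    · have e1 := h k hk f hf hc ε hε hε1
      have e2 := h' f hf hc 1 one_pos le_rfl
      simp only [inv_one, one_pow, mul_one, one_mul] at e2
      have e3 : C' * (∫ p, ‖f p‖) ^ 2 * ε ≤ C' * (ε⁻¹) ^ (q + q') * (∫ p, ‖f p‖) ^ 2 := by
        have : ε ≤ (ε⁻¹) ^ (q + q') := hε1.trans (one_le_pow₀ hi)
        calc C' * (∫ p, ‖f p‖) ^ 2 * ε ≤ C' * (∫ p, ‖f p‖) ^ 2 * (ε⁻¹) ^ (q + q') := by gcongr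
          _ = _ := by ring
      have e4 : ε * energy m f ≤ ε * (energy (m + 1) f + C' * (∫ p, ‖f p‖) ^ 2) := by gcongr
      linarith
    · have e1 := h' f hf hc ε hε hε1
      have : 0 ≤ C * (ε⁻¹) ^ (q + q') * (∫ p, ‖f p‖) ^ 2 := by positivity
      linarith

/-! ### Convolution with smooth functions and cutoff functions -/

/-- Convolution of complex functions on `ℝ^{n+1}`. -/
def conv (g φ : Pt n → ℂ) : Pt n → ℂ := fun p => ∫ q, g q * φ (p - q)

lemma conv_eq (g φ : Pt n → ℂ) :
    conv g φ = MeasureTheory.convolution g φ (ContinuousLinearMap.mul ℝ ℂ) volume := by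
  funext p
  simp [conv, MeasureTheory.convolution]

lemma smooth_conv {g φ : Pt n → ℂ} (hg : LocallyIntegrable g) (hφ : Smooth φ)
    (hc : HasCompactSupport φ) : Smooth (conv g φ) := by
  rw [conv_eq]
  exact hc.contDiff_convolution_right (n := (⊤ : ℕ∞)) _ hg hφ

lemma pdir_conv {g φ : Pt n → ℂ} (hg : LocallyIntegrable g) (hφ : Smooth φ)
    (hc : HasCompactSupport φ) (v : Pt n) : pdir v (conv g φ) = conv g (pdir v φ) := by
  funext p
  rw [conv_eq, conv_eq]
  unfold pdir
  rw [(hc.hasFDerivAt_convolution_right (ContinuousLinearMap.mul ℝ ℂ) hg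
      (hφ.of_le (by simp)) p).fderiv,
    convolution_precompR_apply _ hg (hc.fderiv ℝ) (hφ.continuous_fderiv (by simp))]

lemma mpd_conv {g φ : Pt n → ℂ} (hg : LocallyIntegrable g) (hφ : Smooth φ)
    (hc : HasCompactSupport φ) (γ : Fin (n + 1) → ℕ) : mpd γ (conv g φ) = conv g (mpd γ φ) := by
  induction γ using mi_induction with
  | h0 => rw [mpd_zero, mpd_zero]
  | hs γ i ih =>
    rw [mpd_add_single (smooth_conv hg hφ hc), ih,
      pdir_conv hg (hφ.mpd γ) (hasCompactSupport_mpd hφ hc γ), mpd_add_single hφ]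

/-- Smooth mollifiers at every scale. -/
lemma exists_mollifier (n : ℕ) : ∃ ρ : Pt n → ℝ, ContDiff ℝ (⊤ : ℕ∞) ρ ∧
    (∀ p, 0 ≤ ρ p) ∧ Function.support ρ ⊆ Metric.ball 0 1 ∧ HasCompactSupport ρ ∧
    ∫ p, ρ p = 1 := by
  let b : ContDiffBump (0 : Pt n) := ⟨1 / 2, 1, by norm_num, by norm_num⟩
  exact ⟨b.normed volume, b.contDiff_normed, b.nonneg_normed, b.support_normed_eq.subset,
    b.hasCompactSupport_normed, b.integral_normed⟩

lemma exists_cutoff (n m : ℕ) : ∃ C : ℝ, 1 ≤ C ∧ ∀ r R : ℝ, 0 < r → r < R → R - r ≤ 1 →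
    ∃ η : Pt n → ℂ, Smooth η ∧ HasCompactSupport η ∧ tsupport η ⊆ Metric.ball 0 R ∧
      (∀ p, (starRingEnd ℂ) (η p) = η p) ∧ (∀ p ∈ Metric.ball (0 : Pt n) r, η p = 1) ∧
      ∀ γ : Fin (n + 1) → ℕ, ∑ i, γ i ≤ m → ∀ p, ‖mpd γ η p‖ ≤ C * ((R - r)⁻¹) ^ m := by
  obtain ⟨ρ, hρ, hρ0, hρs, hρc, hρ1⟩ := exists_mollifier n
  set ρ' : Pt n → ℂ := fun p => (ρ p : ℂ) with hρ'
  have hs : Smooth ρ' := Complex.ofRealCLM.contDiff.comp hρ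
  have hc : HasCompactSupport ρ' := hρc.comp_left (g := fun x : ℝ => (x : ℂ)) (by simp)
  have hK : ∀ γ, 0 ≤ ∫ p, ‖mpd γ ρ' p‖ := fun γ => integral_nonneg fun _ => norm_nonneg _
  set K : ℝ := ∑ k ∈ Finset.range (m + 1), ∑ γ ∈ MI n k, ∫ p, ‖mpd γ ρ' p‖ with hKdef
  have hK0 : 0 ≤ K := Finset.sum_nonneg fun _ _ => Finset.sum_nonneg fun _ _ => hK _
  refine ⟨(K + 1) * 4 ^ m, ?_, fun r R hr hrR hR1 => ?_⟩
  · have : (1 : ℝ) ≤ 4 ^ m := one_le_pow₀ (by norm_num)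
    nlinarith
  set d : ℝ := (R - r) / 4 with hd
  have hd0 : 0 < d := by rw [hd]; linarith
  set B : Set (Pt n) := Metric.ball 0 ((r + R) / 2) with hB
  set g : Pt n → ℂ := B.indicator fun _ => 1 with hg
  have hBm : MeasurableSet B := Metric.isOpen_ball.measurableSet
  have hgi : Integrable g := by
    rw [hg, integrable_indicator_iff hBm]
    exact integrableOn_const measure_ball_lt_top.ne
  set φ : Pt n → ℂ := fun p => ((d⁻¹ ^ (n + 1) : ℝ) : ℂ) * ρ' (0 + d⁻¹ • p) with hφ
  have hφeq : φ = ((d⁻¹ ^ (n + 1) : ℝ) : ℂ) • fun p => ρ' (0 + d⁻¹ • p) := rfl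
  have hφs : Smooth φ := (smooth_comp_affine hs 0 d⁻¹).fsmul _
  have hφc : HasCompactSupport φ := by
    have : HasCompactSupport fun p => ρ' (d⁻¹ • p) := hc.comp_smul (by positivity)
    have h2 := this.mul_left (f := fun _ => ((d⁻¹ ^ (n + 1) : ℝ) : ℂ))
    simp only [hφ, zero_add]
    exact h2
  have hφ0 : ∀ p, d ≤ ‖p‖ → φ p = 0 := by
    intro p hp
    have : ρ (d⁻¹ • p) = 0 := by
      by_contra h
      have h2 := hρs h
      rw [mem_ball_zero_iff, norm_smul, Real.norm_of_nonneg (by positivity),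
        inv_mul_lt_iff₀ hd0] at h2
      linarith
    simp [hφ, hρ', this]
  have hscale : ∀ h : Pt n → ℂ, d⁻¹ ^ (n + 1) * ∫ p, ‖h (0 + d⁻¹ • p)‖ = ∫ p, ‖h p‖ := by
    intro h
    have := Measure.integral_comp_smul (μ := (volume : Measure (Pt n))) (fun p => ‖h p‖) d⁻¹
    simp only [zero_add]
    rw [this]
    have hfr : Module.finrank ℝ (Pt n) = n + 1 := by simp
    rw [hfr, abs_of_nonneg (by positivity), smul_eq_mul]
    field_simp
  have hφ1 : ∫ p, φ p = 1 := by
    have h1 : ∀ p, φ p = ((d⁻¹ ^ (n + 1) * ‖ρ' (0 + d⁻¹ • p)‖ : ℝ) : ℂ) := by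
      intro p
      simp [hφ, hρ', abs_of_nonneg (hρ0 _)]
    simp only [h1]
    rw [integral_complex_ofReal, integral_const_mul, hscale]
    simp [hρ', abs_of_nonneg (hρ0 _), hρ1]
  have htrans : ∀ (p : Pt n) (h : Pt n → ℂ), ∫ q, h (p - q) = ∫ q, h q := fun p h =>
    integral_sub_left_eq_self h volume p
  have hval : ∀ p, conv g φ p = ∫ q in B, φ (p - q) := by
    intro p
    rw [← integral_indicator hBm]
    unfold conv
    congr 1
    funext q
    by_cases hq : q ∈ B <;> simp [hg, hq]
  have hsub : Function.support (conv g φ) ⊆ Metric.closedBall 0 ((r + R) / 2 + d) := by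
    intro p hp
    by_contra hp'
    apply hp
    rw [hval]
    refine setIntegral_eq_zero_of_forall_eq_zero fun q hq => hφ0 _ ?_
    rw [mem_closedBall_zero_iff, not_le] at hp'
    have hq' : ‖q‖ < (r + R) / 2 := mem_ball_zero_iff.1 hq
    have := norm_sub_norm_le p q
    linarith
  have hts : tsupport (conv g φ) ⊆ Metric.closedBall 0 ((r + R) / 2 + d) :=
    closure_minimal hsub Metric.isClosed_closedBall
  refine ⟨conv g φ, smooth_conv hgi.locallyIntegrable hφs hφc, ?_, ?_, ?_, ?_, ?_⟩
  · exact HasCompactSupport.of_support_subset_isCompact (isCompact_closedBall _ _) hsub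
  · refine hts.trans (Metric.closedBall_subset_ball ?_)
    rw [hd]; linarith
  · intro p
    rw [hval, ← integral_conj]
    congr 1
    funext q
    simp [hφ, hρ']
  · intro p hp
    rw [hval, setIntegral_eq_integral_of_forall_compl_eq_zero, htrans, hφ1]
    intro q hq
    apply hφ0
    have hq' : (r + R) / 2 ≤ ‖q‖ := by
      simpa [hB] using hq
    rw [mem_ball_zero_iff] at hp
    have := norm_sub_norm_le q p
    rw [norm_sub_rev] at this
    linarith
  · intro γ hγ p
    rw [mpd_conv hgi.locallyIntegrable hφs hφc, hφeq, mpd_const_smul _ (smooth_comp_affine hs 0 _),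
      mpd_comp_affine hs]
    set k := ∑ i, γ i
    have hi : Integrable fun p => ‖mpd γ ρ' (0 + d⁻¹ • p)‖ := by
      have : Integrable fun p => ‖mpd γ ρ' p‖ :=
        ((hs.mpd γ).continuous.integrable_of_hasCompactSupport
        (hasCompactSupport_mpd hs hc γ)).norm
      simpa using this.comp_smul (inv_ne_zero hd0.ne')
    calc ‖conv g (((d⁻¹ ^ (n + 1) : ℝ) : ℂ) • ((d⁻¹ : ℝ) : ℂ) ^ k •
          fun q => mpd γ ρ' (0 + d⁻¹ • q)) p‖
        ≤ ∫ q, d⁻¹ ^ (n + 1) * (d⁻¹ ^ k * ‖mpd γ ρ' (0 + d⁻¹ • (p - q))‖) := by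
          refine norm_integral_le_of_norm_le ?_ (Filter.Eventually.of_forall fun q => ?_)
          · exact ((hi.comp_sub_left p).const_mul _).const_mul _
          · have hgq : ‖g q‖ ≤ 1 := by
              by_cases hq : q ∈ B <;> simp [hg, hq]
            have : 0 ≤ d⁻¹ ^ (n + 1) * (d⁻¹ ^ k * ‖mpd γ ρ' (0 + d⁻¹ • (p - q))‖) := by positivity
            simp only [Pi.smul_apply, smul_eq_mul, norm_mul, norm_pow, Complex.norm_real,
              Real.norm_of_nonneg (pow_nonneg (inv_nonneg.2 hd0.le) (n + 1)),
              Real.norm_of_nonneg (inv_nonneg.2 hd0.le)]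
            exact mul_le_of_le_one_left this hgq
      _ = d⁻¹ ^ k * ∫ q, ‖mpd γ ρ' q‖ := by
          rw [integral_const_mul, integral_const_mul,
            integral_sub_left_eq_self (fun q => ‖mpd γ ρ' (0 + d⁻¹ • q)‖) volume p,
            mul_left_comm, hscale]
      _ ≤ d⁻¹ ^ m * K := by
          have h1 : 1 ≤ d⁻¹ := (one_le_inv₀ hd0).2 (by rw [hd]; linarith)
          have h2 : ∫ q, ‖mpd γ ρ' q‖ ≤ K :=
            (Finset.single_le_sum (f := fun γ => ∫ p, ‖mpd γ ρ' p‖) (fun γ _ => hK γ)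
              (mem_MI.2 rfl)).trans
            (Finset.single_le_sum (f := fun k => ∑ γ ∈ MI n k, ∫ p, ‖mpd γ ρ' p‖)
              (fun k _ => Finset.sum_nonneg fun γ _ => hK γ) (Finset.mem_range.2 (by omega)))
          gcongr
      _ ≤ (K + 1) * 4 ^ m * ((R - r)⁻¹) ^ m := by
          have : d⁻¹ = 4 * (R - r)⁻¹ := by rw [hd, inv_div]; ring
          rw [this, mul_pow]
          have h0 : 0 ≤ (4 : ℝ) ^ m * ((R - r)⁻¹) ^ m := by
            have : 0 < R - r := by linarith
            positivity
          nlinarith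

/-! ### The interior estimate for smooth approximate solutions -/

/-- The squared size of all derivatives of order less than `k`. -/
def jet (k : ℕ) (f : Pt n → ℂ) (p : Pt n) : ℝ := ∑ i ∈ Finset.range k, ∑ γ ∈ MI n i, ‖mpd γ f p‖ ^ 2

lemma jet_nonneg (k : ℕ) (f : Pt n → ℂ) (p : Pt n) : 0 ≤ jet k f p :=
  Finset.sum_nonneg fun _ _ => Finset.sum_nonneg fun _ _ => by positivity

lemma jet_mono {k l : ℕ} (h : k ≤ l) (f : Pt n → ℂ) (p : Pt n) : jet k f p ≤ jet l f p :=
  Finset.sum_le_sum_of_subset_of_nonneg (Finset.range_mono h)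
    fun _ _ _ => Finset.sum_nonneg fun _ _ => by positivity

lemma sq_le_jet {k : ℕ} (f : Pt n → ℂ) (p : Pt n) {γ : Fin (n + 1) → ℕ} (hγ : ∑ i, γ i < k) :
    ‖mpd γ f p‖ ^ 2 ≤ jet k f p :=
  (Finset.single_le_sum (f := fun γ => ‖mpd γ f p‖ ^ 2) (fun _ _ => by positivity)
    (mem_MI.2 rfl)).trans (Finset.single_le_sum (f := fun k => ∑ γ ∈ MI n k, ‖mpd γ f p‖ ^ 2)
      (fun _ _ => Finset.sum_nonneg fun _ _ => by positivity) (Finset.mem_range.2 hγ))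

lemma continuous_jet (k : ℕ) {f : Pt n → ℂ} (hf : Smooth f) : Continuous (jet k f) :=
  continuous_finsetSum _ fun _ _ => continuous_finsetSum _ fun γ _ =>
    (hf.mpd γ).continuous.norm.pow 2

lemma integrableOn_ball_of_continuous {E : Type*} [NormedAddCommGroup E] {g : Pt n → E}
    (hg : Continuous g) (p : Pt n) (r : ℝ) :
    IntegrableOn g (Metric.ball p r) :=
  (hg.continuousOn.integrableOn_compact (isCompact_closedBall p r)).mono_set
    Metric.ball_subset_closedBall

/-- The integral of `jet` over a ball centered at the origin. -/
def jetInt (k : ℕ) (f : Pt n → ℂ) (r : ℝ) : ℝ := ∫ p in Metric.ball 0 r, jet k f p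

lemma jetInt_nonneg (k : ℕ) (f : Pt n → ℂ) (r : ℝ) : 0 ≤ jetInt k f r :=
  integral_nonneg fun p => jet_nonneg k f p

lemma jetInt_mono (k : ℕ) {f : Pt n → ℂ} (hf : Smooth f) {r R : ℝ} (h : r ≤ R) :
    jetInt k f r ≤ jetInt k f R :=
  setIntegral_mono_set (integrableOn_ball_of_continuous (continuous_jet k hf) _ _)
    (Filter.Eventually.of_forall fun p => jet_nonneg k f p)
    (Metric.ball_subset_ball h).eventuallyLE

lemma sq_norm_add_le (a b : ℂ) : ‖a + b‖ ^ 2 ≤ 2 * ‖a‖ ^ 2 + 2 * ‖b‖ ^ 2 := by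
  have h := norm_add_le a b
  have : ‖a + b‖ ^ 2 ≤ (‖a‖ + ‖b‖) ^ 2 := by gcongr
  nlinarith [sq_nonneg (‖a‖ - ‖b‖)]

lemma leibniz_list_bound {m : ℕ} {f η : Pt n → ℂ} {p : Pt n} {M : ℝ}
    (hM : ∀ γ : Fin (n + 1) → ℕ, ∑ i, γ i ≤ m → ‖mpd γ η p‖ ≤ M) {k : ℕ}
    (S : List ((Fin (n + 1) → ℕ) × (Fin (n + 1) → ℕ)))
    (hS : ∀ s ∈ S, (∑ i, s.1 i) ≤ m ∧ (∑ i, s.2 i) < k) :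
    ‖(S.map fun s => mpd s.1 η * mpd s.2 f).sum p‖ ^ 2 ≤ 4 ^ S.length * (M ^ 2 * jet k f p) := by
  induction S with
  | nil =>
    have := jet_nonneg k f p
    simp; positivity
  | cons s S ih =>
    simp only [List.map_cons, List.sum_cons, Pi.add_apply, List.length_cons]
    refine (sq_norm_add_le _ _).trans ?_
    have h1 := ih fun s hs => hS s (List.mem_cons_of_mem _ hs)
    obtain ⟨h2, h3⟩ := hS s List.mem_cons_self
    have h4 : ‖(mpd s.1 η * mpd s.2 f) p‖ ^ 2 ≤ M ^ 2 * jet k f p := by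
      rw [Pi.mul_apply, norm_mul, mul_pow]
      have := hM _ h2
      have := sq_le_jet f p h3
      gcongr
    have h5 : (1 : ℝ) ≤ 4 ^ S.length := one_le_pow₀ (by norm_num)
    have h6 : 0 ≤ M ^ 2 * jet k f p := mul_nonneg (sq_nonneg _) (jet_nonneg _ _ _)
    rw [pow_succ (4 : ℝ)]
    nlinarith

lemma leibniz_bound (n m : ℕ) : ∃ K : ℝ, 1 ≤ K ∧ ∀ α : Fin (n + 1) → ℕ, ∑ i, α i ≤ m →
    ∀ η f : Pt n → ℂ, Smooth η → Smooth f → ∀ (p : Pt n) (M : ℝ),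
      (∀ γ : Fin (n + 1) → ℕ, ∑ i, γ i ≤ m → ‖mpd γ η p‖ ≤ M) →
      ‖mpd α (η * f) p - η p * mpd α f p‖ ^ 2 ≤ K * (M ^ 2 * jet (∑ i, α i) f p) := by
  choose S hS hL using fun α : Fin (n + 1) → ℕ => leibniz_mpd α
  set T : ℝ := ∑ k ∈ Finset.range (m + 1), ∑ α ∈ MI n k, 4 ^ (S α).length with hT
  refine ⟨T + 1, ?_, fun α hα η f hη hf p M hM => ?_⟩
  · have : 0 ≤ T := Finset.sum_nonneg fun _ _ => Finset.sum_nonneg fun _ _ => by positivity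
    linarith
  · rw [hL α η f hη hf]
    simp only [Pi.add_apply, Pi.mul_apply, add_sub_cancel_left]
    refine (leibniz_list_bound (m := m) hM (S α) (k := ∑ i, α i) fun s hs => ?_).trans ?_
    · have := hS α s hs
      omega
    · have h6 : 0 ≤ M ^ 2 * jet (∑ i, α i) f p := mul_nonneg (sq_nonneg _) (jet_nonneg _ _ _)
      have h7 : (4 : ℝ) ^ (S α).length ≤ T :=
        (Finset.single_le_sum (f := fun α => (4 : ℝ) ^ (S α).length) (fun _ _ => by positivity)
          (mem_MI.2 rfl)).trans (Finset.single_le_sum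
          (f := fun k => ∑ α ∈ MI n k, (4 : ℝ) ^ (S α).length)
          (fun _ _ => Finset.sum_nonneg fun _ _ => by positivity)
          (Finset.mem_range.2 (by omega : ∑ i, α i < m + 1)))
      nlinarith

lemma jet_mul_bound (n m : ℕ) : ∃ K : ℝ, 1 ≤ K ∧ ∀ η f : Pt n → ℂ, Smooth η → Smooth f →
    ∀ (p : Pt n) (M : ℝ), (∀ γ : Fin (n + 1) → ℕ, ∑ i, γ i ≤ m → ‖mpd γ η p‖ ≤ M) →
      ∀ k ≤ m + 1, jet k (η * f) p ≤ K * (M ^ 2 * jet k f p) := by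
  obtain ⟨K, hK, h⟩ := leibniz_bound n m
  set T : ℝ := ∑ k ∈ Finset.range (m + 1), (MI n k).card with hT
  have hT0 : 0 ≤ T := Finset.sum_nonneg fun _ _ => by positivity
  refine ⟨(2 * K + 2) * T + 1, by nlinarith, fun η f hη hf p M hM k hk => ?_⟩
  have hJ := jet_nonneg k f p
  calc jet k (η * f) p ≤ ∑ i ∈ Finset.range k, ∑ γ ∈ MI n i, (2 * K + 2) * (M ^ 2 * jet k f p) := by
        refine Finset.sum_le_sum fun i hi => Finset.sum_le_sum fun γ hγ => ?_
        rw [Finset.mem_range] at hi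
        have hγ' := mem_MI.1 hγ
        have h1 := h γ (by omega) η f hη hf p M hM
        have h2 : mpd γ (η * f) p = (mpd γ (η * f) p - η p * mpd γ f p) + η p * mpd γ f p := by ring
        rw [h2]
        refine (sq_norm_add_le _ _).trans ?_
        have h3 : jet (∑ i, γ i) f p ≤ jet k f p := jet_mono (by omega) f p
        have h4 : ‖η p * mpd γ f p‖ ^ 2 ≤ M ^ 2 * jet k f p := by
          rw [norm_mul, mul_pow]
          have h5 := hM 0 (by simp)
          rw [mpd_zero] at h5
          have := sq_le_jet f p (k := k) (by omega : ∑ i, γ i < k)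
          gcongr
        have h6 : K * (M ^ 2 * jet (∑ i, γ i) f p) ≤ K * (M ^ 2 * jet k f p) := by gcongr
        nlinarith
    _ = (∑ i ∈ Finset.range k, (MI n i).card : ℝ) * ((2 * K + 2) * (M ^ 2 * jet k f p)) := by
        simp only [Finset.sum_const, nsmul_eq_mul, ← Finset.sum_mul]
    _ ≤ T * ((2 * K + 2) * (M ^ 2 * jet k f p)) := by
        have : (∑ i ∈ Finset.range k, (MI n i).card : ℝ) ≤ T :=
          Finset.sum_le_sum_of_subset_of_nonneg (Finset.range_mono hk) fun _ _ _ => by positivity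
        gcongr
    _ ≤ ((2 * K + 2) * T + 1) * (M ^ 2 * jet k f p) := by nlinarith [mul_nonneg (sq_nonneg M) hJ]

/-- An absorption argument on the scale of radii between `1/2` and `3/4`. -/
lemma iteration_bound {F : ℝ → ℝ} {B D : ℝ} {N : ℕ} (hB : 0 ≤ B)
    (hFB : ∀ ρ, 1 / 2 ≤ ρ → ρ < 3 / 4 → F ρ ≤ B) 
    (h : ∀ r R, 1 / 2 ≤ r → r < R → R < 3 / 4 →
      F r ≤ (1 / 2) ^ (N + 1) * F R + D * ((R - r)⁻¹) ^ N) :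
    F (1 / 2) ≤ 4 ^ N * (2 * (2 ^ N * D)) := by
  have key : ∀ k : ℕ, ∀ ρ, 1 / 2 ≤ ρ → ρ < 3 / 4 →
      (3 / 4 - ρ) ^ N * F ρ ≤
        B * (1 / 2) ^ k + 2 * (2 ^ N * D) - 2 * (2 ^ N * D) * (1 / 2) ^ k := by
    intro k
    induction k with
    | zero =>
      intro ρ h1 h2
      have h3 : (3 / 4 - ρ) ^ N ≤ 1 := pow_le_one₀ (by linarith) (by linarith)
      have h4 : 0 ≤ (3 / 4 - ρ) ^ N := pow_nonneg (by linarith) _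
      have := hFB ρ h1 h2
      nlinarith
    | succ k ih =>
      intro ρ h1 h2
      set d := (3 / 4 - ρ) / 2 with hd
      have hd0 : 0 < d := by rw [hd]; linarith
      have h3 := h ρ (ρ + d) h1 (by linarith) (by linarith)
      have h4 := ih (ρ + d) (by linarith) (by linarith)
      have h5 : 3 / 4 - (ρ + d) = d := by rw [hd]; ring
      have h6 : 3 / 4 - ρ = 2 * d := by rw [hd]; ring
      rw [h5] at h4
      rw [h6]
      have h7 : ρ + d - ρ = d := by ring
      rw [h7] at h3
      calc (2 * d) ^ N * F ρ ≤ (2 * d) ^ N * ((1 / 2) ^ (N + 1) * F (ρ + d) + D * d⁻¹ ^ N) := by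
            gcongr
        _ = 1 / 2 * (d ^ N * F (ρ + d)) + 2 ^ N * D := by
            have e1 : (2 : ℝ) ^ N * (1 / 2) ^ N = 1 := by rw [← mul_pow]; norm_num
            have e2 : d ^ N * d⁻¹ ^ N = 1 := by rw [← mul_pow, mul_inv_cancel₀ hd0.ne', one_pow]
            rw [mul_pow, pow_succ]
            linear_combination (1 / 2 * d ^ N * F (ρ + d)) * e1 + 2 ^ N * D * e2
        _ ≤ _ := by
            rw [pow_succ]
            linarith
  have hlim : Filter.Tendsto (fun k : ℕ => B * (1 / 2 : ℝ) ^ k + 2 * (2 ^ N * D)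
      - 2 * (2 ^ N * D) * (1 / 2) ^ k) Filter.atTop (nhds (B * 0 + 2 * (2 ^ N * D)
      - 2 * (2 ^ N * D) * 0)) := by
    have h0 : Filter.Tendsto (fun k : ℕ => (1 / 2 : ℝ) ^ k) Filter.atTop (nhds 0) :=
      tendsto_pow_atTop_nhds_zero_of_lt_one (by norm_num) (by norm_num)
    exact ((h0.const_mul _).add_const _).sub (h0.const_mul _)
  have := ge_of_tendsto' hlim fun k => key k (1 / 2) le_rfl (by norm_num)
  have h1 : (3 / 4 - 1 / 2 : ℝ) ^ N * 4 ^ N = 1 := by rw [← mul_pow]; norm_num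
  have h2 : (0 : ℝ) < 4 ^ N := by positivity
  calc F (1 / 2) = 4 ^ N * ((3 / 4 - 1 / 2 : ℝ) ^ N * F (1 / 2)) := by
        rw [← mul_assoc, mul_comm (4 ^ N : ℝ), h1, one_mul]
    _ ≤ _ := mul_le_mul_of_nonneg_left (by linarith) h2.le

lemma mpd_eq_zero_of_notMem {v : Pt n → ℂ} (hv : Smooth v) {U : Set (Pt n)} (hs : tsupport v ⊆ U)
    (γ : Fin (n + 1) → ℕ) {p : Pt n} (hp : p ∉ U) : mpd γ v p = 0 :=
  image_eq_zero_of_notMem_tsupport fun h => hp (hs (tsupport_mpd_subset hv γ h))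

lemma integral_jet_eq (k : ℕ) {v : Pt n → ℂ} (hv : Smooth v) (r : ℝ) :
    jetInt k v r = ∑ i ∈ Finset.range k, ∑ γ ∈ MI n i, ∫ p in Metric.ball 0 r, ‖mpd γ v p‖ ^ 2 := by
  have h : ∀ γ, IntegrableOn (fun p => ‖mpd γ v p‖ ^ 2) (Metric.ball 0 r) := fun γ =>
    integrableOn_ball_of_continuous ((hv.mpd γ).continuous.norm.pow 2) _ _
  unfold jetInt jet
  rw [integral_finsetSum _ fun i _ => integrable_finsetSum _ fun γ _ => h γ]
  exact Finset.sum_congr rfl fun i _ => integral_finsetSum _ fun γ _ => h γ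

lemma energy_le_jetInt {k l : ℕ} (hkl : k < l) {v : Pt n → ℂ} (hv : Smooth v) {R : ℝ}
    (hs : tsupport v ⊆ Metric.ball 0 R) : energy k v ≤ jetInt l v R := by
  rw [integral_jet_eq _ hv]
  have h : energy k v = ∑ γ ∈ MI n k, ∫ p in Metric.ball 0 R, ‖mpd γ v p‖ ^ 2 := by
    refine Finset.sum_congr rfl fun γ _ => ?_
    rw [setIntegral_eq_integral_of_forall_compl_eq_zero]
    intro p hp
    simp [mpd_eq_zero_of_notMem hv hs γ hp]
  rw [h]
  exact Finset.single_le_sum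
    (f := fun k => ∑ γ ∈ MI n k, ∫ p in Metric.ball (0 : Pt n) R, ‖mpd γ v p‖ ^ 2)
    (fun _ _ => Finset.sum_nonneg fun _ _ => integral_nonneg fun _ => by positivity)
    (Finset.mem_range.2 hkl)

lemma jetInt_mul_le {K : ℝ} {η f : Pt n → ℂ} (hη : Smooth η) (hf : Smooth f) {M : ℝ}
    {k : ℕ} (hK : ∀ p, jet k (η * f) p ≤ K * (M ^ 2 * jet k f p)) (R : ℝ) :
    jetInt k (η * f) R ≤ K * (M ^ 2 * jetInt k f R) := by
  unfold jetInt
  rw [← integral_const_mul, ← integral_const_mul]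
  refine integral_mono (integrableOn_ball_of_continuous (continuous_jet k (hη.fmul hf)) _ _)
    (((integrableOn_ball_of_continuous (continuous_jet k hf) _ _).const_mul _).const_mul _) hK

lemma setIntegral_le_of_eqOn {f v : Pt n → ℂ} (hf : Smooth f) (hv : Smooth v)
    (hc : HasCompactSupport v) {r : ℝ} (h : EqOn v f (Metric.ball 0 r)) (γ : Fin (n + 1) → ℕ) :
    ∫ p in Metric.ball 0 r, ‖mpd γ f p‖ ^ 2 ≤ ∫ p, ‖mpd γ v p‖ ^ 2 := by
  have h1 := mpd_eqOn hv hf Metric.isOpen_ball h γ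
  rw [setIntegral_congr_fun (g := fun p => ‖mpd γ v p‖ ^ 2) Metric.isOpen_ball.measurableSet
    fun p hp => by simp only [h1 hp]]
  exact setIntegral_le_integral
    (integrable_sq_of_compact (hv.mpd γ).continuous (hasCompactSupport_mpd hv hc γ))
    (Filter.Eventually.of_forall fun p => by positivity)

lemma lower_order_bound (n m : ℕ) : ∃ K : ℝ, 1 ≤ K ∧ ∃ q : ℕ, ∀ f : Pt n → ℂ, Smooth f →
    ∀ r R κ : ℝ, 1 / 2 ≤ r → r < R → R < 3 / 4 → 0 < κ → κ ≤ 1 →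
      jetInt m f r ≤ κ * (K * ((R - r)⁻¹ ^ m) ^ 2 * jetInt (m + 1) f R) +
        K * (κ⁻¹) ^ q * ((R - r)⁻¹ ^ m) ^ 2 * (∫ p in Metric.ball 0 (3 / 4), ‖f p‖) ^ 2 := by
  obtain ⟨C₁, hC₁, q, hE⟩ := energy_le_top n m
  obtain ⟨C₂, hC₂, hcut⟩ := exists_cutoff n m
  obtain ⟨C₃, hC₃, hjet⟩ := jet_mul_bound n m
  refine ⟨(m * C₃ * C₂ ^ 2 + m * C₁ * C₂ ^ 2) + 1, le_add_of_nonneg_left (by positivity), q,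
    fun f hf r R κ hr hrR hR hκ hκ1 => ?_⟩
  obtain ⟨η, hη, hηc, hηs, -, hη1, hηM⟩ := hcut r R (by linarith) hrR (by linarith)
  set X := (R - r)⁻¹ ^ m
  have hX : 0 ≤ X := pow_nonneg (inv_nonneg.2 (by linarith)) _
  set W := ∫ p in Metric.ball (0 : Pt n) (3 / 4), ‖f p‖
  have hW : 0 ≤ W := integral_nonneg fun _ => norm_nonneg _
  have hv := hη.fmul hf
  have hvc : HasCompactSupport (η * f) := hηc.mul_right
  have hvs : tsupport (η * f) ⊆ Metric.ball 0 R := (tsupport_mul_subset_left).trans hηs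
  have h1 : jetInt m f r ≤ ∑ k ∈ Finset.range m, energy k (η * f) := by
    rw [integral_jet_eq _ hf]
    exact Finset.sum_le_sum fun k _ => Finset.sum_le_sum fun γ _ =>
      setIntegral_le_of_eqOn hf hv hvc (fun p hp => by simp [hη1 p hp]) γ
  have h2 : energy m (η * f) ≤ C₃ * ((C₂ * X) ^ 2 * jetInt (m + 1) f R) :=
    (energy_le_jetInt (Nat.lt_succ_self m) hv hvs).trans (jetInt_mul_le hη hf
      (fun p => hjet η f hη hf p _ (fun γ hγ => hηM γ hγ p) _ le_rfl) R)
  have h3 : ∫ p, ‖(η * f) p‖ ≤ C₂ * X * W := by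
    rw [← setIntegral_eq_integral_of_forall_compl_eq_zero (s := Metric.ball 0 (3 / 4)),
      ← integral_const_mul]
    · refine integral_mono (integrableOn_ball_of_continuous hv.continuous.norm _ _)
        ((integrableOn_ball_of_continuous hf.continuous.norm _ _).const_mul _) fun p => ?_
      simp only [Pi.mul_apply, norm_mul]
      have := hηM 0 (by simp) p
      rw [mpd_zero] at this
      gcongr
    · intro p hp
      have := mpd_eq_zero_of_notMem hv hvs 0 (fun h => hp (Metric.ball_subset_ball hR.le h))
      rw [mpd_zero] at this
      rw [this, norm_zero]
  have h4 : ∀ k ∈ Finset.range m, energy k (η * f) ≤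
      κ * (C₃ * ((C₂ * X) ^ 2 * jetInt (m + 1) f R)) + C₁ * κ⁻¹ ^ q * (C₂ * X * W) ^ 2 := by
    intro k hk
    refine (hE k (Finset.mem_range.1 hk) _ hv hvc κ hκ hκ1).trans ?_
    have : 0 ≤ ∫ p, ‖(η * f) p‖ := integral_nonneg fun _ => norm_nonneg _
    gcongr
  have h5 := h1.trans (Finset.sum_le_card_nsmul _ _ _ h4)
  rw [Finset.card_range, nsmul_eq_mul] at h5
  refine h5.trans ?_
  have hJ := jetInt_nonneg (m + 1) f R
  have a1 : 0 ≤ κ * (X ^ 2 * jetInt (m + 1) f R) := by positivity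
  have a2 : 0 ≤ κ⁻¹ ^ q * (X ^ 2 * W ^ 2) := by positivity
  have b1 : 0 ≤ m * C₃ * C₂ ^ 2 := by positivity
  have b2 : 0 ≤ m * C₁ * C₂ ^ 2 := by positivity
  nlinarith [mul_nonneg b1 a2, mul_nonneg b2 a1, mul_nonneg b1 a1, mul_nonneg b2 a2]

/-- The sesquilinear form of the operator with coefficients `A`. -/
def form (m : ℕ) (A : Coef n) (φ f : Pt n → ℂ) : ℂ :=
  ∑ α ∈ MI n m, ∑ β ∈ MI n m, ∫ p, (starRingEnd ℂ) (mpd α φ p) * A α β p * mpd β f p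

lemma integrable_form_term {a g h : Pt n → ℂ} (ha : Measurable a) {Λ : ℝ}
    (hb : ∀ᵐ p, ‖a p‖ ≤ Λ) (hg : Continuous g) (hgc : HasCompactSupport g) (hh : Continuous h) :
    Integrable fun p => (starRingEnd ℂ) (g p) * a p * h p := by
  have hi : Integrable fun p => Λ * ‖g p * h p‖ :=
    ((hg.mul hh).integrable_of_hasCompactSupport hgc.mul_right).norm.const_mul Λ
  refine hi.mono' ?_ ?_
  · exact (((Complex.continuous_conj.comp hg).measurable.mul ha).mul
      hh.measurable).aestronglyMeasurable
  · filter_upwards [hb] with p hp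
    rw [norm_mul, norm_mul, RCLike.norm_conj, norm_mul]
    have := mul_le_mul_of_nonneg_left hp (mul_nonneg (norm_nonneg (g p)) (norm_nonneg (h p)))
    linarith

lemma mul_le_young {a b θ : ℝ} (hθ : 0 < θ) : a * b ≤ θ * a ^ 2 + θ⁻¹ * b ^ 2 := by
  have h1 : θ * θ⁻¹ = 1 := mul_inv_cancel₀ hθ.ne'
  have h2 : 0 < θ⁻¹ := by positivity
  have h3 : 0 ≤ θ * (a - θ⁻¹ * b) ^ 2 := by positivity
  have h4 : θ * (a - θ⁻¹ * b) ^ 2 = θ * a ^ 2 + θ⁻¹ * b ^ 2 - 2 * (a * b) := by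
    linear_combination (- 2 * a * b + θ⁻¹ * b ^ 2) * h1
  have h5 : 0 ≤ θ * a ^ 2 + θ⁻¹ * b ^ 2 := by positivity
  linarith

lemma form_commutator_term {a x E E' y z : ℂ} {Λ θ : ℝ} (ha : ‖a‖ ≤ Λ) (hθ : 0 < θ) :
    ‖(starRingEnd ℂ) x * a * (z * y + E) - (starRingEnd ℂ) ((starRingEnd ℂ) z * x + E') * a * y‖ ≤
      Λ * (θ * ‖x‖ ^ 2 + θ⁻¹ * ‖E‖ ^ 2 + (θ * ‖y‖ ^ 2 + θ⁻¹ * ‖E'‖ ^ 2)) := by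
  have h0 : (starRingEnd ℂ) x * a * (z * y + E) -
      (starRingEnd ℂ) ((starRingEnd ℂ) z * x + E') * a * y
      = a * ((starRingEnd ℂ) x * E - y * (starRingEnd ℂ) E') := by
    simp only [map_add, map_mul, Complex.conj_conj]
    ring
  rw [h0, norm_mul]
  refine mul_le_mul ha ?_ (norm_nonneg _) ((norm_nonneg _).trans ha)
  refine (norm_sub_le _ _).trans ?_
  rw [norm_mul, norm_mul, RCLike.norm_conj, RCLike.norm_conj]
  exact add_le_add (mul_le_young hθ) (mul_le_young hθ)

set_option maxHeartbeats 1000000 in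
lemma top_order_bound (n m : ℕ) {lam Λ : ℝ} (hlam : 0 < lam) (hΛ : 0 ≤ Λ) :
    ∃ K : ℝ, 1 ≤ K ∧ ∀ A : Coef n, CoefMeasurable A → CoefBounded m A Λ → Garding m A lam →
    ∀ f : Pt n → ℂ, Smooth f → ∀ e : ℝ,
      (∀ φ, IsTest (Metric.ball 0 (3 / 4)) φ → ∀ s : ℝ, 0 < s →
        ‖form m A φ f‖ ≤ s * energy m φ + e / s) →
    ∀ r R s θ : ℝ, 1 / 2 ≤ r → r < R → R < 3 / 4 → 0 < s → 0 < θ →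
      jetInt (m + 1) f r ≤ jetInt m f r + K * (s * ((R - r)⁻¹ ^ m) ^ 4 * jetInt (m + 1) f R + e / s
        + (θ * ((R - r)⁻¹ ^ m) ^ 2 * jetInt (m + 1) f R
          + θ⁻¹ * ((R - r)⁻¹ ^ m) ^ 4 * jetInt m f R)) := by
  obtain ⟨C₂, hC₂, hcut⟩ := exists_cutoff n m
  obtain ⟨C₃, hC₃, hjet⟩ := jet_mul_bound n m
  obtain ⟨C₄, hC₄, hlei⟩ := leibniz_bound n m
  set N : ℝ := ((MI n m).card : ℝ) ^ 2 with hN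
  set P : ℝ := C₃ * C₃ * C₂ ^ 4 with hP
  set Q : ℝ := N * Λ * (2 * (C₃ * C₂ ^ 2)) with hQ
  set T : ℝ := N * Λ * (2 * (C₄ * C₃ * C₂ ^ 4)) with hT
  have hP0 : 0 ≤ P := by positivity
  have hQ0 : 0 ≤ Q := by positivity
  have hT0 : 0 ≤ T := by positivity
  set K : ℝ := lam⁻¹ * (1 + P + Q + T) + 1 with hKdef
  refine ⟨K, le_add_of_nonneg_left (by positivity),
    fun A hAm hAb hG f hf e hform r R s θ hr hrR hR hs hθ => ?_⟩
  obtain ⟨η, hη, hηc, hηs, hηr, hη1, hηM⟩ := hcut r R (by linarith) hrR (by linarith)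
  set X := (R - r)⁻¹ ^ m with hX
  have hX1 : 1 ≤ X := one_le_pow₀ ((one_le_inv₀ (by linarith)).2 (by linarith))
  set v := η * f with hvdef
  set w := η * v with hwdef
  have hv : Smooth v := hη.fmul hf
  have hvc : HasCompactSupport v := hηc.mul_right
  have hvs : tsupport v ⊆ Metric.ball 0 R := (tsupport_mul_subset_left).trans hηs
  have hw : Smooth w := hη.fmul hv
  have hwc : HasCompactSupport w := hηc.mul_right
  have hws : tsupport w ⊆ Metric.ball 0 R := (tsupport_mul_subset_left).trans hηs
  have hM1 : 1 ≤ C₂ * X := one_le_mul_of_one_le_of_one_le hC₂ hX1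
  have hJv : ∀ p, ∀ k ≤ m + 1, jet k v p ≤ C₃ * ((C₂ * X) ^ 2 * jet k f p) := fun p =>
    hjet η f hη hf p _ fun γ hγ => hηM γ hγ p
  have hJw : ∀ p, ∀ k ≤ m + 1, jet k w p ≤ C₃ * ((C₂ * X) ^ 2 * jet k v p) := fun p =>
    hjet η v hη hv p _ fun γ hγ => hηM γ hγ p
  have hFR := jetInt_nonneg (m + 1) f R
  have hGR := jetInt_nonneg m f R
  have hEw : energy m w ≤ P * (X ^ 4 * jetInt (m + 1) f R) := by
    have h1 := (energy_le_jetInt (Nat.lt_succ_self m) hw hws).trans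
      (jetInt_mul_le hη hv (fun p => hJw p _ le_rfl) R)
    have h2 := jetInt_mul_le hη hf (fun p => hJv p _ le_rfl) R
    calc energy m w ≤ C₃ * ((C₂ * X) ^ 2 * (C₃ * ((C₂ * X) ^ 2 * jetInt (m + 1) f R))) :=
          h1.trans (by gcongr)
      _ = _ := by rw [hP]; ring
  have hterm : ∀ α ∈ MI n m, ∀ β ∈ MI n m,
      ‖(∫ p, (starRingEnd ℂ) (mpd α v p) * A α β p * mpd β v p) -
        ∫ p, (starRingEnd ℂ) (mpd α w p) * A α β p * mpd β f p‖ ≤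
      Λ * (2 * (C₃ * C₂ ^ 2)) * (θ * X ^ 2 * jetInt (m + 1) f R) +
        Λ * (2 * (C₄ * C₃ * C₂ ^ 4)) * (θ⁻¹ * X ^ 4 * jetInt m f R) := by
    intro α hα β hβ
    have hα' := mem_MI.1 hα
    have hβ' := mem_MI.1 hβ
    rw [← integral_sub
      (integrable_form_term (hAm α β) (hAb α hα β hβ) (hv.mpd α).continuous
        (hasCompactSupport_mpd hv hvc α) (hv.mpd β).continuous)
      (integrable_form_term (hAm α β) (hAb α hα β hβ) (hw.mpd α).continuous
        (hasCompactSupport_mpd hw hwc α) (hf.mpd β).continuous),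
      ← setIntegral_eq_integral_of_forall_compl_eq_zero (s := Metric.ball 0 R)]
    swap
    · intro p hp
      simp [mpd_eq_zero_of_notMem hv hvs _ hp, mpd_eq_zero_of_notMem hw hws _ hp]
    unfold jetInt
    simp only [← integral_const_mul]
    have i1 := ((integrableOn_ball_of_continuous (continuous_jet (m + 1) hf) 0 R).const_mul
      (θ * X ^ 2)).const_mul (Λ * (2 * (C₃ * C₂ ^ 2)))
    have i2 := ((integrableOn_ball_of_continuous (continuous_jet m hf) 0 R).const_mul
      (θ⁻¹ * X ^ 4)).const_mul (Λ * (2 * (C₄ * C₃ * C₂ ^ 4)))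
    rw [← integral_add i1 i2]
    refine norm_integral_le_of_norm_le (i1.add i2) (ae_restrict_of_ae ?_)
    filter_upwards [hAb α hα β hβ] with p hp
    have hMp : ∀ γ : Fin (n + 1) → ℕ, ∑ i, γ i ≤ m → ‖mpd γ η p‖ ≤ C₂ * X :=
      fun γ hγ => hηM γ hγ p
    have hE := hlei β hβ'.le η f hη hf p _ hMp
    have hE' := hlei α hα'.le η v hη hv p _ hMp
    rw [← hvdef, hβ'] at hE
    rw [← hwdef, hα'] at hE'
    set E := mpd β v p - η p * mpd β f p with hEd
    set E' := mpd α w p - η p * mpd α v p with hEd'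
    have e1 : mpd β v p = η p * mpd β f p + E := by rw [hEd]; ring
    have e2 : mpd α w p = (starRingEnd ℂ) (η p) * mpd α v p + E' := by rw [hEd', hηr]; ring
    rw [e1, e2]
    refine (form_commutator_term hp hθ).trans ?_
    have j1 := jet_nonneg (m + 1) f p
    have j2 := jet_nonneg m f p
    have s1 : ‖mpd α v p‖ ^ 2 ≤ C₃ * C₂ ^ 2 * (X ^ 2 * jet (m + 1) f p) := by
      refine ((sq_le_jet v p (by omega : ∑ i, α i < m + 1)).trans (hJv p _ le_rfl)).trans_eq ?_
      ring
    have s2 : ‖mpd β f p‖ ^ 2 ≤ C₃ * C₂ ^ 2 * (X ^ 2 * jet (m + 1) f p) := by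
      refine (sq_le_jet f p (by omega : ∑ i, β i < m + 1)).trans ?_
      have : 1 ≤ C₃ * (C₂ * X) ^ 2 := one_le_mul_of_one_le_of_one_le hC₃ (one_le_pow₀ hM1)
      calc jet (m + 1) f p ≤ C₃ * (C₂ * X) ^ 2 * jet (m + 1) f p := le_mul_of_one_le_left j1 this
        _ = _ := by ring
    have s3 : ‖E‖ ^ 2 ≤ C₄ * C₃ * C₂ ^ 4 * (X ^ 4 * jet m f p) := by
      refine hE.trans ?_
      have : 1 ≤ C₃ * (C₂ * X) ^ 2 := one_le_mul_of_one_le_of_one_le hC₃ (one_le_pow₀ hM1)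
      calc C₄ * ((C₂ * X) ^ 2 * jet m f p)
          ≤ C₃ * (C₂ * X) ^ 2 * (C₄ * ((C₂ * X) ^ 2 * jet m f p)) :=
            le_mul_of_one_le_left (by positivity) this
        _ = _ := by ring
    have s4 : ‖E'‖ ^ 2 ≤ C₄ * C₃ * C₂ ^ 4 * (X ^ 4 * jet m f p) := by
      refine hE'.trans ?_
      have := hJv p m (by omega)
      calc C₄ * ((C₂ * X) ^ 2 * jet m v p)
          ≤ C₄ * ((C₂ * X) ^ 2 * (C₃ * ((C₂ * X) ^ 2 * jet m f p))) := by gcongr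
        _ = _ := by ring
    calc Λ * (θ * ‖mpd α v p‖ ^ 2 + θ⁻¹ * ‖E‖ ^ 2 + (θ * ‖mpd β f p‖ ^ 2 + θ⁻¹ * ‖E'‖ ^ 2))
        ≤ Λ * (θ * (C₃ * C₂ ^ 2 * (X ^ 2 * jet (m + 1) f p))
            + θ⁻¹ * (C₄ * C₃ * C₂ ^ 4 * (X ^ 4 * jet m f p))
            + (θ * (C₃ * C₂ ^ 2 * (X ^ 2 * jet (m + 1) f p))
            + θ⁻¹ * (C₄ * C₃ * C₂ ^ 4 * (X ^ 4 * jet m f p)))) := by gcongr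
      _ = _ := by ring
  have hdiff : ‖form m A v v - form m A w f‖ ≤
      Q * (θ * X ^ 2 * jetInt (m + 1) f R) + T * (θ⁻¹ * X ^ 4 * jetInt m f R) := by
    unfold form
    rw [← Finset.sum_sub_distrib]
    simp only [← Finset.sum_sub_distrib]
    refine (norm_sum_le_of_le _ fun α hα => norm_sum_le_of_le _ fun β hβ =>
      hterm α hα β hβ).trans_eq ?_
    simp only [Finset.sum_const, nsmul_eq_mul, hQ, hT, hN]
    ring
  have hgar : lam * energy m v ≤ (form m A v v).re := hG v hv hvc
  have hwf := hform w ⟨hw, hwc, hws.trans (Metric.ball_subset_ball hR.le)⟩ s hs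
  have hre : (form m A v v).re ≤ ‖form m A w f‖ + ‖form m A v v - form m A w f‖ := by
    refine (Complex.re_le_norm _).trans ?_
    rw [add_comm]
    simpa using norm_add_le (form m A v v - form m A w f) (form m A w f)
  have he : 0 ≤ e := by
    have h0 := hform 0 ⟨smooth_zero, HasCompactSupport.zero, by simp⟩ 1 one_pos
    have h1 : energy m (0 : Pt n → ℂ) = 0 := by simp [energy, mpd_zero_fun]
    rw [h1] at h0
    have := norm_nonneg (form m A 0 f)
    linarith
  have hes : 0 ≤ e / s := by positivity
  have hsum : jetInt (m + 1) f r ≤ jetInt m f r + energy m v := by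
    rw [integral_jet_eq _ hf, integral_jet_eq _ hf, Finset.sum_range_succ]
    gcongr
    exact Finset.sum_le_sum fun γ _ =>
      setIntegral_le_of_eqOn hf hv hvc (fun p hp => by simp [hvdef, hη1 p hp]) γ
  refine hsum.trans (add_le_add le_rfl ?_)
  have y1 : 0 ≤ s * X ^ 4 * jetInt (m + 1) f R := by positivity
  have y2 : 0 ≤ θ * X ^ 2 * jetInt (m + 1) f R := by positivity
  have y3 : 0 ≤ θ⁻¹ * X ^ 4 * jetInt m f R := by positivity
  set Y₁ := s * X ^ 4 * jetInt (m + 1) f R with hY₁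
  set Y₂ := θ * X ^ 2 * jetInt (m + 1) f R
  set Y₃ := θ⁻¹ * X ^ 4 * jetInt m f R
  have hEw' : s * energy m w ≤ P * Y₁ := by
    calc s * energy m w ≤ s * (P * (X ^ 4 * jetInt (m + 1) f R)) := by gcongr
      _ = _ := by rw [hY₁]; ring
  have hmain : lam * energy m v ≤ (1 + P + Q + T) * (Y₁ + e / s + (Y₂ + Y₃)) := by
    have : lam * energy m v ≤ P * Y₁ + e / s + (Q * Y₂ + T * Y₃) := by linarith
    refine this.trans ?_
    nlinarith [mul_nonneg hP0 y2, mul_nonneg hP0 y3, mul_nonneg hP0 hes, mul_nonneg hQ0 y1,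
      mul_nonneg hQ0 y3, mul_nonneg hQ0 hes, mul_nonneg hT0 y1, mul_nonneg hT0 y2,
      mul_nonneg hT0 hes]
  calc energy m v = lam⁻¹ * (lam * energy m v) := by field_simp
    _ ≤ lam⁻¹ * ((1 + P + Q + T) * (Y₁ + e / s + (Y₂ + Y₃))) := by gcongr
    _ ≤ K * (Y₁ + e / s + (Y₂ + Y₃)) := by
        rw [hKdef]
        have : 0 ≤ Y₁ + e / s + (Y₂ + Y₃) := by positivity
        nlinarith

set_option maxHeartbeats 1000000 in
/-- The interior estimate for smooth functions solving the equation up to a small error. -/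
lemma interior_estimate (n m : ℕ) {lam Λ : ℝ} (hlam : 0 < lam) (hΛ : 0 ≤ Λ) :
    ∃ K : ℝ, 0 ≤ K ∧ ∀ A : Coef n, CoefMeasurable A → CoefBounded m A Λ → Garding m A lam →
    ∀ f : Pt n → ℂ, Smooth f → ∀ e : ℝ,
      (∀ φ, IsTest (Metric.ball 0 (3 / 4)) φ → ∀ s : ℝ, 0 < s →
        ‖form m A φ f‖ ≤ s * energy m φ + e / s) →
      jetInt (m + 1) f (1 / 2) ≤ K * ((∫ p in Metric.ball 0 (3 / 4), ‖f p‖) ^ 2 + e) := by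
  obtain ⟨K₁, hK₁, q, hA⟩ := lower_order_bound n m
  obtain ⟨K₂, hK₂, hB⟩ := top_order_bound n m hlam hΛ
  set K := max K₁ K₂ with hKdef
  have hK : 1 ≤ K := hK₁.trans (le_max_left _ _)
  set N : ℕ := m * (8 + 8 * q) with hN
  set a : ℝ := (1 / 2) ^ (N + 1) with ha
  have ha0 : 0 < a := by positivity
  have ha1 : a ≤ 1 := pow_le_one₀ (by norm_num) (by norm_num)
  set D : ℝ := (9 * K ^ 3 / a * (18 * K ^ 3 / a ^ 2) ^ q + 8 * K ^ 2 / a) * 2 ^ N with hD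
  refine ⟨4 ^ N * (2 * (2 ^ N * D)), by positivity, fun A hAm hAb hG f hf e hform => ?_⟩
  set W := (∫ p in Metric.ball (0 : Pt n) (3 / 4), ‖f p‖) ^ 2 with hW
  have hW0 : 0 ≤ W := sq_nonneg _
  have he : 0 ≤ e := by
    have h0 := hform 0 ⟨smooth_zero, HasCompactSupport.zero, by simp⟩ 1 one_pos
    have h1 : energy m (0 : Pt n → ℂ) = 0 := by simp [energy, mpd_zero_fun]
    rw [h1] at h0
    have := norm_nonneg (form m A 0 f)
    linarith
  have key := iteration_bound (F := jetInt (m + 1) f) (B := jetInt (m + 1) f (3 / 4))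
    (D := D * (W + e)) (N := N) (jetInt_nonneg _ _ _)
    (fun ρ _ h => jetInt_mono _ hf h.le) ?_
  · refine key.trans_eq ?_
    ring
  intro r R hr hrR hR
  set ρ := (r + R) / 2 with hρ
  have hd1 : ρ - r = (R - r) / 2 := by rw [hρ]; ring
  have hd2 : R - ρ = (R - r) / 2 := by rw [hρ]; ring
  set X : ℝ := ((R - r) / 2)⁻¹ ^ m with hX
  have hX1 : 1 ≤ X := one_le_pow₀ ((one_le_inv₀ (by linarith)).2 (by linarith))
  have hX0 : 0 < X := by linarith
  set FR := jetInt (m + 1) f R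
  have hFR : 0 ≤ FR := jetInt_nonneg _ _ _
  set s : ℝ := a / (8 * K * X ^ 4) with hs
  set θ : ℝ := a / (8 * K * X ^ 2) with hθ
  have hs0 : 0 < s := by positivity
  have hθ0 : 0 < θ := by positivity
  set κ : ℝ := a ^ 2 / (18 * K ^ 3 * X ^ 8) with hκ
  have hκ0 : 0 < κ := by positivity
  have hκ1 : κ ≤ 1 := by
    rw [hκ, div_le_one (by positivity)]
    have h1 : a ^ 2 ≤ 1 := pow_le_one₀ ha0.le ha1
    have h2 : 1 ≤ K ^ 3 * X ^ 8 :=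
      one_le_mul_of_one_le_of_one_le (one_le_pow₀ hK) (one_le_pow₀ hX1)
    linarith
  have hb := hB A hAm hAb hG f hf e hform r ρ s θ hr (by linarith) (by linarith) hs0 hθ0
  have hg := hA f hf ρ R κ (by linarith) (by linarith) hR hκ0 hκ1
  rw [hd1, ← hX] at hb
  rw [hd2, ← hX] at hg
  have hGr : jetInt m f r ≤ jetInt m f ρ := jetInt_mono _ hf (by linarith)
  have hFρ : jetInt (m + 1) f ρ ≤ FR := jetInt_mono _ hf (by linarith)
  set G := jetInt m f ρ with hGdef
  have hG0 : 0 ≤ G := jetInt_nonneg _ _ _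
  have hb' : jetInt (m + 1) f r ≤ G + K * (s * X ^ 4 * FR + e / s
      + (θ * X ^ 2 * FR + θ⁻¹ * X ^ 4 * G)) := by
    refine hb.trans (add_le_add hGr ?_)
    have hK2 : K₂ ≤ K := le_max_right _ _
    have := jetInt_nonneg (m + 1) f ρ
    gcongr
  have hg' : G ≤ κ * (K * X ^ 2 * FR) + K * κ⁻¹ ^ q * X ^ 2 * W := by
    refine hg.trans ?_
    have hK1 : K₁ ≤ K := le_max_left _ _
    gcongr
  have e1 : K * (s * X ^ 4 * FR) = a / 8 * FR := by rw [hs]; field_simp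
  have e2 : K * (θ * X ^ 2 * FR) = a / 8 * FR := by rw [hθ]; field_simp
  have e3 : K * (θ⁻¹ * X ^ 4 * G) = 8 * K ^ 2 * X ^ 6 / a * G := by rw [hθ]; field_simp
  have e4 : K * (e / s) = 8 * K ^ 2 * X ^ 4 / a * e := by rw [hs]; field_simp
  have c1 : 1 ≤ K ^ 2 * X ^ 6 / a := by
    rw [one_le_div ha0]
    exact ha1.trans (one_le_mul_of_one_le_of_one_le (one_le_pow₀ hK) (one_le_pow₀ hX1))
  have c2 : G + 8 * K ^ 2 * X ^ 6 / a * G ≤ 9 * K ^ 2 * X ^ 6 / a * G := by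
    have : G ≤ K ^ 2 * X ^ 6 / a * G := le_mul_of_one_le_left hG0 c1
    have e : 9 * K ^ 2 * X ^ 6 / a * G =
        K ^ 2 * X ^ 6 / a * G + 8 * K ^ 2 * X ^ 6 / a * G := by ring
    linarith
  have c3 : 9 * K ^ 2 * X ^ 6 / a * G ≤ a / 2 * FR +
      9 * K ^ 3 / a * (18 * K ^ 3 / a ^ 2) ^ q * X ^ (8 + 8 * q) * W := by
    have : 9 * K ^ 2 * X ^ 6 / a * G ≤
        9 * K ^ 2 * X ^ 6 / a * (κ * (K * X ^ 2 * FR) + K * κ⁻¹ ^ q * X ^ 2 * W) := by gcongr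
    refine this.trans_eq ?_
    have e5 : κ⁻¹ ^ q = (18 * K ^ 3 / a ^ 2) ^ q * X ^ (8 * q) := by
      rw [pow_mul, ← mul_pow, hκ]
      congr 1
      field_simp
    have e6 : 9 * K ^ 2 * X ^ 6 / a * (κ * (K * X ^ 2 * FR)) = a / 2 * FR := by
      rw [hκ]; field_simp; ring
    rw [mul_add, e6, e5, pow_add]
    ring
  have hXN : X ^ (8 + 8 * q) = 2 ^ N * (R - r)⁻¹ ^ N := by
    rw [hX, ← pow_mul, ← hN, ← mul_pow]
    congr 1
    rw [inv_div]
    field_simp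
  have c4 : X ^ 4 ≤ X ^ (8 + 8 * q) := pow_le_pow_right₀ hX1 (by omega)
  have hXq : 0 ≤ X ^ (8 + 8 * q) := by positivity
  have c5 : 8 * K ^ 2 * X ^ 4 / a * e ≤ 8 * K ^ 2 / a * (X ^ (8 + 8 * q) * e) := by
    calc 8 * K ^ 2 * X ^ 4 / a * e = 8 * K ^ 2 / a * (X ^ 4 * e) := by ring
      _ ≤ _ := by gcongr
  have h1 : 0 ≤ 9 * K ^ 3 / a * (18 * K ^ 3 / a ^ 2) ^ q * (X ^ (8 + 8 * q) * e) := by positivity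
  have h2 : 0 ≤ 8 * K ^ 2 / a * (X ^ (8 + 8 * q) * W) := by positivity
  have e7 : D * (W + e) * (R - r)⁻¹ ^ N =
      (9 * K ^ 3 / a * (18 * K ^ 3 / a ^ 2) ^ q + 8 * K ^ 2 / a) * (X ^ (8 + 8 * q) * W
        + X ^ (8 + 8 * q) * e) := by
    rw [hXN, hD]; ring
  rw [e7]
  have hFa : 0 ≤ a * FR := by positivity
  linarith

/-! ### Taylor polynomials and a Poincaré inequality -/

/-- The monomial `(z - Y)^γ`. -/
def monom (Y : Pt n) (γ : Fin (n + 1) → ℕ) (z : Pt n) : ℂ :=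
  ∏ i, ((coord i z - coord i Y : ℝ) : ℂ) ^ γ i

lemma smooth_coord (i : Fin (n + 1)) : Smooth fun z : Pt n => ((coord i z : ℝ) : ℂ) := by
  unfold coord
  split_ifs with h
  · exact Complex.ofRealCLM.contDiff.comp ((contDiff_apply ℝ ℝ (⟨i, h⟩ : Fin n)).comp contDiff_fst)
  · exact Complex.ofRealCLM.contDiff.comp contDiff_snd

lemma smooth_monom (Y : Pt n) (γ : Fin (n + 1) → ℕ) : Smooth (monom Y γ) := by
  refine contDiff_prod fun i _ => ContDiff.pow ?_ _
  simp only [Complex.ofReal_sub]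
  exact (smooth_coord i).sub contDiff_const

lemma coord_add_smul_edir (z : Pt n) (s : ℝ) (i l : Fin (n + 1)) :
    coord i (z + s • edir n l) = coord i z + if i = l then s else 0 := by
  unfold coord edir
  by_cases hi : (i : ℕ) < n <;> by_cases hl : (l : ℕ) < n
  · simp only [hi, hl, dite_true, Prod.fst_add, Prod.smul_fst, Pi.add_apply, Pi.smul_apply,
      Pi.single_apply, smul_eq_mul, mul_ite, mul_one, mul_zero, Fin.ext_iff]
  · have : i ≠ l := fun h => hl (h ▸ hi)
    simp [hi, hl, this]
  · have : i ≠ l := fun h => hi (h ▸ hl)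
    simp [hi, hl, this]
  · have : i = l := Fin.ext (by omega)
    simp [hl, this]

lemma pdir_monom (Y : Pt n) (γ : Fin (n + 1) → ℕ) (l : Fin (n + 1)) :
    pdir (edir n l) (monom Y γ) = (γ l : ℂ) • monom Y (γ - emi l) := by
  funext z
  have h1 : HasDerivAt (fun s : ℝ => z + s • edir n l) (edir n l) 0 := by
    simpa using ((hasDerivAt_id (0 : ℝ)).smul_const (edir n l)).const_add z
  have h2 : HasDerivAt (fun s : ℝ => monom Y γ (z + s • edir n l))
      (pdir (edir n l) (monom Y γ) z) 0 := by
    have h3 : HasFDerivAt (monom Y γ) (fderiv ℝ (monom Y γ) z) (z + (0 : ℝ) • edir n l) := by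
      simpa using ((smooth_monom Y γ).differentiable' z).hasFDerivAt
    exact h3.comp_hasDerivAt 0 h1
  set R : ℂ := ∏ i ∈ Finset.univ.erase l, ((coord i z - coord i Y : ℝ) : ℂ) ^ γ i with hR
  have h4 : ∀ s : ℝ, monom Y γ (z + s • edir n l)
      = ((s + (coord l z - coord l Y) : ℝ) : ℂ) ^ γ l * R := by
    intro s
    unfold monom
    rw [← Finset.mul_prod_erase _ _ (Finset.mem_univ l)]
    congr 1
    · rw [coord_add_smul_edir, if_pos rfl]
      congr 2; ring
    · refine Finset.prod_congr rfl fun i hi => ?_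
      rw [coord_add_smul_edir, if_neg (Finset.ne_of_mem_erase hi), add_zero]
  have h5 : HasDerivAt (fun s : ℝ => ((s + (coord l z - coord l Y) : ℝ) : ℂ) ^ γ l * R)
      ((γ l : ℂ) * ((0 + (coord l z - coord l Y) : ℝ) : ℂ) ^ (γ l - 1) * 1 * R) 0 := by
    have h6 : HasDerivAt (fun s : ℝ => ((s + (coord l z - coord l Y) : ℝ) : ℂ)) 1 0 := by
      simpa using ((hasDerivAt_id (0 : ℝ)).add_const (coord l z - coord l Y)).ofReal_comp
    exact (h6.pow (γ l)).mul_const R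
  simp only [h4] at h2
  rw [h2.unique h5, Pi.smul_apply, smul_eq_mul]
  unfold monom
  rw [← Finset.mul_prod_erase _ _ (Finset.mem_univ l)]
  have h7 : ∏ i ∈ Finset.univ.erase l, ((coord i z - coord i Y : ℝ) : ℂ) ^ (γ - emi l) i = R := by
    refine Finset.prod_congr rfl fun i hi => ?_
    simp [emi, Finset.ne_of_mem_erase hi]
  rw [h7]
  simp [emi, mul_assoc]

lemma mpd_monom (Y : Pt n) (γ γ' : Fin (n + 1) → ℕ) :
    mpd γ' (monom Y γ) = ((∏ i, (γ i).descFactorial (γ' i) : ℕ) : ℂ) • monom Y (γ - γ') := by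
  induction γ' using mi_induction with
  | h0 => simp [mpd_zero]
  | hs γ' l ih =>
    rw [mpd_add_single (smooth_monom Y γ), ih, pdir_const_smul _ (smooth_monom _ _), pdir_monom,
      smul_smul]
    congr 1
    · rw [← Finset.mul_prod_erase _ _ (Finset.mem_univ l),
        ← Finset.mul_prod_erase _ (fun i => (γ i).descFactorial ((γ' + emi l) i))
          (Finset.mem_univ l)]
      have h7 : ∏ i ∈ Finset.univ.erase l, (γ i).descFactorial ((γ' + emi l) i)
          = ∏ i ∈ Finset.univ.erase l, (γ i).descFactorial (γ' i) :=
        Finset.prod_congr rfl fun i hi => by simp [emi, Finset.ne_of_mem_erase hi]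
      rw [h7]
      simp only [emi, Pi.add_apply, Pi.single_eq_same, Nat.descFactorial_succ, Pi.sub_apply]
      push_cast
      ring
    · rw [tsub_tsub]

lemma mpd_monom_eq_zero (Y : Pt n) {γ γ' : Fin (n + 1) → ℕ} (h : ∃ i, γ i < γ' i) :
    mpd γ' (monom Y γ) = 0 := by
  obtain ⟨i, hi⟩ := h
  rw [mpd_monom, Finset.prod_eq_zero (Finset.mem_univ i) (Nat.descFactorial_of_lt hi)]
  simp

lemma mpd_monom_self (Y : Pt n) (γ γ' : Fin (n + 1) → ℕ) :
    mpd γ' (monom Y γ) Y = if γ = γ' then ((∏ i, (γ i).factorial : ℕ) : ℂ) else 0 := by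
  split_ifs with h
  · subst h
    rw [mpd_monom]
    simp [monom, Nat.descFactorial_self]
  · by_cases h2 : ∃ i, γ i < γ' i
    · rw [mpd_monom_eq_zero Y h2]; rfl
    · push Not at h2
      obtain ⟨i, hi⟩ := Function.ne_iff.1 h
      rw [mpd_monom, Pi.smul_apply]
      have : monom Y (γ - γ') Y = 0 := by
        refine Finset.prod_eq_zero (Finset.mem_univ i) ?_
        have : γ' i < γ i := lt_of_le_of_ne (h2 i) (Ne.symm hi)
        simp; omega
      rw [this, smul_zero]

lemma smooth_sum {ι : Type*} (s : Finset ι) {f : ι → Pt n → ℂ} (hf : ∀ i ∈ s, Smooth (f i)) :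
    Smooth (∑ i ∈ s, f i) := by
  have := ContDiff.sum (𝕜 := ℝ) (n := (⊤ : ℕ∞)) hf
  have e : (∑ i ∈ s, f i) = fun x => ∑ i ∈ s, f i x := by funext x; simp
  rw [e]; exact this

lemma mpd_sum {ι : Type*} (s : Finset ι) {f : ι → Pt n → ℂ} (hf : ∀ i ∈ s, Smooth (f i))
    (γ : Fin (n + 1) → ℕ) : mpd γ (∑ i ∈ s, f i) = ∑ i ∈ s, mpd γ (f i) := by
  classical
  induction s using Finset.induction_on with
  | empty => simpa using mpd_zero_fun γ
  | insert a s ha ih =>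
    have h2 : ∀ i ∈ s, Smooth (f i) := fun i hi => hf i (Finset.mem_insert_of_mem hi)
    rw [Finset.sum_insert ha, Finset.sum_insert ha,
      mpd_add (hf a (Finset.mem_insert_self _ _)) (smooth_sum s h2), ih h2]

/-- Existence of Taylor polynomials of degree less than `j`. -/
lemma exists_taylor (j : ℕ) {f : Pt n → ℂ} (Y : Pt n) :
    ∃ P : Pt n → ℂ, Smooth P ∧ (∀ γ : Fin (n + 1) → ℕ, j ≤ ∑ i, γ i → mpd γ P = 0) ∧
      ∀ γ : Fin (n + 1) → ℕ, ∑ i, γ i < j → mpd γ P Y = mpd γ f Y := by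
  set t : (Fin (n + 1) → ℕ) → Pt n → ℂ := fun γ =>
    (mpd γ f Y / ((∏ i, (γ i).factorial : ℕ) : ℂ)) • monom Y γ with ht
  have hts : ∀ γ, Smooth (t γ) := fun γ => (smooth_monom Y γ).fsmul _
  have hmt : ∀ γ γ', mpd γ' (t γ) = (mpd γ f Y / ((∏ i, (γ i).factorial : ℕ) : ℂ)) •
      mpd γ' (monom Y γ) := fun γ γ' => mpd_const_smul _ (smooth_monom Y γ) γ'
  have hs : ∀ k ∈ Finset.range j, Smooth (∑ γ ∈ MI n k, t γ) := fun k _ =>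
    smooth_sum _ fun γ _ => hts γ
  have hm : ∀ γ', mpd γ' (∑ k ∈ Finset.range j, ∑ γ ∈ MI n k, t γ) =
      ∑ k ∈ Finset.range j, ∑ γ ∈ MI n k, mpd γ' (t γ) := by
    intro γ'
    rw [mpd_sum _ hs]
    exact Finset.sum_congr rfl fun k _ => mpd_sum _ (fun γ _ => hts γ) γ'
  refine ⟨∑ k ∈ Finset.range j, ∑ γ ∈ MI n k, t γ, smooth_sum _ hs, fun γ' hγ' => ?_,
    fun γ' hγ' => ?_⟩
  · rw [hm]
    refine Finset.sum_eq_zero fun k hk => Finset.sum_eq_zero fun γ hγ => ?_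
    rw [hmt, mpd_monom_eq_zero, smul_zero]
    by_contra h
    push Not at h
    have h1 := Finset.sum_le_sum fun i (_ : i ∈ Finset.univ) => h i
    have h2 := mem_MI.1 hγ
    have h3 := Finset.mem_range.1 hk
    omega
  · rw [hm, Finset.sum_apply, Finset.sum_eq_single (∑ i, γ' i)]
    · rw [Finset.sum_apply, Finset.sum_eq_single γ']
      · rw [hmt, Pi.smul_apply, mpd_monom_self, if_pos rfl, smul_eq_mul, div_mul_cancel₀]
        exact Nat.cast_ne_zero.2 (Finset.prod_ne_zero_iff.2 fun i _ => Nat.factorial_ne_zero _)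
      · intro γ _ h
        rw [hmt, Pi.smul_apply, mpd_monom_self, if_neg h, smul_zero]
      · intro h; exact absurd (mem_MI.2 rfl) h
    · intro k _ hk
      rw [Finset.sum_apply]
      refine Finset.sum_eq_zero fun γ hγ => ?_
      rw [hmt, Pi.smul_apply, mpd_monom_self, if_neg, smul_zero]
      rintro rfl
      exact hk (mem_MI.1 hγ).symm
    · intro h; exact absurd (Finset.mem_range.2 hγ') h

/-- The `ℓ¹` size of the derivatives of order `k`. -/
def ordE (k : ℕ) (f : Pt n → ℂ) (p : Pt n) : ℝ≥0∞ := ∑ γ ∈ MI n k, ‖mpd γ f p‖ₑ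

lemma continuous_ordE (k : ℕ) {f : Pt n → ℂ} (hf : Smooth f) : Continuous (ordE k f) :=
  continuous_finsetSum _ fun γ _ => (hf.mpd γ).continuous.enorm

lemma enorm_mpd_le_ordE {k : ℕ} {γ : Fin (n + 1) → ℕ} (hγ : ∑ i, γ i = k) (f : Pt n → ℂ)
    (p : Pt n) : ‖mpd γ f p‖ₑ ≤ ordE k f p :=
  Finset.single_le_sum (f := fun γ => ‖mpd γ f p‖ₑ) (fun _ _ => zero_le) (mem_MI.2 hγ)

/-- The fundamental theorem of calculus along a line, as an inequality. -/
lemma enorm_line_le {f : Pt n → ℂ} (hf : Smooth f) (x v : Pt n) (a b : ℝ) :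
    ‖f (x + b • v)‖ₑ ≤ ‖f (x + a • v)‖ₑ + ∫⁻ s in Set.uIoc a b, ‖pdir v f (x + s • v)‖ₑ := by
  have hd : ∀ s : ℝ, HasDerivAt (fun s : ℝ => f (x + s • v)) (pdir v f (x + s • v)) s := by
    intro s
    have h1 : HasDerivAt (fun s : ℝ => x + s • v) v s := by
      simpa using ((hasDerivAt_id s).smul_const v).const_add x
    exact (hf.differentiable' (x + s • v)).hasFDerivAt.comp_hasDerivAt s h1
  have hc : Continuous fun s : ℝ => pdir v f (x + s • v) :=
    (hf.pdir v).continuous.comp (by fun_prop)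
  have h := intervalIntegral.integral_eq_sub_of_hasDerivAt (fun s _ => hd s)
    (hc.intervalIntegrable a b)
  have h2 : f (x + b • v) = f (x + a • v) + ∫ s in a..b, pdir v f (x + s • v) := by
    rw [h]; ring
  rw [h2]
  refine (enorm_add_le _ _).trans ?_
  gcongr
  rw [← ofReal_norm, intervalIntegral.norm_intervalIntegral_eq, ofReal_norm]
  exact enorm_integral_le_lintegral_enorm _

lemma enorm_pdir_mpd_le {f : Pt n → ℂ} (hf : Smooth f) {v : Pt n} (hv : ‖v‖ ≤ 2) {k : ℕ}
    {γ : Fin (n + 1) → ℕ} (hγ : ∑ i, γ i = k) (p : Pt n) :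
    ‖pdir v (mpd γ f) p‖ₑ ≤ (2 * (n + 1) : ℕ) * ordE (k + 1) f p := by
  rw [pdir_eq_sum]
  calc ‖∑ i, (coord i v : ℂ) * pdir (edir n i) (mpd γ f) p‖ₑ
      ≤ ∑ i, ‖(coord i v : ℂ) * pdir (edir n i) (mpd γ f) p‖ₑ := enorm_sum_le _ _
    _ ≤ ∑ i : Fin (n + 1), 2 * ordE (k + 1) f p := by
        gcongr with i
        rw [enorm_mul, ← mpd_add_single hf]
        gcongr
        · rw [← ofReal_norm, Complex.norm_real, Real.norm_eq_abs]
          refine (ENNReal.ofReal_le_ofReal ((abs_coord_le i v).trans hv)).trans ?_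
          simp
        · exact enorm_mpd_le_ordE (by rw [mi_sum_add_single, hγ]) f p
    _ = _ := by simp; ring

/-- If all derivatives of order `k` vanish at `Y`, they are controlled along rays from `Y` by the
derivatives of order `k + 1`. -/
lemma ordE_ray_le {g : Pt n → ℂ} (hg : Smooth g) {Y v : Pt n} (hv : ‖v‖ ≤ 2) {k : ℕ}
    (hY : ∀ γ : Fin (n + 1) → ℕ, ∑ i, γ i = k → mpd γ g Y = 0) {s : ℝ} (hs : s ∈ Icc (0 : ℝ) 1) :
    ordE k g (Y + s • v) ≤ (((MI n k).card * (2 * (n + 1)) : ℕ) : ℝ≥0∞) *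
      ∫⁻ r in Ioc (0 : ℝ) 1, ordE (k + 1) g (Y + r • v) := by
  have hc : Measurable fun r : ℝ => ordE (k + 1) g (Y + r • v) := by
    have : Continuous fun r : ℝ => ordE (k + 1) g (Y + r • v) :=
      (continuous_ordE (k + 1) hg).comp (by fun_prop)
    exact this.measurable
  calc ordE k g (Y + s • v)
      ≤ ∑ γ ∈ MI n k, ((2 * (n + 1) : ℕ) : ℝ≥0∞) *
          ∫⁻ r in Ioc (0 : ℝ) 1, ordE (k + 1) g (Y + r • v) := by
        refine Finset.sum_le_sum fun γ hγ => ?_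
        have h := enorm_line_le (hg.mpd γ) Y v 0 s
        rw [zero_smul, add_zero, hY γ (mem_MI.1 hγ), enorm_zero, zero_add,
          Set.uIoc_of_le hs.1] at h
        refine h.trans ?_
        rw [← lintegral_const_mul _ hc]
        refine (lintegral_mono_set (Set.Ioc_subset_Ioc_right hs.2)).trans ?_
        exact lintegral_mono fun r => enorm_pdir_mpd_le hg hv (mem_MI.1 hγ) _
    _ = _ := by
        rw [Finset.sum_const, nsmul_eq_mul]
        push_cast
        ring

lemma ordE_ray_iterate_le (n j : ℕ) : ∃ c : ℕ, 1 ≤ c ∧ ∀ g : Pt n → ℂ, Smooth g → ∀ Y v : Pt n,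
    ‖v‖ ≤ 2 → (∀ γ : Fin (n + 1) → ℕ, ∑ i, γ i < j → mpd γ g Y = 0) →
    ∀ k < j, ordE k g (Y + v) ≤ c * ∫⁻ r in Ioc (0 : ℝ) 1, ordE j g (Y + r • v) := by
  set d : ℕ := (∑ k ∈ Finset.range j, (MI n k).card * (2 * (n + 1))) + 1 with hd
  have hdk : ∀ k < j, (MI n k).card * (2 * (n + 1)) ≤ d := fun k hk =>
    (Finset.single_le_sum (f := fun k => (MI n k).card * (2 * (n + 1))) (fun _ _ => Nat.zero_le _)
      (Finset.mem_range.2 hk)).trans (Nat.le_succ _)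
  refine ⟨d ^ j, Nat.one_le_pow _ _ (Nat.succ_pos _), fun g hg Y v hv hY => ?_⟩
  have key : ∀ i k, k + (i + 1) = j → ∀ s ∈ Icc (0 : ℝ) 1, ordE k g (Y + s • v) ≤
      ((d ^ (i + 1) : ℕ) : ℝ≥0∞) * ∫⁻ r in Ioc (0 : ℝ) 1, ordE j g (Y + r • v) := by
    intro i
    induction i with
    | zero =>
      intro k hk s hs
      refine (ordE_ray_le hg hv (fun γ hγ => hY γ (by omega)) hs).trans ?_
      obtain rfl : k + 1 = j := by omega
      gcongr
      rw [zero_add, pow_one]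
      exact hdk k (by omega)
    | succ i ih =>
      intro k hk s hs
      refine (ordE_ray_le hg hv (fun γ hγ => hY γ (by omega)) hs).trans ?_
      have h1 : ∫⁻ r in Ioc (0 : ℝ) 1, ordE (k + 1) g (Y + r • v) ≤
          ∫⁻ _ in Ioc (0 : ℝ) 1, ((d ^ (i + 1) : ℕ) : ℝ≥0∞) *
            ∫⁻ r in Ioc (0 : ℝ) 1, ordE j g (Y + r • v) :=
        setLIntegral_mono' measurableSet_Ioc fun r hr =>
          ih (k + 1) (by omega) r ⟨hr.1.le, hr.2⟩
      rw [lintegral_const] at h1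
      simp only [MeasurableSet.univ, Measure.restrict_apply, Set.univ_inter, Real.volume_Ioc,
        sub_zero, ENNReal.ofReal_one, mul_one] at h1
      refine (mul_le_mul_right h1 _).trans ?_
      rw [← mul_assoc, ← Nat.cast_mul]
      gcongr
      rw [pow_succ d (i + 1), mul_comm]
      exact Nat.mul_le_mul_left _ (hdk k (by omega))
  intro k hk
  have h := key (j - k - 1) k (by omega) 1 ⟨zero_le_one, le_rfl⟩
  rw [one_smul] at h
  refine h.trans ?_
  gcongr
  · exact Nat.succ_pos _
  · omega

lemma vmi_succ (n k : ℕ) : vmi n (k + 1) = vmi n k + emi (Fin.last n) := by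
  funext i
  by_cases h : i = Fin.last n
  · subst h; simp [vmi, emi]
  · have : (i : ℕ) ≠ n := fun h' => h (Fin.ext h')
    simp [vmi, emi, this, h]

lemma vmi_sum (n k : ℕ) : ∑ i, vmi n k i = k := by
  rw [Finset.sum_eq_single (Fin.last n)]
  · simp [vmi]
  · intro i _ h
    have : (i : ℕ) ≠ n := fun h' => h (Fin.ext h')
    simp [vmi, this]
  · simp

lemma edir_last (n : ℕ) : edir n (Fin.last n) = (0, 1) := by simp [edir]

/-- One-dimensional vertical bound. -/
lemma enorm_vertical_le {g : Pt n → ℂ} (hg : Smooth g) (x : Fin n → ℝ) {τ t : ℝ}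
    (hτ : τ ∈ Ioo (-(3 / 4) : ℝ) (3 / 4)) (ht : t ∈ Ioo (-(3 / 4) : ℝ) (3 / 4)) (k : ℕ) :
    ‖mpd (vmi n k) g (x, t)‖ₑ ≤ ‖mpd (vmi n k) g (x, τ)‖ₑ +
      ∫⁻ s in Ioo (-(3 / 4) : ℝ) (3 / 4), ‖mpd (vmi n (k + 1)) g (x, s)‖ₑ := by
  have h := enorm_line_le (hg.mpd (vmi n k)) ((x, 0) : Pt n) (edir n (Fin.last n)) τ t
  rw [← mpd_add_single hg, ← vmi_succ, edir_last] at h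
  have e : ∀ s : ℝ, ((x, 0) : Pt n) + s • ((0, 1) : Pt n) = (x, s) := fun s => by simp
  simp only [e] at h
  refine h.trans ?_
  gcongr
  intro s hs
  rw [Set.mem_uIoc] at hs
  rcases hs with hs | hs
  · exact ⟨hτ.1.trans hs.1, hs.2.trans_lt ht.2⟩
  · exact ⟨ht.1.trans hs.1, hs.2.trans_lt hτ.2⟩

lemma enorm_vertical_iterate_le {g : Pt n → ℂ} (hg : Smooth g) (x : Fin n → ℝ) {τ t : ℝ}
    (hτ : τ ∈ Ioo (-(3 / 4) : ℝ) (3 / 4)) (ht : t ∈ Ioo (-(3 / 4) : ℝ) (3 / 4)) (i : ℕ) :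
    ‖g (x, t)‖ₑ ≤ 2 ^ i * (∑ k ∈ Finset.range (i + 1), ‖mpd (vmi n k) g (x, τ)‖ₑ +
      ∫⁻ s in Ioo (-(3 / 4) : ℝ) (3 / 4), ‖mpd (vmi n (i + 1)) g (x, s)‖ₑ) := by
  induction i with
  | zero =>
    have h := enorm_vertical_le hg x hτ ht 0
    have h0 : vmi n 0 = 0 := by funext i; simp [vmi]
    rw [h0, mpd_zero] at h
    simpa [h0, mpd_zero] using h
  | succ i ih =>
    refine ih.trans ?_
    have h1 : ∫⁻ s in Ioo (-(3 / 4) : ℝ) (3 / 4), ‖mpd (vmi n (i + 1)) g (x, s)‖ₑ ≤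
        ∫⁻ _ in Ioo (-(3 / 4) : ℝ) (3 / 4), (‖mpd (vmi n (i + 1)) g (x, τ)‖ₑ +
          ∫⁻ s in Ioo (-(3 / 4) : ℝ) (3 / 4), ‖mpd (vmi n (i + 1 + 1)) g (x, s)‖ₑ) :=
      setLIntegral_mono' measurableSet_Ioo fun s hs => enorm_vertical_le hg x hτ hs (i + 1)
    rw [lintegral_const] at h1
    simp only [MeasurableSet.univ, Measure.restrict_apply, Set.univ_inter, Real.volume_Ioo] at h1
    have h2 : ENNReal.ofReal (3 / 4 - -(3 / 4)) ≤ 2 := by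
      rw [← ENNReal.ofReal_ofNat]; exact ENNReal.ofReal_le_ofReal (by norm_num)
    have h3 := h1.trans (mul_le_mul_right h2 _)
    rw [Finset.sum_range_succ _ (i + 1), pow_succ, mul_assoc]
    gcongr
    set S := ∑ k ∈ Finset.range (i + 1), ‖mpd (vmi n k) g (x, τ)‖ₑ
    calc _ ≤ 2 * S + _ := add_le_add (le_mul_of_one_le_left zero_le one_le_two) h3
      _ = _ := by ring

lemma lintegral_comp_affine {E : Type*} [NormedAddCommGroup E] [NormedSpace ℝ E]
    [MeasurableSpace E] [BorelSpace E] [FiniteDimensional ℝ E] (μ : Measure E) [μ.IsAddHaarMeasure]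
    (h : E → ℝ≥0∞) (a : E) {c : ℝ} (hc : c ≠ 0) :
    ∫⁻ x, h (a + c • x) ∂μ =
      ENNReal.ofReal |(c ^ Module.finrank ℝ E)⁻¹| * ∫⁻ x, h x ∂μ := by
  have h1 : ∫⁻ x, h (a + c • x) ∂μ = ∫⁻ x, h (a + x) ∂(Measure.map (c • ·) μ) :=
    (lintegral_map_equiv (fun x => h (a + x)) (Homeomorph.smulOfNeZero c hc).toMeasurableEquiv).symm
  rw [h1, Measure.map_addHaar_smul μ hc, lintegral_smul_measure, smul_eq_mul,
    lintegral_add_left_eq_self h a]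

/-- Contracting a convex set towards one of its points changes integrals at most by the
Jacobian. -/
lemma setLIntegral_contract_le {B : Set (Fin n → ℝ)} (hB : Convex ℝ B) (hBm : MeasurableSet B)
    (h : (Fin n → ℝ) → ℝ≥0∞) {y : Fin n → ℝ} (hy : y ∈ B) {c : ℝ} (hc : c ∈ Icc (1 / 2 : ℝ) 1) :
    ∫⁻ x in B, h ((1 - c) • y + c • x) ≤ 2 ^ n * ∫⁻ x in B, h x := by
  have hc0 : 0 < c := by linarith [hc.1]
  calc ∫⁻ x in B, h ((1 - c) • y + c • x)
      ≤ ∫⁻ x, B.indicator h ((1 - c) • y + c • x) := by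
        rw [← lintegral_indicator hBm]
        refine lintegral_mono fun x => ?_
        by_cases hx : x ∈ B
        · have : (1 - c) • y + c • x ∈ B := hB hy hx (by linarith [hc.2]) hc0.le (by ring)
          simp [hx, this]
        · simp [hx]
    _ = ENNReal.ofReal |(c ^ n)⁻¹| * ∫⁻ x in B, h x := by
        rw [lintegral_comp_affine volume _ _ hc0.ne', lintegral_indicator hBm]
        simp
    _ ≤ _ := by
        gcongr
        rw [abs_of_pos (by positivity), ← inv_pow]
        have : c⁻¹ ≤ 2 := by
          rw [inv_le_comm₀ hc0 two_pos]; linarith [hc.1]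
        calc ENNReal.ofReal (c⁻¹ ^ n) ≤ ENNReal.ofReal (2 ^ n) :=
              ENNReal.ofReal_le_ofReal (pow_le_pow_left₀ (by positivity) this n)
          _ = 2 ^ n := by simp [ENNReal.ofReal_pow]

/-- There is a good center from which the segment integrals are controlled. -/
lemma exists_good_center {B : Set (Fin n → ℝ)} (hB : Convex ℝ B) (hBm : MeasurableSet B)
    (hB0 : volume B ≠ 0) (hB1 : volume B ≠ ∞) {h : (Fin n → ℝ) → ℝ≥0∞} (hh : Measurable h) :
    ∃ y ∈ B, ∫⁻ x in B, ∫⁻ s in Ioc (0 : ℝ) 1, h (y + s • (x - y)) ≤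
      2 ^ n * ∫⁻ x in B, h x := by
  set F : (Fin n → ℝ) → ℝ≥0∞ := fun y =>
    ∫⁻ x in B, ∫⁻ s in Ioc (0 : ℝ) 1, h (y + s • (x - y)) with hF
  have hm3 : Measurable fun z : ((Fin n → ℝ) × (Fin n → ℝ)) × ℝ =>
      h (z.1.1 + z.2 • (z.1.2 - z.1.1)) := by
    refine hh.comp ?_
    have : Continuous fun z : ((Fin n → ℝ) × (Fin n → ℝ)) × ℝ =>
      z.1.1 + z.2 • (z.1.2 - z.1.1) := by fun_prop
    exact this.measurable
  have hm2 : Measurable fun z : (Fin n → ℝ) × (Fin n → ℝ) =>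
      ∫⁻ s in Ioc (0 : ℝ) 1, h (z.1 + s • (z.2 - z.1)) := hm3.lintegral_prod_right'
  have hFm : Measurable F := hm2.lintegral_prod_right'
  obtain ⟨y, hy, hle⟩ := exists_le_setLAverage hB0 hB1 hFm.aemeasurable
  refine ⟨y, hy, hle.trans ?_⟩
  rw [setLAverage_eq]
  refine ENNReal.div_le_of_le_mul ?_
  have hs : ∀ s ∈ Ioc (0 : ℝ) 1, ∫⁻ y in B, ∫⁻ x in B, h (y + s • (x - y)) ≤
      2 ^ n * (∫⁻ x in B, h x) * volume B := by
    intro s hs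
    rcases le_total (1 / 2) s with h2 | h2
    · calc ∫⁻ y in B, ∫⁻ x in B, h (y + s • (x - y))
          ≤ ∫⁻ y in B, 2 ^ n * ∫⁻ x in B, h x := by
            refine setLIntegral_mono' hBm fun y hy => ?_
            refine le_trans (le_of_eq ?_) (setLIntegral_contract_le hB hBm h hy ⟨h2, hs.2⟩)
            congr 1; funext x; congr 1; module
        _ = _ := by rw [lintegral_const]; simp
    · calc ∫⁻ y in B, ∫⁻ x in B, h (y + s • (x - y))
          = ∫⁻ x in B, ∫⁻ y in B, h (y + s • (x - y)) := by
            refine lintegral_lintegral_swap ?_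
            refine (hh.comp ?_).aemeasurable
            have : Continuous fun z : (Fin n → ℝ) × (Fin n → ℝ) =>
              z.1 + s • (z.2 - z.1) := by fun_prop
            exact this.measurable
        _ ≤ ∫⁻ x in B, 2 ^ n * ∫⁻ y in B, h y := by
            refine setLIntegral_mono' hBm fun x hx => ?_
            refine le_trans (le_of_eq ?_) (setLIntegral_contract_le (c := 1 - s) hB hBm h hx
              ⟨by linarith, by linarith [hs.1]⟩)
            congr 1; funext y; congr 1; module
        _ = _ := by rw [lintegral_const]; simp
  calc ∫⁻ y in B, F y
      = ∫⁻ y in B, ∫⁻ s in Ioc (0 : ℝ) 1, ∫⁻ x in B, h (y + s • (x - y)) := by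
        congr 1; funext y
        refine lintegral_lintegral_swap ?_
        refine (hm3.comp (g := fun z : ((Fin n → ℝ) × (Fin n → ℝ)) × ℝ =>
          h (z.1.1 + z.2 • (z.1.2 - z.1.1))) (f := fun w : (Fin n → ℝ) × ℝ => ((y, w.1), w.2))
          (by fun_prop)).aemeasurable
    _ = ∫⁻ s in Ioc (0 : ℝ) 1, ∫⁻ y in B, ∫⁻ x in B, h (y + s • (x - y)) := by
        refine lintegral_lintegral_swap ?_
        have : Measurable fun w : ((Fin n → ℝ) × ℝ) × (Fin n → ℝ) =>
            h (w.1.1 + w.1.2 • (w.2 - w.1.1)) :=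
          hm3.comp (g := fun z : ((Fin n → ℝ) × (Fin n → ℝ)) × ℝ =>
            h (z.1.1 + z.2 • (z.1.2 - z.1.1)))
            (f := fun w : ((Fin n → ℝ) × ℝ) × (Fin n → ℝ) => ((w.1.1, w.2), w.1.2)) (by fun_prop)
        exact this.lintegral_prod_right'.aemeasurable
    _ ≤ ∫⁻ _ in Ioc (0 : ℝ) 1, 2 ^ n * (∫⁻ x in B, h x) * volume B :=
        setLIntegral_mono' measurableSet_Ioc hs
    _ = _ := by rw [lintegral_const]; simp

lemma setLIntegral_ball_eq (r : ℝ) {h : Pt n → ℝ≥0∞} (hh : Measurable h) :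
    ∫⁻ p in Metric.ball (0 : Pt n) r, h p =
      ∫⁻ x in Metric.ball (0 : Fin n → ℝ) r, ∫⁻ t in Ioo (-r) r, h (x, t) := by
  have e : Metric.ball (0 : Pt n) r = Metric.ball (0 : Fin n → ℝ) r ×ˢ Ioo (-r) r := by
    have := ball_prod_same (0 : Fin n → ℝ) (0 : ℝ) r
    rw [Real.ball_eq_Ioo, zero_sub, zero_add] at this
    exact this.symm
  rw [e, Measure.volume_eq_prod, ← Measure.prod_restrict, lintegral_prod _ hh.aemeasurable]

/-- A Poincaré inequality: up to a polynomial of degree less than `j`, a smooth function is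
controlled in `L¹` by a horizontal slice of its `j`-th gradient and its vertical derivative of
order `j + 1`. -/
lemma poincare_slice (n j : ℕ) : ∃ C : ℕ, ∀ f : Pt n → ℂ, Smooth f →
    ∀ τ ∈ Ioo (-(3 / 4) : ℝ) (3 / 4), ∃ P : Pt n → ℂ, Smooth P ∧
      (∀ γ : Fin (n + 1) → ℕ, j ≤ ∑ i, γ i → mpd γ P = 0) ∧
      ∫⁻ p in Metric.ball (0 : Pt n) (3 / 4), ‖(f - P) p‖ₑ ≤
        C * ((∫⁻ x in Metric.ball (0 : Fin n → ℝ) (3 / 4), ordE j f (x, τ)) +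
          ∫⁻ p in Metric.ball (0 : Pt n) (3 / 4), ‖mpd (vmi n (j + 1)) f p‖ₑ) := by
  obtain ⟨c, -, hcb⟩ := ordE_ray_iterate_le n j
  refine ⟨2 ^ (j + 1) * (j * c * 2 ^ n + 1), fun f hf τ hτ => ?_⟩
  set B := Metric.ball (0 : Fin n → ℝ) (3 / 4) with hB
  set I := Ioo (-(3 / 4) : ℝ) (3 / 4) with hI
  have hh : Continuous fun x : Fin n → ℝ => ordE j f (x, τ) :=
    (continuous_ordE j hf).comp (by fun_prop)
  obtain ⟨y, hy, hyle⟩ := exists_good_center (convex_ball (0 : Fin n → ℝ) (3 / 4))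
    Metric.isOpen_ball.measurableSet (Metric.measure_ball_pos volume _ (by norm_num)).ne'
    measure_ball_lt_top.ne hh.measurable
  obtain ⟨P, hP, hP0, hPY⟩ := exists_taylor j (f := f) (y, τ)
  refine ⟨P, hP, hP0, ?_⟩
  set g := f - P with hg
  have hgs : Smooth g := hf.fsub hP
  have hgγ : ∀ γ : Fin (n + 1) → ℕ, j ≤ ∑ i, γ i → mpd γ g = mpd γ f := fun γ hγ => by
    rw [hg, mpd_sub hf hP, hP0 γ hγ, sub_zero]
  have hgord : ordE j g = ordE j f := by
    funext p
    exact Finset.sum_congr rfl fun γ hγ => by rw [hgγ γ (mem_MI.1 hγ).ge]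
  have hgv : mpd (vmi n (j + 1)) g = mpd (vmi n (j + 1)) f :=
    hgγ _ (by rw [vmi_sum]; omega)
  have hgY : ∀ γ : Fin (n + 1) → ℕ, ∑ i, γ i < j → mpd γ g (y, τ) = 0 := fun γ hγ => by
    rw [hg, mpd_sub hf hP, Pi.sub_apply, hPY γ hγ, sub_self]
  have hray : ∀ x ∈ B, ∑ k ∈ Finset.range (j + 1), ‖mpd (vmi n k) g (x, τ)‖ₑ ≤
      (j * c : ℕ) * (∫⁻ s in Ioc (0 : ℝ) 1, ordE j f (y + s • (x - y), τ)) +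
        ordE j f (x, τ) := by
    intro x hx
    rw [Finset.sum_range_succ]
    refine add_le_add ?_ ?_
    · calc ∑ k ∈ Finset.range j, ‖mpd (vmi n k) g (x, τ)‖ₑ
          ≤ ∑ k ∈ Finset.range j, (c : ℝ≥0∞) *
              ∫⁻ s in Ioc (0 : ℝ) 1, ordE j f (y + s • (x - y), τ) := by
            refine Finset.sum_le_sum fun k hk => ?_
            have hv : ‖((x - y, 0) : Pt n)‖ ≤ 2 := by
              rw [Prod.norm_mk, norm_zero]
              refine max_le ((norm_sub_le x y).trans ?_) zero_le_two
              have h1 := mem_ball_zero_iff.1 hx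
              have h2 := mem_ball_zero_iff.1 hy
              linarith
            have h := hcb g hgs (y, τ) (x - y, 0) hv hgY k (Finset.mem_range.1 hk)
            rw [hgord] at h
            have e1 : ((y, τ) : Pt n) + (x - y, 0) = (x, τ) := by simp
            have e2 : ∀ r : ℝ, ((y, τ) : Pt n) + r • ((x - y, 0) : Pt n) =
                (y + r • (x - y), τ) := fun r => by simp
            simp only [e2, e1] at h
            exact (enorm_mpd_le_ordE (vmi_sum n k) g (x, τ)).trans h
        _ = _ := by rw [Finset.sum_const, Finset.card_range, nsmul_eq_mul]; push_cast; ring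
    · rw [← hgord]; exact enorm_mpd_le_ordE (vmi_sum n j) g (x, τ)
  set S := ∫⁻ x in B, ordE j f (x, τ) with hS
  have hvm : Measurable fun p : Pt n => ‖mpd (vmi n (j + 1)) f p‖ₑ :=
    (hf.mpd _).continuous.enorm.measurable
  set V := ∫⁻ p in Metric.ball (0 : Pt n) (3 / 4), ‖mpd (vmi n (j + 1)) f p‖ₑ with hV
  have hV' : V = ∫⁻ x in B, ∫⁻ s in I, ‖mpd (vmi n (j + 1)) f (x, s)‖ₑ :=
    setLIntegral_ball_eq _ hvm
  have hI2 : volume I ≤ 2 := by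
    rw [hI, Real.volume_Ioo, ← ENNReal.ofReal_ofNat]
    exact ENNReal.ofReal_le_ofReal (by norm_num)
  have hmv : Measurable fun x : Fin n → ℝ => ∫⁻ s in I, ‖mpd (vmi n (j + 1)) f (x, s)‖ₑ :=
    hvm.lintegral_prod_right'
  calc ∫⁻ p in Metric.ball (0 : Pt n) (3 / 4), ‖g p‖ₑ
      = ∫⁻ x in B, ∫⁻ t in I, ‖g (x, t)‖ₑ :=
        setLIntegral_ball_eq _ hgs.continuous.enorm.measurable
    _ ≤ ∫⁻ x in B, 2 ^ (j + 1) * ((j * c : ℕ) *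
          (∫⁻ s in Ioc (0 : ℝ) 1, ordE j f (y + s • (x - y), τ)) + (ordE j f (x, τ) +
          ∫⁻ s in I, ‖mpd (vmi n (j + 1)) f (x, s)‖ₑ)) := by
        refine setLIntegral_mono' Metric.isOpen_ball.measurableSet fun x hx => ?_
        calc ∫⁻ t in I, ‖g (x, t)‖ₑ
            ≤ ∫⁻ _ in I, 2 ^ j * (∑ k ∈ Finset.range (j + 1), ‖mpd (vmi n k) g (x, τ)‖ₑ +
              ∫⁻ s in I, ‖mpd (vmi n (j + 1)) g (x, s)‖ₑ) :=
              setLIntegral_mono' measurableSet_Ioo fun t ht =>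
                enorm_vertical_iterate_le hgs x hτ ht j
          _ ≤ 2 ^ j * (∑ k ∈ Finset.range (j + 1), ‖mpd (vmi n k) g (x, τ)‖ₑ +
              ∫⁻ s in I, ‖mpd (vmi n (j + 1)) g (x, s)‖ₑ) * 2 := by
              rw [lintegral_const, Measure.restrict_apply_univ]
              gcongr
          _ ≤ 2 ^ j * (((j * c : ℕ) * (∫⁻ s in Ioc (0 : ℝ) 1, ordE j f (y + s • (x - y), τ)) +
              ordE j f (x, τ)) + ∫⁻ s in I, ‖mpd (vmi n (j + 1)) f (x, s)‖ₑ) * 2 := by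
              rw [hgv]
              gcongr
              exact hray x hx
          _ = _ := by rw [pow_succ]; ring
    _ = 2 ^ (j + 1) * ((j * c : ℕ) * (∫⁻ x in B, ∫⁻ s in Ioc (0 : ℝ) 1,
          ordE j f (y + s • (x - y), τ)) + (S + V)) := by
        rw [lintegral_const_mul' _ _ (by simp), lintegral_add_right _
          (show Measurable fun x : Fin n → ℝ => ordE j f (x, τ) +
            ∫⁻ s in I, ‖mpd (vmi n (j + 1)) f (x, s)‖ₑ from hh.measurable.add hmv),
          lintegral_const_mul' _ _ (ENNReal.natCast_ne_top _),
          lintegral_add_left hh.measurable, hV']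
    _ ≤ 2 ^ (j + 1) * ((j * c : ℕ) * (2 ^ n * S) + (S + V)) := by gcongr
    _ ≤ 2 ^ (j + 1) * ((j * c : ℕ) * (2 ^ n * (S + V)) + (S + V)) := by
        gcongr; exact le_self_add
    _ = _ := by push_cast; ring

lemma add_sq_le_two_mul (a b : ℝ≥0∞) : (a + b) ^ 2 ≤ 2 * (a ^ 2 + b ^ 2) := by
  have h := ENNReal.rpow_add_le_mul_rpow_add_rpow a b (p := 2) (by norm_num)
  norm_num at h
  exact_mod_cast h

set_option maxHeartbeats 1000000 in
/-- The main estimate at unit scale, for smooth approximate solutions. -/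
lemma unit_estimate (n m j : ℕ) (hj : j ≤ m) {lam Λ : ℝ} (hlam : 0 < lam) (hΛ : 0 ≤ Λ) :
    ∃ K : ℝ≥0∞, K ≠ ∞ ∧ ∀ A : Coef n, CoefMeasurable A → CoefBounded m A Λ → Garding m A lam →
      ∀ f : Pt n → ℂ, Smooth f → ∀ e : ℝ, 0 ≤ e →
      (∀ φ, IsTest (Metric.ball (0 : Pt n) (3 / 4)) φ → ∀ s > 0,
        ‖form m A φ f‖ ≤ s * energy m φ + e / s) →
      ∀ τ ∈ Ioo (-(1 / 2) : ℝ) (1 / 2),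
      ∑ γ ∈ MI n j, ∫⁻ p in Metric.ball (0 : Pt n) (1 / 2), ‖mpd γ f p‖ₑ ^ 2 ≤
        K * ((∫⁻ x in Metric.ball (0 : Fin n → ℝ) (3 / 4), ordE j f (x, τ)) ^ 2 +
          (∫⁻ p in Metric.ball (0 : Pt n) (3 / 4), ‖mpd (vmi n (j + 1)) f p‖ₑ) ^ 2 +
          ENNReal.ofReal e) := by
  obtain ⟨K, hK, hest⟩ := interior_estimate n m hlam hΛ
  obtain ⟨C, hC⟩ := poincare_slice n j
  refine ⟨ENNReal.ofReal K * (2 * C ^ 2 + 1), by finiteness,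
    fun A hAm hAb hAG f hf e he hφ τ hτ => ?_⟩
  obtain ⟨P, hP, hP0, hle⟩ := hC f hf τ ⟨by linarith [hτ.1], by linarith [hτ.2]⟩
  set g := f - P with hg
  have hgs : Smooth g := hf.fsub hP
  have hgγ : ∀ γ : Fin (n + 1) → ℕ, j ≤ ∑ i, γ i → mpd γ g = mpd γ f := fun γ hγ => by
    rw [hg, mpd_sub hf hP, hP0 γ hγ, sub_zero]
  have hform : ∀ φ, form m A φ g = form m A φ f := fun φ => by
    unfold form
    refine Finset.sum_congr rfl fun α _ => Finset.sum_congr rfl fun β hβ => ?_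
    rw [hgγ β (by rw [mem_MI.1 hβ]; exact hj)]
  have h1 := hest A hAm hAb hAG g hgs e (fun φ h s hs => by rw [hform]; exact hφ φ h s hs)
  have hsq : ∀ γ : Fin (n + 1) → ℕ, ∫⁻ p in Metric.ball (0 : Pt n) (1 / 2), ‖mpd γ g p‖ₑ ^ 2 =
      ENNReal.ofReal (∫ p in Metric.ball (0 : Pt n) (1 / 2), ‖mpd γ g p‖ ^ 2) := by
    intro γ
    have hc : Continuous fun p => ‖mpd γ g p‖ ^ 2 := (hgs.mpd γ).continuous.norm.pow 2
    rw [ofReal_integral_eq_lintegral_ofReal (integrableOn_ball_of_continuous hc _ _)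
      (ae_of_all _ fun p => by positivity)]
    refine lintegral_congr fun p => ?_
    rw [ENNReal.ofReal_pow (norm_nonneg _), ofReal_norm]
  have hL : ENNReal.ofReal (∫ p in Metric.ball (0 : Pt n) (3 / 4), ‖g p‖) =
      ∫⁻ p in Metric.ball (0 : Pt n) (3 / 4), ‖g p‖ₑ := by
    rw [ofReal_integral_eq_lintegral_ofReal (integrableOn_ball_of_continuous
      hgs.continuous.norm _ _) (ae_of_all _ fun p => by positivity)]
    simp_rw [ofReal_norm]
  have hnn : ∀ γ : Fin (n + 1) → ℕ, 0 ≤ ∫ p in Metric.ball (0 : Pt n) (1 / 2), ‖mpd γ g p‖ ^ 2 :=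
    fun γ => integral_nonneg fun p => by positivity
  have h2 : ∑ γ ∈ MI n j, ∫ p in Metric.ball (0 : Pt n) (1 / 2), ‖mpd γ g p‖ ^ 2 ≤
      jetInt (m + 1) g (1 / 2) := by
    rw [integral_jet_eq (m + 1) hgs]
    exact Finset.single_le_sum (f := fun i => ∑ γ ∈ MI n i,
      ∫ p in Metric.ball (0 : Pt n) (1 / 2), ‖mpd γ g p‖ ^ 2)
      (fun i _ => Finset.sum_nonneg fun γ _ => hnn γ) (Finset.mem_range.2 (by omega))
  set S := ∫⁻ x in Metric.ball (0 : Fin n → ℝ) (3 / 4), ordE j f (x, τ)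
  set V := ∫⁻ p in Metric.ball (0 : Pt n) (3 / 4), ‖mpd (vmi n (j + 1)) f p‖ₑ
  calc ∑ γ ∈ MI n j, ∫⁻ p in Metric.ball (0 : Pt n) (1 / 2), ‖mpd γ f p‖ₑ ^ 2
      = ENNReal.ofReal (∑ γ ∈ MI n j, ∫ p in Metric.ball (0 : Pt n) (1 / 2), ‖mpd γ g p‖ ^ 2) := by
        rw [ENNReal.ofReal_sum_of_nonneg fun γ _ => hnn γ]
        exact Finset.sum_congr rfl fun γ hγ => by rw [← hsq, hgγ γ (mem_MI.1 hγ).ge]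
    _ ≤ ENNReal.ofReal (K * ((∫ p in Metric.ball (0 : Pt n) (3 / 4), ‖g p‖) ^ 2 + e)) :=
        ENNReal.ofReal_le_ofReal (h2.trans h1)
    _ = ENNReal.ofReal K * ((∫⁻ p in Metric.ball (0 : Pt n) (3 / 4), ‖g p‖ₑ) ^ 2 +
          ENNReal.ofReal e) := by
        rw [ENNReal.ofReal_mul hK, ENNReal.ofReal_add (by positivity) he,
          ENNReal.ofReal_pow (integral_nonneg fun p => by positivity), hL]
    _ ≤ ENNReal.ofReal K * ((C * (S + V)) ^ 2 + ENNReal.ofReal e) := by gcongr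
    _ ≤ ENNReal.ofReal K * ((2 * C ^ 2 + 1) * (S ^ 2 + V ^ 2 + ENNReal.ofReal e)) := by
        gcongr
        have h3 := add_sq_le_two_mul S V
        calc (C * (S + V)) ^ 2 + ENNReal.ofReal e
            = C ^ 2 * (S + V) ^ 2 + ENNReal.ofReal e := by rw [mul_pow]
          _ ≤ C ^ 2 * (2 * (S ^ 2 + V ^ 2)) + ENNReal.ofReal e := by gcongr
          _ ≤ C ^ 2 * (2 * (S ^ 2 + V ^ 2)) + ENNReal.ofReal e +
              (2 * C ^ 2 * ENNReal.ofReal e + (S ^ 2 + V ^ 2)) := le_self_add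
          _ = _ := by ring
    _ = _ := by ring

/-! ### Rescaling -/

lemma integral_comp_affine (h : Pt n → ℂ) (a : Pt n) (c : ℝ) :
    ∫ p, h (a + c • p) = ((|(c ^ (n + 1))⁻¹| : ℝ) : ℂ) * ∫ p, h p := by
  have h1 := Measure.integral_comp_smul (volume : Measure (Pt n)) (fun p => h (a + p)) c
  rw [h1, integral_add_left_eq_self h a]
  simp

lemma integral_comp_affine_real (h : Pt n → ℝ) (a : Pt n) (c : ℝ) :
    ∫ p, h (a + c • p) = |(c ^ (n + 1))⁻¹| * ∫ p, h p := by
  have h1 := Measure.integral_comp_smul (volume : Measure (Pt n)) (fun p => h (a + p)) c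
  rw [h1, integral_add_left_eq_self h a]
  simp

lemma ae_comp_affine {q : Pt n → Prop} (hq : ∀ᵐ p, q p) (a : Pt n) {c : ℝ} (hc : c ≠ 0) :
    ∀ᵐ p, q (a + c • p) := by
  have hm : Measurable fun p : Pt n => c • p := by fun_prop
  have h1 : ∀ᵐ p ∂(Measure.map (c • ·) (volume : Measure (Pt n))), q (a + p) := by
    rw [Measure.map_addHaar_smul _ hc]
    refine Measure.ae_smul_measure ?_ _
    exact (measurePreserving_add_left (volume : Measure (Pt n)) a).quasiMeasurePreserving.ae hq
  exact ae_of_ae_map hm.aemeasurable h1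

lemma finrank_Pt (n : ℕ) : Module.finrank ℝ (Pt n) = n + 1 := by simp

/-- Rescaled coefficients. -/
def rescale (A : Coef n) (a : Pt n) (c : ℝ) : Coef n := fun α β p => A α β (a + c • p)

lemma CoefMeasurable.rescale {A : Coef n} (h : CoefMeasurable A) (a : Pt n) (c : ℝ) :
    CoefMeasurable (rescale A a c) := fun α β => (h α β).comp (by fun_prop)

lemma CoefBounded.rescale {m : ℕ} {A : Coef n} {Λ : ℝ} (h : CoefBounded m A Λ) (a : Pt n) {c : ℝ}
    (hc : c ≠ 0) : CoefBounded m (rescale A a c) Λ := fun α hα β hβ =>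
  ae_comp_affine (h α hα β hβ) a hc

lemma form_rescale (m : ℕ) (A : Coef n) {φ f : Pt n → ℂ} (hφ : Smooth φ) (hf : Smooth f)
    (a : Pt n) (c : ℝ) :
    form m (rescale A a c) (fun q => φ (a + c • q)) (fun q => f (a + c • q)) =
      ((c ^ (2 * m) * |(c ^ (n + 1))⁻¹| : ℝ) : ℂ) * form m A φ f := by
  unfold form
  rw [Finset.mul_sum]
  refine Finset.sum_congr rfl fun α hα => ?_
  rw [Finset.mul_sum]
  refine Finset.sum_congr rfl fun β hβ => ?_
  rw [mpd_comp_affine hφ, mpd_comp_affine hf, mem_MI.1 hα, mem_MI.1 hβ]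
  push_cast
  rw [mul_assoc, ← integral_comp_affine (fun p => (starRingEnd ℂ) (mpd α φ p) * A α β p *
    mpd β f p) a c, ← integral_const_mul]
  congr 1
  funext q
  simp only [Pi.smul_apply, smul_eq_mul, map_mul, map_pow, Complex.conj_ofReal, rescale]
  ring

lemma energy_rescale (m : ℕ) {φ : Pt n → ℂ} (hφ : Smooth φ) (a : Pt n) (c : ℝ) :
    energy m (fun q => φ (a + c • q)) = c ^ (2 * m) * |(c ^ (n + 1))⁻¹| * energy m φ := by
  unfold energy
  rw [Finset.mul_sum]
  refine Finset.sum_congr rfl fun α hα => ?_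
  rw [mpd_comp_affine hφ, mem_MI.1 hα, mul_assoc, ← integral_comp_affine_real
    (fun p => ‖mpd α φ p‖ ^ 2) a c, ← integral_const_mul]
  congr 1
  funext q
  simp only [Pi.smul_apply, smul_eq_mul, norm_mul, norm_pow, Complex.norm_real, Real.norm_eq_abs]
  rw [mul_pow, ← pow_mul, mul_comm m 2, pow_mul, sq_abs, ← pow_mul]

lemma affine_cancel {c : ℝ} (hc : c ≠ 0) (a p : Pt n) :
    -(c⁻¹ • a) + c⁻¹ • (a + c • p) = p := by
  rw [smul_add, smul_smul, inv_mul_cancel₀ hc, one_smul]; abel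

lemma affine_cancel' {c : ℝ} (hc : c ≠ 0) (a p : Pt n) :
    a + c • (-(c⁻¹ • a) + c⁻¹ • p) = p := by
  rw [smul_add, smul_neg, smul_smul, smul_smul, mul_inv_cancel₀ hc, one_smul, one_smul]; abel

/-- Every smooth compactly supported function is a rescaling of another one. -/
lemma exists_unscale {φ : Pt n → ℂ} {r ℓ : ℝ} (hφ : Smooth φ) (hc : HasCompactSupport φ)
    (hℓ : 0 < ℓ) (a : Pt n) : ∃ ψ : Pt n → ℂ, Smooth ψ ∧ HasCompactSupport ψ ∧
      (φ = fun q => ψ (a + ℓ • q)) ∧ (tsupport φ ⊆ Metric.ball 0 r →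
        tsupport ψ ⊆ Metric.ball a (ℓ * r)) := by
  have hne := hℓ.ne'
  set T : Pt n ≃ₜ Pt n :=
    { toFun := fun p => -(ℓ⁻¹ • a) + ℓ⁻¹ • p
      invFun := fun p => a + ℓ • p
      left_inv := affine_cancel' hne a
      right_inv := affine_cancel hne a
      continuous_toFun := by fun_prop
      continuous_invFun := by fun_prop } with hT
  refine ⟨φ ∘ T, smooth_comp_affine hφ _ _, hc.comp_homeomorph T, ?_, fun h => ?_⟩
  · funext q
    change φ q = φ (-(ℓ⁻¹ • a) + ℓ⁻¹ • (a + ℓ • q))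
    rw [affine_cancel hne]
  · rw [tsupport_comp_eq_preimage φ T]
    intro p hp
    have h1 := h hp
    rw [mem_ball_zero_iff] at h1
    rw [mem_ball_iff_norm]
    have h2 : p - a = ℓ • T p := sub_eq_of_eq_add' (affine_cancel' hne a p).symm
    rw [h2, norm_smul, Real.norm_of_nonneg hℓ.le]
    gcongr

lemma Garding.rescale {m : ℕ} {A : Coef n} {lam : ℝ} (h : Garding m A lam) (a : Pt n) {ℓ : ℝ}
    (hℓ : 0 < ℓ) : Garding m (rescale A a ℓ) lam := by
  intro φ hφ hc
  obtain ⟨ψ, hψ, hψc, rfl, -⟩ := exists_unscale (r := 0) hφ hc hℓ a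
  have h1 := h ψ hψ hψc
  have e1 := form_rescale m A hψ hψ a ℓ
  have e2 := energy_rescale m hψ a ℓ
  change lam * energy m _ ≤ (form m _ _ _).re
  change lam * energy m ψ ≤ (form m A ψ ψ).re at h1
  rw [e1, e2, Complex.re_ofReal_mul, mul_left_comm]
  gcongr

lemma lintegral_ball_rescale {E : Type*} [NormedAddCommGroup E] [NormedSpace ℝ E]
    [MeasurableSpace E] [BorelSpace E] [FiniteDimensional ℝ E] (μ : Measure E) [μ.IsAddHaarMeasure]
    (h : E → ℝ≥0∞) (a : E) {ℓ : ℝ} (hℓ : 0 < ℓ) (r : ℝ) :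
    ∫⁻ x in Metric.ball 0 r, h (a + ℓ • x) ∂μ =
      (ENNReal.ofReal ℓ ^ Module.finrank ℝ E)⁻¹ * ∫⁻ x in Metric.ball a (ℓ * r), h x ∂μ := by
  have h1 : ∀ x, (Metric.ball (0 : E) r).indicator (fun x => h (a + ℓ • x)) x =
      (Metric.ball a (ℓ * r)).indicator h (a + ℓ • x) := by
    intro x
    have : a + ℓ • x ∈ Metric.ball a (ℓ * r) ↔ x ∈ Metric.ball (0 : E) r := by
      rw [mem_ball_iff_norm, mem_ball_zero_iff, add_sub_cancel_left, norm_smul,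
        Real.norm_of_nonneg hℓ.le, mul_lt_mul_iff_right₀ hℓ]
    by_cases hx : x ∈ Metric.ball (0 : E) r
    · rw [Set.indicator_of_mem hx, Set.indicator_of_mem (this.2 hx)]
    · rw [Set.indicator_of_notMem hx, Set.indicator_of_notMem (fun h' => hx (this.1 h'))]
  rw [← lintegral_indicator Metric.isOpen_ball.measurableSet, lintegral_congr h1,
    lintegral_comp_affine μ _ a hℓ.ne', lintegral_indicator Metric.isOpen_ball.measurableSet,
    abs_of_pos (by positivity), ENNReal.ofReal_inv_of_pos (by positivity),
    ENNReal.ofReal_pow hℓ.le]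

lemma enorm_mpd_rescale {f : Pt n → ℂ} (hf : Smooth f) (a : Pt n) {ℓ : ℝ} (hℓ : 0 < ℓ)
    (γ : Fin (n + 1) → ℕ) (q : Pt n) : ‖mpd γ (fun q => f (a + ℓ • q)) q‖ₑ =
      ENNReal.ofReal ℓ ^ (∑ i, γ i) * ‖mpd γ f (a + ℓ • q)‖ₑ := by
  rw [mpd_comp_affine hf, Pi.smul_apply, smul_eq_mul, enorm_mul, enorm_pow]
  congr 2
  rw [← ofReal_norm, Complex.norm_real, Real.norm_of_nonneg hℓ.le]

lemma ordE_rescale {f : Pt n → ℂ} (hf : Smooth f) (a : Pt n) {ℓ : ℝ} (hℓ : 0 < ℓ)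
    (k : ℕ) (q : Pt n) : ordE k (fun q => f (a + ℓ • q)) q =
      ENNReal.ofReal ℓ ^ k * ordE k f (a + ℓ • q) := by
  unfold ordE
  rw [Finset.mul_sum]
  refine Finset.sum_congr rfl fun γ hγ => ?_
  rw [enorm_mpd_rescale hf a hℓ, mem_MI.1 hγ]

set_option maxHeartbeats 1000000 in
/-- The main estimate for smooth approximate solutions, at arbitrary scale. -/
lemma scaled_estimate (n m j : ℕ) (hj : j ≤ m) {lam Λ : ℝ} (hlam : 0 < lam) (hΛ : 0 ≤ Λ) :
    ∃ K : ℝ≥0∞, K ≠ ∞ ∧ ∀ A : Coef n, CoefMeasurable A → CoefBounded m A Λ → Garding m A lam →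
      ∀ (c : Fin n → ℝ) (s₀ ℓ : ℝ), 0 < ℓ → ∃ D : ℝ≥0∞, D ≠ ∞ ∧
      ∀ f : Pt n → ℂ, Smooth f → ∀ e : ℝ, 0 ≤ e →
      (∀ φ, IsTest (Metric.ball ((c, s₀) : Pt n) (ℓ * (3 / 4))) φ → ∀ s > 0,
        ‖form m A φ f‖ ≤ s * energy m φ + e / s) →
      ∀ τ ∈ Ioo (s₀ - ℓ / 2) (s₀ + ℓ / 2),
      (ENNReal.ofReal ℓ ^ (n + 1))⁻¹ *
        ∑ γ ∈ MI n j, ∫⁻ p in Metric.ball ((c, s₀) : Pt n) (ℓ * (1 / 2)), ‖mpd γ f p‖ₑ ^ 2 ≤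
        K * (((ENNReal.ofReal ℓ ^ n)⁻¹ *
            ∫⁻ x in Metric.ball c (ℓ * (3 / 4)), ordE j f (x, τ)) ^ 2 +
          (ENNReal.ofReal ℓ * ((ENNReal.ofReal ℓ ^ (n + 1))⁻¹ *
            ∫⁻ p in Metric.ball ((c, s₀) : Pt n) (ℓ * (3 / 4)),
              ‖mpd (vmi n (j + 1)) f p‖ₑ)) ^ 2 + D * ENNReal.ofReal e) := by
  obtain ⟨K, hK, hest⟩ := unit_estimate n m j hj hlam hΛ
  refine ⟨K, hK, fun A hAm hAb hAG c s₀ ℓ hℓ => ?_⟩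
  set L := ENNReal.ofReal ℓ with hL
  have hL0 : L ≠ 0 := by simpa [hL] using hℓ
  have hLt : L ≠ ∞ := ENNReal.ofReal_ne_top
  set Z : ℝ := ℓ ^ (2 * m) * |(ℓ ^ (n + 1))⁻¹| with hZ
  have hZ0 : 0 ≤ Z := by positivity
  refine ⟨(L ^ (2 * j))⁻¹ * ENNReal.ofReal Z, by
    refine ENNReal.mul_ne_top (ENNReal.inv_ne_top.2 (pow_ne_zero _ hL0)) ENNReal.ofReal_ne_top,
    fun f hf e he hφ τ hτ => ?_⟩
  set a : Pt n := (c, s₀) with ha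
  have hτ' : (τ - s₀) / ℓ ∈ Ioo (-(1 / 2) : ℝ) (1 / 2) := by
    constructor
    · rw [lt_div_iff₀ hℓ]; linarith [hτ.1]
    · rw [div_lt_iff₀ hℓ]; linarith [hτ.2]
  have h := hest (rescale A a ℓ) (hAm.rescale a ℓ) (hAb.rescale a hℓ.ne') (hAG.rescale a hℓ)
    (fun q => f (a + ℓ • q)) (smooth_comp_affine hf a ℓ) (Z * e) (by positivity) ?_ _ hτ'
  · simp only [enorm_mpd_rescale hf a hℓ, ordE_rescale hf a hℓ, vmi_sum] at h
    have eS : ∫⁻ x in Metric.ball (0 : Fin n → ℝ) (3 / 4),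
        L ^ j * ordE j f (a + ℓ • (x, (τ - s₀) / ℓ)) =
        L ^ j * ((L ^ n)⁻¹ * ∫⁻ x in Metric.ball c (ℓ * (3 / 4)), ordE j f (x, τ)) := by
      rw [lintegral_const_mul' _ _ (by finiteness)]
      congr 1
      have := lintegral_ball_rescale volume (fun x => ordE j f (x, τ)) c hℓ (3 / 4)
      rw [Module.finrank_fin_fun] at this
      rw [← this]
      congr 1
      funext x
      congr 1
      ext1
      · simp [ha]
      · simp only [ha, Prod.snd_add, Prod.smul_snd, smul_eq_mul]; field_simp; ring
    have eV : ∫⁻ p in Metric.ball (0 : Pt n) (3 / 4),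
        L ^ (j + 1) * ‖mpd (vmi n (j + 1)) f (a + ℓ • p)‖ₑ =
        L ^ (j + 1) * ((L ^ (n + 1))⁻¹ * ∫⁻ p in Metric.ball a (ℓ * (3 / 4)),
          ‖mpd (vmi n (j + 1)) f p‖ₑ) := by
      rw [lintegral_const_mul' _ _ (by finiteness), lintegral_ball_rescale volume
        (fun p => ‖mpd (vmi n (j + 1)) f p‖ₑ) a hℓ, finrank_Pt]
    have eX : ∑ γ ∈ MI n j, ∫⁻ p in Metric.ball (0 : Pt n) (1 / 2),
        (L ^ (∑ i, γ i) * ‖mpd γ f (a + ℓ • p)‖ₑ) ^ 2 =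
        L ^ (2 * j) * ((L ^ (n + 1))⁻¹ * ∑ γ ∈ MI n j,
          ∫⁻ p in Metric.ball a (ℓ * (1 / 2)), ‖mpd γ f p‖ₑ ^ 2) := by
      rw [Finset.mul_sum, Finset.mul_sum]
      refine Finset.sum_congr rfl fun γ hγ => ?_
      simp only [mul_pow]
      rw [mem_MI.1 hγ, lintegral_const_mul' _ _ (by finiteness), lintegral_ball_rescale volume
        (fun p => ‖mpd γ f p‖ₑ ^ 2) a hℓ, finrank_Pt, ← pow_mul, mul_comm j 2]
    rw [eS, eV, eX, ENNReal.ofReal_mul hZ0] at h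
    set X := (L ^ (n + 1))⁻¹ * ∑ γ ∈ MI n j,
          ∫⁻ p in Metric.ball a (ℓ * (1 / 2)), ‖mpd γ f p‖ₑ ^ 2
    set S := (L ^ n)⁻¹ * ∫⁻ x in Metric.ball c (ℓ * (3 / 4)), ordE j f (x, τ)
    set V := (L ^ (n + 1))⁻¹ * ∫⁻ p in Metric.ball a (ℓ * (3 / 4)),
          ‖mpd (vmi n (j + 1)) f p‖ₑ
    have hinv : (L ^ (2 * j))⁻¹ * L ^ (2 * j) = 1 :=
      ENNReal.inv_mul_cancel (pow_ne_zero _ hL0) (by finiteness)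
    calc X = (L ^ (2 * j))⁻¹ * (L ^ (2 * j) * X) := by rw [← mul_assoc, hinv, one_mul]
      _ ≤ (L ^ (2 * j))⁻¹ * _ := mul_le_mul_right h _
      _ = K * (((L ^ (2 * j))⁻¹ * L ^ (2 * j)) * (S ^ 2 + (L * V) ^ 2) +
          (L ^ (2 * j))⁻¹ * ENNReal.ofReal Z * ENNReal.ofReal e) := by ring
      _ = _ := by rw [hinv, one_mul]
  · rintro φ ⟨hφs, hφc, hφt⟩ s hs
    obtain ⟨ψ, hψ, hψc, rfl, hψt⟩ := exists_unscale (r := 3 / 4) hφs hφc hℓ a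
    have h1 := hφ ψ ⟨hψ, hψc, hψt hφt⟩ s hs
    rw [form_rescale m A hψ hf a ℓ, energy_rescale m hψ a ℓ, norm_mul, Complex.norm_real,
      Real.norm_of_nonneg hZ0]
    calc Z * ‖form m A ψ f‖ ≤ Z * (s * energy m ψ + e / s) := by gcongr
      _ = _ := by rw [hZ]; ring

/-! ### Approximation of weak solutions by smooth functions -/

lemma eLpNorm_two_sq {α : Type*} [MeasurableSpace α] (μ : Measure α) (g : α → ℂ) :
    eLpNorm g 2 μ ^ 2 = ∫⁻ p, ‖g p‖ₑ ^ 2 ∂μ := by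
  rw [eLpNorm_eq_lintegral_rpow_enorm_toReal (by norm_num) (by norm_num)]
  simp only [ENNReal.toReal_ofNat, one_div]
  rw [← ENNReal.rpow_natCast, ← ENNReal.rpow_mul]
  norm_num

/-- Continuity of translations in `L²`. -/
lemma exists_translate_le {g : Pt n → ℂ} (hg : MemLp g 2 volume) {δ : ℝ≥0∞} (hδ : δ ≠ 0) :
    ∃ r > 0, ∀ y : Pt n, ‖y‖ < r → ∫⁻ p, ‖g (y + p) - g p‖ₑ ^ 2 ≤ δ := by
  set G : Lp ℂ 2 (volume : Measure (Pt n)) := hg.toLp g with hG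
  set T : C(Pt n, C(Pt n, Pt n)) :=
    (ContinuousMap.mk (fun a : Pt n × Pt n => a.1 + a.2) continuous_add).curry with hT
  have hmp : ∀ y, MeasurePreserving (T y) (volume : Measure (Pt n)) volume := fun y =>
    measurePreserving_add_left volume y
  have hcont : Continuous fun y : Pt n => Lp.compMeasurePreserving (T y) (hmp y) G :=
    continuous_const.compMeasurePreservingLp T.continuous hmp (by norm_num)
  have hmem : ∀ y, MemLp (fun p => g (y + p)) 2 (volume : Measure (Pt n)) := fun y =>
    hg.comp_measurePreserving (hmp y)
  have hval : ∀ y, Lp.compMeasurePreserving (T y) (hmp y) G =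
      (hmem y).toLp (fun p => g (y + p)) := fun y =>
    Lp.toLp_compMeasurePreserving hg (hmp y)
  have h0 : Lp.compMeasurePreserving (T 0) (hmp 0) G = G := by
    rw [hval, hG]
    congr 1
    funext p
    rw [zero_add]
  have hδ2 : 0 < (min δ 1) ^ (1 / 2 : ℝ) :=
    ENNReal.rpow_pos (lt_min (pos_iff_ne_zero.2 hδ) one_pos) (by simp)
  have hnhds := EMetric.tendsto_nhds.1 (hcont.tendsto 0) _ hδ2
  obtain ⟨r, hr, hball⟩ := Metric.eventually_nhds_iff.1 hnhds
  refine ⟨r, hr, fun y hy => ?_⟩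
  have h1 := hball (y := y) (by simpa using hy)
  rw [h0, hval, hG, Lp.edist_toLp_toLp] at h1
  have h2 := eLpNorm_two_sq volume ((fun p => g (y + p)) - g)
  simp only [Pi.sub_apply] at h2
  rw [← h2]
  calc _ ≤ ((min δ 1) ^ (1 / 2 : ℝ)) ^ 2 := by gcongr
    _ = min δ 1 := by rw [← ENNReal.rpow_natCast, ← ENNReal.rpow_mul]; norm_num
    _ ≤ δ := min_le_left _ _

lemma exists_small_mollifier (n : ℕ) {ε : ℝ} (hε : 0 < ε) : ∃ ρ : Pt n → ℝ,
    ContDiff ℝ (⊤ : ℕ∞) ρ ∧ (∀ p, 0 ≤ ρ p) ∧ tsupport ρ ⊆ Metric.closedBall 0 ε ∧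
    Function.support ρ ⊆ Metric.ball 0 ε ∧ HasCompactSupport ρ ∧ ∫ p, ρ p = 1 := by
  let b : ContDiffBump (0 : Pt n) := ⟨ε / 2, ε, by positivity, by linarith⟩
  exact ⟨b.normed volume, b.contDiff_normed, b.nonneg_normed, b.tsupport_normed_eq.subset,
    b.support_normed_eq.subset, b.hasCompactSupport_normed, b.integral_normed⟩

lemma lintegral_weight_sq_le {ρ : Pt n → ℝ} (hρ : Measurable ρ) (hρ0 : ∀ p, 0 ≤ ρ p)
    (hρ1 : ∫ p, ρ p = 1) (hρi : Integrable ρ) {h : Pt n → ℝ≥0∞} (hh : Measurable h) :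
    (∫⁻ p, ENNReal.ofReal (ρ p) * h p) ^ 2 ≤ ∫⁻ p, ENNReal.ofReal (ρ p) * h p ^ 2 := by
  set ν := (volume : Measure (Pt n)).withDensity fun p => ENNReal.ofReal (ρ p)
  have : IsProbabilityMeasure ν := ⟨by
    rw [withDensity_apply _ MeasurableSet.univ, Measure.restrict_univ,
      ← ofReal_integral_eq_lintegral_ofReal hρi (ae_of_all _ hρ0), hρ1, ENNReal.ofReal_one]⟩
  have h1 := lintegral_sq_le_of_isProbabilityMeasure (μ := ν) hh.aemeasurable
  rw [lintegral_withDensity_eq_lintegral_mul _ hρ.ennreal_ofReal hh,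
    lintegral_withDensity_eq_lintegral_mul _ hρ.ennreal_ofReal (hh.pow_const 2)] at h1
  exact h1

/-- Mollification error in `L²`. -/
lemma lintegral_conv_sub_le {g : Pt n → ℂ} (hgm : Measurable g) (hgi : Integrable g)
    {δ : ℝ≥0∞} {r : ℝ} (hr : ∀ y : Pt n, ‖y‖ < r → ∫⁻ p, ‖g (y + p) - g p‖ₑ ^ 2 ≤ δ)
    {ρ : Pt n → ℝ} (hρ : ContDiff ℝ (⊤ : ℕ∞) ρ) (hρ0 : ∀ p, 0 ≤ ρ p)
    (hρs : Function.support ρ ⊆ Metric.ball 0 r) (hρc : HasCompactSupport ρ)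
    (hρ1 : ∫ p, ρ p = 1) :
    ∫⁻ p, ‖conv g (fun q => (ρ q : ℂ)) p - g p‖ₑ ^ 2 ≤ δ := by
  have hρi : Integrable ρ := hρ.continuous.integrable_of_hasCompactSupport hρc
  have hρm : Measurable ρ := hρ.continuous.measurable
  have hpt : ∀ p, ‖conv g (fun q => (ρ q : ℂ)) p - g p‖ₑ ^ 2 ≤
      ∫⁻ y, ENNReal.ofReal (ρ y) * ‖g (p - y) - g p‖ₑ ^ 2 := by
    intro p
    have hi1 : Integrable fun y => g (p - y) * (ρ y : ℂ) := by
      obtain ⟨M, hM⟩ := hρ.continuous.bounded_above_of_compact_support hρc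
      refine (hgi.comp_sub_left p).mul_bdd (c := M)
        (Complex.continuous_ofReal.comp hρ.continuous).aestronglyMeasurable
        (ae_of_all _ fun y => ?_)
      rw [Complex.norm_real]; exact hM y
    have hi2 : Integrable fun y => g p * (ρ y : ℂ) := hρi.ofReal.const_mul _
    have e1 : conv g (fun q => (ρ q : ℂ)) p - g p = ∫ y, (g (p - y) - g p) * (ρ y : ℂ) := by
      have e2 : conv g (fun q => (ρ q : ℂ)) p = ∫ y, g (p - y) * (ρ y : ℂ) := by
        unfold conv
        rw [← integral_sub_left_eq_self _ volume p]
        simp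
      have e3 : ∫ y, (ρ y : ℂ) = 1 := by rw [integral_complex_ofReal, hρ1, Complex.ofReal_one]
      simp only [sub_mul]
      rw [integral_sub hi1 hi2, integral_const_mul, e3, mul_one, e2]
    have hm : Measurable fun y => ‖g (p - y) - g p‖ₑ :=
      ((hgm.comp (measurable_const.sub measurable_id)).sub_const _).enorm
    refine le_trans ?_ (lintegral_weight_sq_le hρm hρ0 hρ1 hρi hm)
    gcongr
    rw [e1]
    refine (enorm_integral_le_lintegral_enorm _).trans (le_of_eq ?_)
    refine lintegral_congr fun y => ?_
    rw [enorm_mul, mul_comm, ← ofReal_norm (ρ y : ℂ), Complex.norm_real,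
      Real.norm_of_nonneg (hρ0 y)]
  have hm2 : Measurable fun z : Pt n × Pt n =>
      ENNReal.ofReal (ρ z.2) * ‖g (z.1 - z.2) - g z.1‖ₑ ^ 2 := by
    refine (hρm.comp measurable_snd).ennreal_ofReal.mul (Measurable.pow_const ?_ 2)
    exact ((hgm.comp (measurable_fst.sub measurable_snd)).sub (hgm.comp measurable_fst)).enorm
  calc ∫⁻ p, ‖conv g (fun q => (ρ q : ℂ)) p - g p‖ₑ ^ 2
      ≤ ∫⁻ p, ∫⁻ y, ENNReal.ofReal (ρ y) * ‖g (p - y) - g p‖ₑ ^ 2 := lintegral_mono hpt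
    _ = ∫⁻ y, ∫⁻ p, ENNReal.ofReal (ρ y) * ‖g (p - y) - g p‖ₑ ^ 2 :=
        lintegral_lintegral_swap hm2.aemeasurable
    _ ≤ ∫⁻ y, ENNReal.ofReal (ρ y) * δ := by
        refine lintegral_mono fun y => ?_
        dsimp only
        rw [lintegral_const_mul' _ _ ENNReal.ofReal_ne_top]
        by_cases hy : ρ y = 0
        · simp [hy]
        · gcongr
          have h1 := hr (-y) (by simpa using hρs hy)
          simpa [neg_add_eq_sub] using h1
    _ = δ := by
        rw [lintegral_mul_const _ hρm.ennreal_ofReal,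
          ← ofReal_integral_eq_lintegral_ofReal hρi (ae_of_all _ hρ0), hρ1, ENNReal.ofReal_one,
          one_mul]

/-- Derivatives of mollifications are mollifications of weak derivatives. -/
lemma mpd_conv_weak {Ω : Set (Pt n)} (hΩ : MeasurableSet Ω) {γ : Fin (n + 1) → ℕ}
    {u v : Pt n → ℂ} (hw : IsWeakDeriv Ω γ u v) (hu : Integrable (Ω.indicator u))
    {r : Pt n → ℂ} (hr : Smooth r) (hrc : HasCompactSupport r) {ε : ℝ}
    (hrs : tsupport r ⊆ Metric.closedBall 0 ε) {p : Pt n} (hp : Metric.closedBall p ε ⊆ Ω) :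
    mpd γ (conv (Ω.indicator u) r) p = conv (Ω.indicator v) r p := by
  rw [mpd_conv hu.locallyIntegrable hr hrc]
  have hφe : (fun q => r (p - q)) = fun q => r (p + (-1 : ℝ) • q) := by
    funext q; rw [neg_one_smul, sub_eq_add_neg]
  have htest : IsTest Ω (fun q => r (p - q)) := by
    refine ⟨?_, ?_, ?_⟩
    · rw [hφe]; exact smooth_comp_affine hr p (-1)
    · exact hrc.comp_homeomorph (Homeomorph.subLeft p)
    · have := tsupport_comp_eq_preimage r (Homeomorph.subLeft p)
      intro q hq
      have hq' : q ∈ (Homeomorph.subLeft p) ⁻¹' tsupport r := by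
        rw [← this]; exact hq
      refine hp ?_
      have h2 := hrs hq'
      rw [mem_closedBall_zero_iff] at h2
      rw [mem_closedBall_iff_norm, norm_sub_rev]
      exact h2
  have h := hw _ htest
  have e : mpd γ (fun q => r (p - q)) = fun q => (-1 : ℂ) ^ (∑ i, γ i) * mpd γ r (p - q) := by
    rw [hφe, mpd_comp_affine hr]
    funext q
    simp [sub_eq_add_neg]
  rw [e] at h
  have e2 : ∀ (w s : Pt n → ℂ), conv (Ω.indicator w) s p = ∫ q in Ω, w q * s (p - q) := by
    intro w s
    rw [← integral_indicator hΩ]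
    unfold conv
    congr 1
    funext q
    by_cases hq : q ∈ Ω <;> simp [hq]
  rw [e2, e2]
  have hne : ((-1 : ℂ) ^ (∑ i, γ i)) ≠ 0 := pow_ne_zero _ (by norm_num)
  refine mul_left_cancel₀ hne ?_
  rw [← h, ← integral_const_mul]
  congr 1
  funext q
  ring

/-- A function in `L²` of a ball, extended by zero, is in `L²` and integrable. -/
lemma indicator_ball_memLp {g : Pt n → ℂ} (hg : Measurable g) {p₀ : Pt n} {ℓ : ℝ}
    (hfin : ∫⁻ p in Metric.ball p₀ ℓ, ‖g p‖ₑ ^ 2 < ⊤) :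
    MemLp ((Metric.ball p₀ ℓ).indicator g) 2 volume ∧
      Integrable ((Metric.ball p₀ ℓ).indicator g) := by
  have h2 : MemLp g 2 (volume.restrict (Metric.ball p₀ ℓ)) := by
    refine ⟨hg.aestronglyMeasurable, ?_⟩
    rw [← eLpNorm_two_sq] at hfin
    exact (ENNReal.pow_lt_top_iff.1 hfin).resolve_right two_ne_zero
  have : IsFiniteMeasure (volume.restrict (Metric.ball p₀ ℓ)) :=
    ⟨by rw [Measure.restrict_apply_univ]; exact measure_ball_lt_top⟩
  refine ⟨(memLp_indicator_iff_restrict measurableSet_ball).2 h2, ?_⟩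
  rw [integrable_indicator_iff measurableSet_ball]
  exact h2.integrable (by norm_num)

/-- Smooth approximation of a function together with finitely many of its weak derivatives. -/
lemma exists_smooth_approx {p₀ : Pt n} {ℓ : ℝ} (hℓ : 0 < ℓ) (S : Finset (Fin (n + 1) → ℕ))
    {u : Pt n → ℂ} {du : (Fin (n + 1) → ℕ) → Pt n → ℂ}
    (hu : Integrable ((Metric.ball p₀ ℓ).indicator u))
    (hm : ∀ γ ∈ S, Measurable (du γ))
    (hw : ∀ γ ∈ S, IsWeakDeriv (Metric.ball p₀ ℓ) γ u (du γ))
    (hfin : ∀ γ ∈ S, ∫⁻ p in Metric.ball p₀ ℓ, ‖du γ p‖ₑ ^ 2 < ⊤) {δ : ℝ≥0∞} (hδ : δ ≠ 0) :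
    ∃ f : Pt n → ℂ, Smooth f ∧ ∀ γ ∈ S,
      ∫⁻ p in Metric.ball p₀ (ℓ * (3 / 4)), ‖mpd γ f p - du γ p‖ₑ ^ 2 ≤ δ := by
  have hr : ∃ r > 0, r ≤ ℓ / 4 ∧ ∀ γ ∈ S, ∀ y : Pt n, ‖y‖ < r →
      ∫⁻ p, ‖(Metric.ball p₀ ℓ).indicator (du γ) (y + p) -
        (Metric.ball p₀ ℓ).indicator (du γ) p‖ₑ ^ 2 ≤ δ := by
    clear hu hw
    induction S using Finset.induction_on with
    | empty => exact ⟨ℓ / 4, by positivity, le_rfl, by simp⟩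
    | insert γ S hγ ih =>
      obtain ⟨r, hr, hr4, hrS⟩ := ih (fun γ h => hm γ (Finset.mem_insert_of_mem h))
        (fun γ h => hfin γ (Finset.mem_insert_of_mem h))
      have hγS := Finset.mem_insert_self γ S
      obtain ⟨r', hr', h'⟩ := exists_translate_le
        (indicator_ball_memLp (hm γ hγS) (hfin γ hγS)).1 hδ
      refine ⟨min r r', lt_min hr hr', (min_le_left _ _).trans hr4, fun γ' hγ' y hy => ?_⟩
      rcases Finset.mem_insert.1 hγ' with rfl | h
      · exact h' y (hy.trans_le (min_le_right _ _))
      · exact hrS γ' h y (hy.trans_le (min_le_left _ _))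
  obtain ⟨r, hr0, hr4, hrS⟩ := hr
  obtain ⟨ρ, hρ, hρ0, hρt, hρs, hρc, hρ1⟩ := exists_small_mollifier n hr0
  have hρC : Smooth fun q => (ρ q : ℂ) := Complex.ofRealCLM.contDiff.comp hρ
  have hsupp : Function.support (fun q => (ρ q : ℂ)) = Function.support ρ := by
    ext q; simp
  have hρCc : HasCompactSupport fun q => (ρ q : ℂ) := by
    unfold HasCompactSupport tsupport; rw [hsupp]; exact hρc
  have hρCt : tsupport (fun q => (ρ q : ℂ)) ⊆ Metric.closedBall 0 r := by
    unfold tsupport; rw [hsupp]; exact hρt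
  refine ⟨conv ((Metric.ball p₀ ℓ).indicator u) fun q => (ρ q : ℂ),
    smooth_conv hu.locallyIntegrable hρC hρCc, fun γ hγ => ?_⟩
  have hmeas := (hm γ hγ).indicator (s := Metric.ball p₀ ℓ) measurableSet_ball
  refine le_trans ?_ (lintegral_conv_sub_le hmeas (indicator_ball_memLp (hm γ hγ) (hfin γ hγ)).2
    (hrS γ hγ) hρ hρ0 hρs hρc hρ1)
  refine le_trans (le_of_eq ?_) (setLIntegral_le_lintegral (Metric.ball p₀ (ℓ * (3 / 4))) _)
  refine setLIntegral_congr_fun measurableSet_ball fun p hp => ?_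
  have hp' : dist p p₀ < ℓ * (3 / 4) := hp
  have hmem : p ∈ Metric.ball p₀ ℓ := Metric.ball_subset_ball (by linarith) hp
  rw [mpd_conv_weak measurableSet_ball (hw γ hγ) hu hρC hρCc hρCt
    (Metric.closedBall_subset_ball' (by linarith)), indicator_of_mem hmem (du γ)]

lemma norm_form_term_sub_le {a g h w : Pt n → ℂ} (ha : Measurable a) {Λ : ℝ}
    (hb : ∀ᵐ p, ‖a p‖ ≤ Λ) (hg : Continuous g) (hgc : HasCompactSupport g) {U Ω : Set (Pt n)}
    (hΩ : MeasurableSet Ω) (hUΩ : U ⊆ Ω) (hgU : ∀ p, p ∉ U → g p = 0)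
    (hh : Continuous h) (hw : Measurable w) {δ : ℝ} (hδ : 0 ≤ δ)
    (hd : ∫⁻ p in U, ‖h p - w p‖ₑ ^ 2 ≤ ENNReal.ofReal δ) {θ : ℝ} (hθ : 0 < θ) :
    ‖(∫ p, (starRingEnd ℂ) (g p) * a p * h p) - ∫ p in Ω, (starRingEnd ℂ) (g p) * a p * w p‖ ≤
      θ * (∫ p, ‖g p‖ ^ 2) + θ⁻¹ * (Λ ^ 2 * δ) := by
  have hmem : MemLp (fun p => h p - w p) 2 (volume.restrict U) := by
    refine ⟨(hh.measurable.sub hw).aestronglyMeasurable, ?_⟩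
    rw [← eLpNorm_two_sq (volume.restrict U) (fun p => h p - w p)] at hd
    exact (ENNReal.pow_lt_top_iff.1 (hd.trans_lt ENNReal.ofReal_lt_top)).resolve_right two_ne_zero
  have hi2 : Integrable (fun p => ‖h p - w p‖ ^ 2) (volume.restrict U) :=
    hmem.integrable_norm_pow (by norm_num)
  have hle : ∫ p in U, ‖h p - w p‖ ^ 2 ≤ δ := by
    rw [← ENNReal.ofReal_le_ofReal_iff hδ, ofReal_integral_eq_lintegral_ofReal hi2
      (Filter.Eventually.of_forall fun p => by positivity)]
    refine le_trans (le_of_eq (lintegral_congr fun p => ?_)) hd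
    rw [← ofReal_norm, ENNReal.ofReal_pow (norm_nonneg _)]
  have hgi := integrable_sq_of_compact hg hgc
  have hdom : Integrable (fun p => θ * ‖g p‖ ^ 2 + θ⁻¹ * (Λ ^ 2 * ‖h p - w p‖ ^ 2))
      (volume.restrict U) :=
    (hgi.integrableOn.const_mul θ).add ((hi2.const_mul _).const_mul _)
  have hbound : ∀ᵐ p ∂(volume.restrict U), ‖(starRingEnd ℂ) (g p) * a p * (h p - w p)‖ ≤
      θ * ‖g p‖ ^ 2 + θ⁻¹ * (Λ ^ 2 * ‖h p - w p‖ ^ 2) := by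
    filter_upwards [ae_restrict_of_ae hb] with p hp
    rw [norm_mul, norm_mul, RCLike.norm_conj]
    calc ‖g p‖ * ‖a p‖ * ‖h p - w p‖ ≤ ‖g p‖ * Λ * ‖h p - w p‖ := by gcongr
      _ = ‖g p‖ * (Λ * ‖h p - w p‖) := by ring
      _ ≤ _ := mul_le_young hθ
      _ = _ := by ring
  have hid : Integrable (fun p => (starRingEnd ℂ) (g p) * a p * (h p - w p))
      (volume.restrict U) := by
    refine hdom.mono' ?_ hbound
    exact (((Complex.continuous_conj.comp hg).measurable.mul ha).mul
      (hh.measurable.sub hw)).aestronglyMeasurable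
  have hih := (integrable_form_term ha hb hg hgc hh).integrableOn (s := U)
  have e1 : (∫ p, (starRingEnd ℂ) (g p) * a p * h p) =
      ∫ p in U, (starRingEnd ℂ) (g p) * a p * h p :=
    (setIntegral_eq_integral_of_forall_compl_eq_zero fun p hp => by simp [hgU p hp]).symm
  have e2 : (∫ p in Ω, (starRingEnd ℂ) (g p) * a p * w p) =
      ∫ p in U, (starRingEnd ℂ) (g p) * a p * w p :=
    setIntegral_eq_of_subset_of_forall_sdiff_eq_zero hΩ hUΩ fun p hp => by simp [hgU p hp.2]
  have hiw : Integrable (fun p => (starRingEnd ℂ) (g p) * a p * w p) (volume.restrict U) := by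
    refine (hih.sub hid).congr (Filter.Eventually.of_forall fun p => ?_)
    simp only [Pi.sub_apply]; ring
  rw [e1, e2, ← integral_sub hih hiw]
  simp_rw [← mul_sub]
  refine (norm_integral_le_of_norm_le hdom hbound).trans ?_
  rw [integral_add (hgi.integrableOn.const_mul θ) ((hi2.const_mul _).const_mul _),
    integral_const_mul, integral_const_mul, integral_const_mul]
  gcongr
  · exact Filter.Eventually.of_forall fun p => by positivity
  · exact Measure.restrict_le_self

/-- An approximation of a weak solution is an approximate weak solution. -/
lemma norm_form_approx_le (m : ℕ) {A : Coef n} (hA : CoefMeasurable A) {Λ : ℝ}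
    (hb : CoefBounded m A Λ) {U Ω : Set (Pt n)} (hΩ : MeasurableSet Ω)
    (hUΩ : U ⊆ Ω) {du : (Fin (n + 1) → ℕ) → Pt n → ℂ} (hsol : WeakSolution m A Ω du)
    (hm : ∀ γ ∈ MI n m, Measurable (du γ)) {f : Pt n → ℂ} (hf : Smooth f) {δ : ℝ} (hδ : 0 ≤ δ)
    (hd : ∀ γ ∈ MI n m, ∫⁻ p in U, ‖mpd γ f p - du γ p‖ₑ ^ 2 ≤ ENNReal.ofReal δ)
    {φ : Pt n → ℂ} (hφ : IsTest U φ) {s : ℝ} (hs : 0 < s) :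
    ‖form m A φ f‖ ≤ s * energy m φ +
      (((MI n m).card : ℝ) + 1) ^ 3 * Λ ^ 2 * δ / s := by
  set N : ℝ := ((MI n m).card : ℝ) with hNdef
  have hN : 0 ≤ N := Nat.cast_nonneg _
  have hφs : Smooth φ := hφ.1
  have h0 := hsol φ ⟨hφ.1, hφ.2.1, hφ.2.2.trans hUΩ⟩
  have hθ : 0 < s / (N + 1) := by positivity
  have hE := energy_nonneg m φ
  calc ‖form m A φ f‖ = ‖∑ α ∈ MI n m, ∑ β ∈ MI n m,
        ((∫ p, (starRingEnd ℂ) (mpd α φ p) * A α β p * mpd β f p) -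
          ∫ p in Ω, (starRingEnd ℂ) (mpd α φ p) * A α β p * du β p)‖ := by
        simp_rw [Finset.sum_sub_distrib]
        rw [h0, sub_zero]; rfl
    _ ≤ ∑ α ∈ MI n m, ∑ β ∈ MI n m, (s / (N + 1) * (∫ p, ‖mpd α φ p‖ ^ 2) +
          (s / (N + 1))⁻¹ * (Λ ^ 2 * δ)) := by
        refine (norm_sum_le _ _).trans (Finset.sum_le_sum fun α hα => ?_)
        refine (norm_sum_le _ _).trans (Finset.sum_le_sum fun β hβ => ?_)
        exact norm_form_term_sub_le (hA α β) (hb α hα β hβ) (hφs.mpd α).continuous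
          (hasCompactSupport_mpd hφ.1 hφ.2.1 α) hΩ hUΩ
          (fun p hp => mpd_eq_zero_of_notMem hφ.1 hφ.2.2 α hp) (hf.mpd β).continuous (hm β hβ)
          hδ (hd β hβ) hθ
    _ = N * (s / (N + 1)) * energy m φ + N * N * (N + 1) * Λ ^ 2 * δ / s := by
        simp only [Finset.sum_const, nsmul_eq_mul, ← hNdef]
        rw [← Finset.mul_sum, Finset.sum_add_distrib, ← Finset.mul_sum, Finset.sum_const,
          nsmul_eq_mul, ← hNdef]
        change N * (s / (N + 1) * energy m φ + N * _) = _
        field_simp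
    _ ≤ _ := by
        have h1 : N * (s / (N + 1)) ≤ s := by
          rw [← mul_div_assoc, div_le_iff₀ (by positivity)]; nlinarith
        have h2 : N * N * (N + 1) ≤ (N + 1) ^ 3 := by nlinarith [mul_nonneg hN hN]
        gcongr

lemma le_add_inv_mul_sq (h : ℝ≥0∞) {ε : ℝ≥0∞} (h0 : ε ≠ 0) (ht : ε ≠ ⊤) :
    h ≤ ε + ε⁻¹ * h ^ 2 := by
  rcases le_total h ε with hle | hle
  · exact hle.trans le_self_add
  · have h1 : 1 ≤ ε⁻¹ * h := by
      rw [← ENNReal.inv_mul_cancel h0 ht]; gcongr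
    calc h = 1 * h := (one_mul h).symm
      _ ≤ ε⁻¹ * h * h := by gcongr
      _ = ε⁻¹ * h ^ 2 := by ring
      _ ≤ _ := le_add_self

lemma setLIntegral_le_of_sq_le {α : Type*} [MeasurableSpace α] {μ : Measure α}
    {h : α → ℝ≥0∞} {ε : ℝ≥0∞} (h0 : ε ≠ 0) (ht : ε ≠ ⊤) {U : Set α}
    (hd : ∫⁻ p in U, h p ^ 2 ∂μ ≤ ε ^ 2) : ∫⁻ p in U, h p ∂μ ≤ ε * (μ U + 1) := by
  calc ∫⁻ p in U, h p ∂μ ≤ ∫⁻ p in U, (ε + ε⁻¹ * h p ^ 2) ∂μ :=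
        lintegral_mono fun p => le_add_inv_mul_sq _ h0 ht
    _ = ε * μ U + ε⁻¹ * ∫⁻ p in U, h p ^ 2 ∂μ := by
        rw [lintegral_add_left measurable_const, setLIntegral_const,
          lintegral_const_mul' _ _ (ENNReal.inv_ne_top.2 h0)]
    _ ≤ ε * μ U + ε⁻¹ * ε ^ 2 := by gcongr
    _ = ε * (μ U + 1) := by
        rw [sq, ← mul_assoc, ENNReal.inv_mul_cancel h0 ht]; ring

lemma enorm_le_enorm_add_enorm_sub (a b : ℂ) : ‖a‖ₑ ≤ ‖b‖ₑ + ‖a - b‖ₑ := by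
  calc ‖a‖ₑ = ‖b + (a - b)‖ₑ := by rw [add_sub_cancel]
    _ ≤ _ := enorm_add_le _ _

lemma enorm_sq_le_of_sub (a b : ℂ) : ‖b‖ₑ ^ 2 ≤ 2 * ‖a‖ₑ ^ 2 + 2 * ‖a - b‖ₑ ^ 2 := by
  calc ‖b‖ₑ ^ 2 ≤ (‖a‖ₑ + ‖b - a‖ₑ) ^ 2 := by gcongr; exact enorm_le_enorm_add_enorm_sub _ _
    _ ≤ _ := add_sq_le_two_mul _ _
    _ = _ := by rw [enorm_sub_rev, mul_add]

/-- Slices of a sequence converging fast in `L¹` of a product converge for almost every slice. -/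
lemma ae_tendsto_slice {X : Type*} [MeasurableSpace X] {μ : Measure X} [SFinite μ]
    {ν : Measure ℝ} [SFinite ν] {F : ℕ → X × ℝ → ℝ≥0∞} (hF : ∀ k, Measurable (F k))
    {M : ℝ≥0∞} (hM : M ≠ ⊤)
    (h : ∀ k, ∫⁻ p, F k p ∂(μ.prod ν) ≤ (2⁻¹ : ℝ≥0∞) ^ k * M) :
    ∀ᵐ τ ∂ν, Filter.Tendsto (fun k => ∫⁻ x, F k (x, τ) ∂μ) Filter.atTop (nhds 0) := by
  have hmeas : ∀ k, Measurable fun τ => ∫⁻ x, F k (x, τ) ∂μ := fun k =>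
    (hF k).lintegral_prod_left'
  have hsum : ∫⁻ τ, (∑' k, ∫⁻ x, F k (x, τ) ∂μ) ∂ν ≠ ⊤ := by
    rw [lintegral_tsum fun k => (hmeas k).aemeasurable]
    refine ne_top_of_le_ne_top (b := ∑' k : ℕ, (2⁻¹ : ℝ≥0∞) ^ k * M) ?_
      (ENNReal.tsum_le_tsum fun k => ?_)
    · rw [ENNReal.tsum_mul_right, ENNReal.tsum_geometric]
      refine ENNReal.mul_ne_top ?_ hM
      rw [ENNReal.one_sub_inv_two, inv_inv]; finiteness
    · rw [← lintegral_prod_symm' _ (hF k)]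
      exact h k
  filter_upwards [ae_lt_top (Measurable.tsum hmeas) hsum] with τ hτ
  exact ENNReal.tendsto_atTop_zero_of_tsum_ne_top hτ.ne

lemma prod_Ioo_subset_ball (c : Fin n → ℝ) (s₀ : ℝ) {ℓ : ℝ} (hℓ : 0 < ℓ) :
    Metric.ball c (ℓ * (3 / 4)) ×ˢ Ioo (s₀ - ℓ / 2) (s₀ + ℓ / 2) ⊆
      Metric.ball ((c, s₀) : Pt n) (ℓ * (3 / 4)) := by
  rw [← ball_prod_same, Real.ball_eq_Ioo]
  exact Set.prod_mono le_rfl (Ioo_subset_Ioo (by linarith) (by linarith))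

set_option maxHeartbeats 1000000 in
/-- The interior estimate for weak solutions, on balls of the sup norm. -/
lemma weak_solution_estimate (n m j : ℕ) (hj : j ≤ m) {lam Λ : ℝ} (hlam : 0 < lam)
    (hΛ : 0 ≤ Λ) : ∃ K : ℝ≥0∞, K ≠ ∞ ∧ ∀ A : Coef n, CoefMeasurable A → CoefBounded m A Λ →
      Garding m A lam → ∀ (c : Fin n → ℝ) (s₀ ℓ : ℝ), 0 < ℓ →
      ∀ (u : Pt n → ℂ) (du : (Fin (n + 1) → ℕ) → Pt n → ℂ),
        HasWDerivs (Metric.ball ((c, s₀) : Pt n) ℓ) m u du →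
        (∀ γ : Fin (n + 1) → ℕ, (∑ i, γ i) ≤ m →
          ∫⁻ p in Metric.ball ((c, s₀) : Pt n) ℓ, ‖du γ p‖ₑ ^ 2 < ⊤) →
        WeakSolution m A (Metric.ball ((c, s₀) : Pt n) ℓ) du →
        Measurable (du (vmi n (j + 1))) →
        IsWeakDeriv (Metric.ball ((c, s₀) : Pt n) ℓ) (vmi n (j + 1)) u (du (vmi n (j + 1))) →
        ∫⁻ p in Metric.ball ((c, s₀) : Pt n) ℓ, ‖du (vmi n (j + 1)) p‖ₑ ^ 2 < ⊤ →
        ∀ᵐ τ ∂(volume.restrict (Ioo (s₀ - ℓ / 2) (s₀ + ℓ / 2))),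
          (ENNReal.ofReal ℓ ^ (n + 1))⁻¹ * ∑ γ ∈ MI n j,
            ∫⁻ p in Metric.ball ((c, s₀) : Pt n) (ℓ * (1 / 2)), ‖du γ p‖ₑ ^ 2 ≤
          K * (((ENNReal.ofReal ℓ ^ n)⁻¹ *
              ∫⁻ x in Metric.ball c (ℓ * (3 / 4)), ∑ γ ∈ MI n j, ‖du γ (x, τ)‖ₑ) ^ 2 +
            (ENNReal.ofReal ℓ * ((ENNReal.ofReal ℓ ^ (n + 1))⁻¹ *
              ∫⁻ p in Metric.ball ((c, s₀) : Pt n) (ℓ * (3 / 4)),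
                ‖du (vmi n (j + 1)) p‖ₑ)) ^ 2) := by
  obtain ⟨K, hK, hest⟩ := scaled_estimate n m j hj hlam hΛ
  refine ⟨2 * K, by finiteness, fun A hA hb hG c s₀ ℓ hℓ u du hdu hfin hsol hvm hvw hvfin => ?_⟩
  obtain ⟨D, hD, hest⟩ := hest A hA hb hG c s₀ ℓ hℓ
  set p₀ : Pt n := (c, s₀) with hp₀
  set U := Metric.ball p₀ (ℓ * (3 / 4)) with hUdef
  set S : Finset (Fin (n + 1) → ℕ) := insert (vmi n (j + 1)) (MI n j ∪ MI n m) with hS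
  have hord : ∀ γ ∈ MI n j ∪ MI n m, ∑ i, γ i ≤ m := by
    intro γ hγ
    rcases Finset.mem_union.1 hγ with h | h
    · rw [mem_MI.1 h]; exact hj
    · rw [mem_MI.1 h]
  have hSm : ∀ γ ∈ S, Measurable (du γ) := by
    intro γ hγ
    rcases Finset.mem_insert.1 hγ with rfl | h
    · exact hvm
    · exact (hdu.2 γ (hord γ h)).1
  have hSw : ∀ γ ∈ S, IsWeakDeriv (Metric.ball p₀ ℓ) γ u (du γ) := by
    intro γ hγ
    rcases Finset.mem_insert.1 hγ with rfl | h
    · exact hvw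
    · exact (hdu.2 γ (hord γ h)).2
  have hSf : ∀ γ ∈ S, ∫⁻ p in Metric.ball p₀ ℓ, ‖du γ p‖ₑ ^ 2 < ⊤ := by
    intro γ hγ
    rcases Finset.mem_insert.1 hγ with rfl | h
    · exact hvfin
    · exact hfin γ (hord γ h)
  have hui : Integrable ((Metric.ball p₀ ℓ).indicator u) := by
    have h1 := (hdu.2 (fun _ => 0) (by simp)).1
    have h2 := hfin (fun _ => 0) (by simp)
    rw [hdu.1] at h1 h2
    exact (indicator_ball_memLp h1 h2).2
  have hεr : ∀ k : ℕ, (((2⁻¹ : ℝ≥0∞) ^ k) ^ 2) = ENNReal.ofReal (((2⁻¹ : ℝ) ^ k) ^ 2) := by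
    intro k
    rw [ENNReal.ofReal_pow (by positivity), ENNReal.ofReal_pow (by positivity),
      ENNReal.ofReal_inv_of_pos (by norm_num)]
    norm_num
  have hε0 : ∀ k : ℕ, ((2⁻¹ : ℝ≥0∞) ^ k) ≠ 0 := fun k => pow_ne_zero _ (by simp)
  have hεt : ∀ k : ℕ, ((2⁻¹ : ℝ≥0∞) ^ k) ≠ ⊤ := fun k => by finiteness
  have happrox := fun k : ℕ => exists_smooth_approx hℓ S hui hSm hSw hSf
    (pow_ne_zero 2 (hε0 k))
  choose f hf hfd using happrox
  have hjS : ∀ γ ∈ MI n j, γ ∈ S := fun γ h =>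
    Finset.mem_insert_of_mem (Finset.mem_union_left _ h)
  have hmS : ∀ γ ∈ MI n m, γ ∈ S := fun γ h =>
    Finset.mem_insert_of_mem (Finset.mem_union_right _ h)
  have hvS : vmi n (j + 1) ∈ S := Finset.mem_insert_self _ _
  have hUfin : volume U ≠ ⊤ := measure_ball_lt_top.ne
  set e : ℕ → ℝ := fun k => (((MI n m).card : ℝ) + 1) ^ 3 * Λ ^ 2 * ((2⁻¹ : ℝ) ^ k) ^ 2 with he
  have hform : ∀ k, ∀ φ, IsTest U φ → ∀ s > 0, ‖form m A φ (f k)‖ ≤ s * energy m φ + e k / s := by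
    intro k φ hφ s hs
    exact norm_form_approx_le m hA hb measurableSet_ball
      (Metric.ball_subset_ball (by linarith)) hsol (fun γ h => hSm γ (hmS γ h)) (hf k)
      (by positivity) (fun γ h => by rw [← hεr]; exact hfd k γ (hmS γ h)) hφ hs
  have hL1 : ∀ k, ∀ γ ∈ S, ∫⁻ p in U, ‖mpd γ (f k) p - du γ p‖ₑ ≤
      (2⁻¹ : ℝ≥0∞) ^ k * (volume U + 1) := fun k γ hγ =>
    setLIntegral_le_of_sq_le (hε0 k) (hεt k) (hfd k γ hγ)
  have hdm : ∀ k, ∀ γ ∈ S, Measurable fun p => ‖mpd γ (f k) p - du γ p‖ₑ := fun k γ hγ =>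
    (((hf k).mpd γ).continuous.measurable.sub (hSm γ hγ)).enorm
  set F : ℕ → Pt n → ℝ≥0∞ := fun k p => ∑ γ ∈ MI n j, ‖mpd γ (f k) p - du γ p‖ₑ with hFdef
  have hFm : ∀ k, Measurable (F k) := fun k =>
    Finset.measurable_fun_sum _ fun γ hγ => hdm k γ (hjS γ hγ)
  have hslice := ae_tendsto_slice (μ := volume.restrict (Metric.ball c (ℓ * (3 / 4))))
    (ν := volume.restrict (Ioo (s₀ - ℓ / 2) (s₀ + ℓ / 2))) hFm
    (M := (MI n j).card * (volume U + 1)) (by finiteness) (fun k => by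
      rw [Measure.prod_restrict, ← Measure.volume_eq_prod]
      refine (lintegral_mono_set (prod_Ioo_subset_ball c s₀ hℓ)).trans ?_
      rw [hFdef]
      dsimp only
      rw [lintegral_finsetSum _ fun γ hγ => hdm k γ (hjS γ hγ)]
      refine (Finset.sum_le_sum fun γ hγ => hL1 k γ (hjS γ hγ)).trans (le_of_eq ?_)
      rw [Finset.sum_const, nsmul_eq_mul]; ring)
  filter_upwards [hslice, ae_restrict_mem measurableSet_Ioo] with τ hτ hτI
  set a := (ENNReal.ofReal ℓ ^ (n + 1))⁻¹ with ha
  set b := (ENNReal.ofReal ℓ ^ n)⁻¹ with hbdef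
  have hℓ' : ENNReal.ofReal ℓ ≠ 0 := by simpa using hℓ
  have haf : a ≠ ⊤ := ENNReal.inv_ne_top.2 (pow_ne_zero _ hℓ')
  have hbf : b ≠ ⊤ := ENNReal.inv_ne_top.2 (pow_ne_zero _ hℓ')
  set Y := ∫⁻ x in Metric.ball c (ℓ * (3 / 4)), ∑ γ ∈ MI n j, ‖du γ (x, τ)‖ₑ
  set Z := ∫⁻ p in U, ‖du (vmi n (j + 1)) p‖ₑ
  set T : ℕ → ℝ≥0∞ := fun k => ∫⁻ x in Metric.ball c (ℓ * (3 / 4)), F k (x, τ) with hT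
  set W : ℕ → ℝ≥0∞ := fun k => (2⁻¹ : ℝ≥0∞) ^ k * (volume U + 1) with hW
  set R : ℕ → ℝ≥0∞ := fun k => 2 * (K * ((b * (Y + T k)) ^ 2 +
    (ENNReal.ofReal ℓ * (a * (Z + W k))) ^ 2 + D * ENNReal.ofReal (e k))) +
      a * (2 * ((MI n j).card * ((2⁻¹ : ℝ≥0∞) ^ k) ^ 2)) with hR
  have hbound : ∀ k, a * ∑ γ ∈ MI n j, ∫⁻ p in Metric.ball p₀ (ℓ * (1 / 2)), ‖du γ p‖ₑ ^ 2 ≤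
      R k := by
    intro k
    have hk := hest (f k) (hf k) (e k) (by positivity) (hform k) τ hτI
    have hs1 : ∫⁻ x in Metric.ball c (ℓ * (3 / 4)), ordE j (f k) (x, τ) ≤ Y + T k := by
      have hFτ : Measurable fun x => F k (x, τ) := (hFm k).comp measurable_prodMk_right
      rw [hT]
      dsimp only
      rw [← lintegral_add_right _ hFτ]
      refine lintegral_mono fun x => ?_
      dsimp only
      rw [hFdef, ← Finset.sum_add_distrib]
      exact Finset.sum_le_sum fun γ _ => enorm_le_enorm_add_enorm_sub _ _
    have hs2 : ∫⁻ p in U, ‖mpd (vmi n (j + 1)) (f k) p‖ₑ ≤ Z + W k := by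
      refine le_trans ?_ (add_le_add_right (hL1 k _ hvS) _)
      rw [← lintegral_add_left hvm.enorm]
      exact lintegral_mono fun p => enorm_le_enorm_add_enorm_sub _ _
    have hs3 : ∑ γ ∈ MI n j, ∫⁻ p in Metric.ball p₀ (ℓ * (1 / 2)), ‖du γ p‖ₑ ^ 2 ≤
        2 * (∑ γ ∈ MI n j, ∫⁻ p in Metric.ball p₀ (ℓ * (1 / 2)), ‖mpd γ (f k) p‖ₑ ^ 2) +
          2 * ((MI n j).card * ((2⁻¹ : ℝ≥0∞) ^ k) ^ 2) := by
      have : ∀ γ ∈ MI n j, ∫⁻ p in Metric.ball p₀ (ℓ * (1 / 2)), ‖du γ p‖ₑ ^ 2 ≤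
          2 * (∫⁻ p in Metric.ball p₀ (ℓ * (1 / 2)), ‖mpd γ (f k) p‖ₑ ^ 2) +
            2 * ((2⁻¹ : ℝ≥0∞) ^ k) ^ 2 := by
        intro γ hγ
        refine (lintegral_mono fun p => enorm_sq_le_of_sub (mpd γ (f k) p) (du γ p)).trans ?_
        rw [lintegral_add_left ((((hf k).mpd γ).continuous.measurable.enorm.pow_const 2).const_mul
          2), lintegral_const_mul' _ _ (by simp), lintegral_const_mul' _ _ (by simp)]
        gcongr
        exact (lintegral_mono_set (Metric.ball_subset_ball (by linarith))).trans
          (hfd k γ (hjS γ hγ))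
      refine (Finset.sum_le_sum this).trans (le_of_eq ?_)
      rw [Finset.sum_add_distrib, ← Finset.mul_sum, Finset.sum_const, nsmul_eq_mul]; ring
    calc _ ≤ a * (2 * (∑ γ ∈ MI n j,
            ∫⁻ p in Metric.ball p₀ (ℓ * (1 / 2)), ‖mpd γ (f k) p‖ₑ ^ 2) +
          2 * ((MI n j).card * ((2⁻¹ : ℝ≥0∞) ^ k) ^ 2)) := by gcongr
      _ = 2 * (a * ∑ γ ∈ MI n j,
            ∫⁻ p in Metric.ball p₀ (ℓ * (1 / 2)), ‖mpd γ (f k) p‖ₑ ^ 2) +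
          a * (2 * ((MI n j).card * ((2⁻¹ : ℝ≥0∞) ^ k) ^ 2)) := by ring
      _ ≤ R k := by
        rw [hR]; dsimp only
        refine add_le_add (mul_le_mul_right (hk.trans ?_) _) le_rfl
        gcongr
  have hgeo : Filter.Tendsto (fun k : ℕ => (2⁻¹ : ℝ≥0∞) ^ k) Filter.atTop (nhds 0) :=
    ENNReal.tendsto_pow_atTop_nhds_zero_of_lt_one (by simp)
  have hgeo2 : Filter.Tendsto (fun k : ℕ => ((2⁻¹ : ℝ≥0∞) ^ k) ^ 2) Filter.atTop (nhds 0) := by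
    simpa using ENNReal.Tendsto.pow (n := 2) hgeo
  have hWl : Filter.Tendsto W Filter.atTop (nhds 0) := by
    simpa using ENNReal.Tendsto.mul_const hgeo (b := volume U + 1) (Or.inr (by finiteness))
  have hel : Filter.Tendsto (fun k => ENNReal.ofReal (e k)) Filter.atTop (nhds 0) := by
    have : ∀ k, ENNReal.ofReal (e k) = ENNReal.ofReal ((((MI n m).card : ℝ) + 1) ^ 3 * Λ ^ 2) *
        ((2⁻¹ : ℝ≥0∞) ^ k) ^ 2 := fun k => by
      rw [hεr, ← ENNReal.ofReal_mul (by positivity)]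
    simp_rw [this]
    simpa using ENNReal.Tendsto.const_mul hgeo2 (Or.inr ENNReal.ofReal_ne_top)
  have hlim : Filter.Tendsto R Filter.atTop (nhds (2 * (K * ((b * (Y + 0)) ^ 2 +
      (ENNReal.ofReal ℓ * (a * (Z + 0))) ^ 2 + D * 0)) +
        a * (2 * ((MI n j).card * 0)))) := by
    refine Filter.Tendsto.add ?_ ?_
    · refine ENNReal.Tendsto.const_mul (ENNReal.Tendsto.const_mul ?_ (Or.inr hK))
        (Or.inr (by finiteness))
      refine Filter.Tendsto.add (Filter.Tendsto.add ?_ ?_) ?_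
      · exact ENNReal.Tendsto.pow
          (ENNReal.Tendsto.const_mul (tendsto_const_nhds.add hτ) (Or.inr hbf))
      · exact ENNReal.Tendsto.pow (ENNReal.Tendsto.const_mul (ENNReal.Tendsto.const_mul
          (tendsto_const_nhds.add hWl) (Or.inr haf)) (Or.inr ENNReal.ofReal_ne_top))
      · exact ENNReal.Tendsto.const_mul hel (Or.inr hD)
    · exact ENNReal.Tendsto.const_mul (ENNReal.Tendsto.const_mul (ENNReal.Tendsto.const_mul hgeo2
        (Or.inr (ENNReal.natCast_ne_top _))) (Or.inr (by finiteness))) (Or.inr haf)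
  refine (ge_of_tendsto' hlim hbound).trans (le_of_eq ?_)
  simp only [add_zero, mul_zero, mul_assoc]

lemma cube_eq_ball (c : Fin n → ℝ) {ℓ : ℝ} (hℓ : 0 < ℓ) : cube c ℓ = Metric.ball c (ℓ / 2) := by
  ext x
  simp only [cube, mem_ofPred_eq, Metric.mem_ball, dist_pi_lt_iff (half_pos hℓ), Real.dist_eq]

lemma cube_prod_Ioo_eq_ball (c : Fin n → ℝ) (s₀ : ℝ) {ℓ : ℝ} (hℓ : 0 < ℓ) :
    cube c ℓ ×ˢ Ioo (s₀ - ℓ / 2) (s₀ + ℓ / 2) = Metric.ball ((c, s₀) : Pt n) (ℓ / 2) := by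
  rw [cube_eq_ball c hℓ, ← ball_prod_same, Real.ball_eq_Ioo]

lemma volume_cube (c : Fin n → ℝ) {ℓ : ℝ} (hℓ : 0 < ℓ) :
    volume (cube c ℓ) = ENNReal.ofReal ℓ ^ n := by
  rw [cube_eq_ball c hℓ, Real.volume_pi_ball c (half_pos hℓ), mul_div_cancel₀ _ two_ne_zero,
    Fintype.card_fin, ENNReal.ofReal_pow hℓ.le]

lemma volume_cube_prod_Ioo (c : Fin n → ℝ) (s₀ : ℝ) {ℓ : ℝ} (hℓ : 0 < ℓ) :
    volume (cube c ℓ ×ˢ Ioo (s₀ - ℓ / 2) (s₀ + ℓ / 2)) = ENNReal.ofReal ℓ ^ (n + 1) := by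
  rw [Measure.volume_eq_prod, Measure.prod_prod, volume_cube c hℓ, Real.volume_Ioo, pow_succ]
  congr 2
  ring

lemma sum_enorm_le_gradSq (j : ℕ) (du : (Fin (n + 1) → ℕ) → Pt n → ℂ) (p : Pt n) :
    ∑ γ ∈ MI n j, ‖du γ p‖ₑ ≤ (MI n j).card * gradSq j du p ^ (1 / 2 : ℝ) := by
  rw [← nsmul_eq_mul]
  refine Finset.sum_le_card_nsmul _ _ _ fun γ hγ => ?_
  calc ‖du γ p‖ₑ = (‖du γ p‖ₑ ^ 2) ^ (1 / 2 : ℝ) := by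
        rw [← ENNReal.rpow_natCast, ← ENNReal.rpow_mul]; norm_num
    _ ≤ _ := by
        gcongr
        exact Finset.single_le_sum (f := fun γ => (‖du γ p‖₊ : ℝ≥0∞) ^ 2)
          (fun _ _ => zero_le) hγ

/-- Passing from an average over a ball of radius `3 / 4` to one over the doubled ball. -/
lemma inv_pow_mul_eq (k : ℕ) (ℓ : ℝ) (X : ℝ≥0∞) :
    (ENNReal.ofReal ℓ ^ k)⁻¹ * X = 2 ^ k * (X / ENNReal.ofReal (2 * ℓ) ^ k) := by
  have h2 : ENNReal.ofReal (2 * ℓ) = 2 * ENNReal.ofReal ℓ := by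
    rw [ENNReal.ofReal_mul (by norm_num)]; norm_num
  rw [h2, mul_pow, div_eq_mul_inv, ENNReal.mul_inv (Or.inl (by simp)) (Or.inl (by finiteness)),
    mul_left_comm X, ← mul_assoc, ENNReal.mul_inv_cancel (by simp) (by finiteness), one_mul,
    mul_comm]

end

/-- (Lemma `lem:iterate`.)  For `t`-independent coefficients satisfying
the Gårding inequality and a weak solution `u` of `Lu = 0` on `2Q̃`,
`⨍_{Q̃} |∇^j u|² ≤ C ℓ(Q)² (⨍_{2Q̃} |∂_t^{j+1}u|)² + C (⨍_{2Q} |∇^j u(·,τ)|)²`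
for a.e. `τ ∈ (s₀ − ℓ(Q)/2, s₀ + ℓ(Q)/2)`. -/
theorem statement6 (n m : ℕ) (hm : 1 ≤ m) (lam Λ : ℝ) (hlam : 0 < lam) :
    ∃ C : ℝ≥0∞, 0 < C ∧ C < ⊤ ∧
      ∀ A : Coef n, CoefMeasurable A → CoefBounded m A Λ → TIndep A → Garding m A lam →
      ∀ (c : Fin n → ℝ) (ℓ s₀ : ℝ), 0 < ℓ →
      ∀ (u : (Fin n → ℝ) × ℝ → ℂ)
        (du : (Fin (n + 1) → ℕ) → (Fin n → ℝ) × ℝ → ℂ),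
        HasWDerivs ((cube c (2 * ℓ)) ×ˢ Ioo (s₀ - ℓ) (s₀ + ℓ)) m u du →
        (∀ γ : Fin (n + 1) → ℕ, (∑ i, γ i) ≤ m →
          (∫⁻ p in (cube c (2 * ℓ)) ×ˢ Ioo (s₀ - ℓ) (s₀ + ℓ),
            (‖du γ p‖₊ : ℝ≥0∞) ^ 2) < ⊤) →
        WeakSolution m A ((cube c (2 * ℓ)) ×ˢ Ioo (s₀ - ℓ) (s₀ + ℓ)) du →
        ∀ j : ℕ, j ≤ m →
          Measurable (du (vmi n (j + 1))) →
          IsWeakDeriv ((cube c (2 * ℓ)) ×ˢ Ioo (s₀ - ℓ) (s₀ + ℓ)) (vmi n (j + 1))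
            u (du (vmi n (j + 1))) →
          (∫⁻ p in (cube c (2 * ℓ)) ×ˢ Ioo (s₀ - ℓ) (s₀ + ℓ),
            (‖du (vmi n (j + 1)) p‖₊ : ℝ≥0∞) ^ 2) < ⊤ →
          ∀ᵐ τ ∂(volume.restrict (Ioo (s₀ - ℓ / 2) (s₀ + ℓ / 2))),
            (∫⁻ p in (cube c ℓ) ×ˢ Ioo (s₀ - ℓ / 2) (s₀ + ℓ / 2), gradSq j du p) /
                volume ((cube c ℓ) ×ˢ Ioo (s₀ - ℓ / 2) (s₀ + ℓ / 2)) ≤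
              C * (ENNReal.ofReal ℓ) ^ 2 *
                ((∫⁻ p in (cube c (2 * ℓ)) ×ˢ Ioo (s₀ - ℓ) (s₀ + ℓ),
                    (‖du (vmi n (j + 1)) p‖₊ : ℝ≥0∞)) /
                  volume ((cube c (2 * ℓ)) ×ˢ Ioo (s₀ - ℓ) (s₀ + ℓ))) ^ 2 +
              C * ((∫⁻ x in cube c (2 * ℓ), (gradSq j du (x, τ)) ^ (1/2 : ℝ)) /
                  volume (cube c (2 * ℓ))) ^ 2 := by
  have hex := fun j : Fin (m + 1) => weak_solution_estimate n m j (Nat.lt_succ_iff.1 j.2) hlam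
    (le_max_right Λ 0)
  choose K hK hest using hex
  set B : Fin (m + 1) → ℝ≥0∞ := fun j =>
    K j * (((MI n j).card * 2 ^ n) ^ 2 + (2 ^ (n + 1)) ^ 2) with hB
  have hBfin : ∀ j, B j ≠ ⊤ := fun j => by
    have := hK j
    rw [hB]; dsimp only; finiteness
  refine ⟨1 + ∑ j, B j, by simp, ?_, ?_⟩
  · exact (ENNReal.add_ne_top.2 ⟨one_ne_top, ENNReal.sum_ne_top.2 fun j _ => hBfin j⟩).lt_top
  intro A hA hb _ hG c ℓ s₀ hℓ u du hdu hfin hsol j hj hvm hvw hvfin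
  have hb' : CoefBounded m A (max Λ 0) := fun α hα β hβ =>
    (hb α hα β hβ).mono fun p hp => hp.trans (le_max_left _ _)
  have hbig : cube c (2 * ℓ) ×ˢ Ioo (s₀ - ℓ) (s₀ + ℓ) = Metric.ball ((c, s₀) : Pt n) ℓ := by
    simpa using cube_prod_Ioo_eq_ball c s₀ (ℓ := 2 * ℓ) (by positivity)
  have hvol : volume (cube c (2 * ℓ) ×ˢ Ioo (s₀ - ℓ) (s₀ + ℓ)) =
      ENNReal.ofReal (2 * ℓ) ^ (n + 1) := by
    simpa using volume_cube_prod_Ioo c s₀ (ℓ := 2 * ℓ) (by positivity)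
  rw [hvol]
  rw [hbig] at hdu hfin hsol hvw hvfin ⊢
  have hgrad : ∫⁻ p in (cube c ℓ) ×ˢ Ioo (s₀ - ℓ / 2) (s₀ + ℓ / 2), gradSq j du p =
      ∑ γ ∈ MI n j, ∫⁻ p in Metric.ball ((c, s₀) : Pt n) (ℓ * (1 / 2)), ‖du γ p‖ₑ ^ 2 := by
    rw [cube_prod_Ioo_eq_ball c s₀ hℓ, mul_one_div]
    refine lintegral_finsetSum _ fun γ hγ => ?_
    exact (hdu.2 γ ((mem_MI.1 hγ).trans_le hj)).1.enorm.pow_const 2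
  rw [hgrad, volume_cube_prod_Ioo c s₀ hℓ, volume_cube c (by positivity : 0 < 2 * ℓ)]
  have hcube : cube c (2 * ℓ) = Metric.ball c ℓ := by
    simpa using cube_eq_ball c (ℓ := 2 * ℓ) (by positivity)
  rw [hcube]
  have h34 : ℓ * (3 / 4) ≤ ℓ := by linarith
  filter_upwards [hest ⟨j, Nat.lt_succ_of_le hj⟩ A hA hb' hG c s₀ ℓ hℓ u du hdu hfin hsol hvm hvw
    hvfin] with τ hτ
  rw [div_eq_mul_inv, mul_comm]
  refine hτ.trans ?_
  have hBj : B ⟨j, Nat.lt_succ_of_le hj⟩ ≤ 1 + ∑ i, B i :=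
    (Finset.single_le_sum (f := B) (fun _ _ => zero_le) (Finset.mem_univ _)).trans le_add_self
  rw [hB] at hBj
  dsimp only at hBj
  rw [inv_pow_mul_eq n ℓ, inv_pow_mul_eq (n + 1) ℓ]
  set k := K ⟨j, Nat.lt_succ_of_le hj⟩
  set C := 1 + ∑ i, B i
  set Z := (∫⁻ p in Metric.ball ((c, s₀) : Pt n) ℓ, (‖du (vmi n (j + 1)) p‖₊ : ℝ≥0∞)) /
    ENNReal.ofReal (2 * ℓ) ^ (n + 1)
  set Y := (∫⁻ x in Metric.ball c ℓ, gradSq j du (x, τ) ^ (1 / 2 : ℝ)) /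
    ENNReal.ofReal (2 * ℓ) ^ n
  have hZle : (∫⁻ p in Metric.ball ((c, s₀) : Pt n) (ℓ * (3 / 4)), ‖du (vmi n (j + 1)) p‖ₑ) /
      ENNReal.ofReal (2 * ℓ) ^ (n + 1) ≤ Z :=
    ENNReal.div_le_div_right (lintegral_mono_set (Metric.ball_subset_ball h34)) _
  have hYle : (∫⁻ x in Metric.ball c (ℓ * (3 / 4)), ∑ γ ∈ MI n j, ‖du γ (x, τ)‖ₑ) /
      ENNReal.ofReal (2 * ℓ) ^ n ≤ (MI n j).card * Y := by
    refine (ENNReal.div_le_div_right ?_ _).trans_eq (mul_div_assoc _ _ _)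
    rw [← lintegral_const_mul' _ _ (ENNReal.natCast_ne_top _)]
    exact (lintegral_mono_set (Metric.ball_subset_ball h34)).trans
      (lintegral_mono fun x => sum_enorm_le_gradSq j du (x, τ))
  set N : ℝ≥0∞ := ((MI n j).card : ℝ≥0∞)
  calc _ ≤ k * ((2 ^ n * (N * Y)) ^ 2 + (ENNReal.ofReal ℓ * (2 ^ (n + 1) * Z)) ^ 2) := by gcongr
    _ = k * (2 ^ (n + 1)) ^ 2 * ENNReal.ofReal ℓ ^ 2 * Z ^ 2 + k * (N * 2 ^ n) ^ 2 * Y ^ 2 := by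
        ring
    _ ≤ C * ENNReal.ofReal ℓ ^ 2 * Z ^ 2 + C * Y ^ 2 := by
        have h1 : k * (2 ^ (n + 1)) ^ 2 ≤ C := le_trans (by gcongr; exact le_add_self) hBj
        have h2 : k * (N * 2 ^ n) ^ 2 ≤ C := le_trans (by gcongr; exact le_self_add) hBj
        gcongr

end
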